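/- Let k ≥ 1 be an integer and let P ∈ ℝ[x₀,x₁,x₂] be a nonzero homogeneous polynomial of degree 2k whose image in ℂ[x₀,x₁,x₂] is squarefree (i.e., the plane curve C = {P = 0} ⊂ ℙ²(ℂ) is reduced). If the real projective zero set ℝZ(P) = {[x] ∈ ℙ²(ℝ) : P(x) = 0} is finite, then its cardinality satisfies |ℝZ(P)| ≤ (3/2)·k·(k−1) + 1. -/

import Mathlib

open MvPolynomial

/-- The real projective zero set of a homogeneous polynomial in three variables:
the set of points of `ℙ²(ℝ)` at which (a representative of) the point evaluates to zero. -/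
noncomputable def RZ (P : MvPolynomial (Fin 3) ℝ) : Set (Projectivization ℝ (Fin 3 → ℝ)) :=
  {x | MvPolynomial.eval x.rep P = 0}


/-- polynomials in two variables all of whose monomials have degree `< m` -/
noncomputable def DL (m : ℕ) : Submodule ℂ (MvPolynomial (Fin 2) ℂ) :=
  restrictSupport ℂ {s | s.degree < m}

lemma mem_DL {m : ℕ} {g : MvPolynomial (Fin 2) ℂ} :
    g ∈ DL m ↔ ∀ s ∈ g.support, s.degree < m := by
  rw [DL, mem_restrictSupport_iff]; rfl

lemma DL_mono {m n : ℕ} (h : m ≤ n) {g : MvPolynomial (Fin 2) ℂ} (hg : g ∈ DL m) : g ∈ DL n := by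
  rw [mem_DL] at *
  intro s hs; exact lt_of_lt_of_le (hg s hs) h

lemma DL_zero {g : MvPolynomial (Fin 2) ℂ} (hg : g ∈ DL 0) : g = 0 := by
  rw [mem_DL] at hg
  rw [← support_eq_empty, Finset.eq_empty_iff_forall_notMem]
  intro s hs; exact absurd (hg s hs) (by omega)

lemma DL_mul {m n : ℕ} {a b : MvPolynomial (Fin 2) ℂ} (ha : a ∈ DL m) (hb : b ∈ DL n) :
    a * b ∈ DL (m + n - 1) := by
  classical
  rw [mem_DL] at *
  intro s hs
  obtain ⟨i, hi, j, hj, rfl⟩ := Finset.mem_add.1 (support_mul a b hs)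
  have := ha i hi
  have := hb j hj
  rw [map_add]; omega

lemma DL_mul' {m n : ℕ} {a b : MvPolynomial (Fin 2) ℂ} (ha : a ∈ DL m) (hb : b ∈ DL (n + 1)) :
    a * b ∈ DL (m + n) := by
  have := DL_mul ha hb
  rwa [show m + (n + 1) - 1 = m + n by omega] at this

/-- for use with `m - 1` -/
lemma DL_mul_pred {m n : ℕ} {a b : MvPolynomial (Fin 2) ℂ} (ha : a ∈ DL (m - 1))
    (hb : b ∈ DL (n + 1)) : a * b ∈ DL (m + n - 1) := by
  rcases m with _ | m
  · rw [DL_zero ha, zero_mul]; exact zero_mem _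
  · have := DL_mul' ha hb
    refine DL_mono ?_ this; omega

lemma DL_of_hom {m n : ℕ} {a : MvPolynomial (Fin 2) ℂ} (ha : a.IsHomogeneous m) (h : m < n) :
    a ∈ DL n := by
  rw [mem_DL]; intro s hs
  have : s.degree = m := by
    rw [Finsupp.degree_eq_weight_one]; exact ha (mem_support_iff.1 hs)
  simpa [this] using h

lemma eq_zero_of_hom_DL {m : ℕ} {a : MvPolynomial (Fin 2) ℂ} (ha : a.IsHomogeneous m)
    (h : a ∈ DL m) : a = 0 := by
  rw [mem_DL] at h
  rw [← support_eq_empty, Finset.eq_empty_iff_forall_notMem]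
  intro s hs
  have : s.degree = m := by
    rw [Finsupp.degree_eq_weight_one]; exact ha (mem_support_iff.1 hs)
  have h2 := h s hs
  rw [← this] at h2
  exact lt_irrefl _ h2

lemma DL_split {n : ℕ} {a : MvPolynomial (Fin 2) ℂ} (ha : a ∈ DL n) :
    ∃ a0 : MvPolynomial (Fin 2) ℂ, a0.IsHomogeneous (n - 1) ∧ a0 ∈ DL n ∧ a - a0 ∈ DL (n - 1) := by
  classical
  rcases n with _ | n
  · exact ⟨0, isHomogeneous_zero _ _ _, zero_mem _, by rw [DL_zero ha, sub_zero]; exact zero_mem _⟩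
  · refine ⟨homogeneousComponent n a, homogeneousComponent_isHomogeneous n a,
      DL_of_hom (homogeneousComponent_isHomogeneous n a) (Nat.lt_succ_self n), ?_⟩
    rw [mem_DL] at *
    intro s hs
    rw [mem_support_iff, coeff_sub, coeff_homogeneousComponent] at hs
    by_cases h : s.degree = n
    · simp [h] at hs
    · have : s ∈ a.support := by
        rw [mem_support_iff]; simpa [h] using hs
      have := ha s this
      simp; omega

lemma DL_of_mul {n e : ℕ} {c G : MvPolynomial (Fin 2) ℂ} (hG : G.IsHomogeneous e) (hG0 : G ≠ 0)
    (h : c * G ∈ DL n) : c ∈ DL (n - e) := by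
  by_cases hc : c = 0
  · rw [hc]; exact zero_mem _
  have h1 := totalDegree_mul_of_isDomain hc hG0
  rw [hG.totalDegree hG0] at h1
  have h2 : (c * G).totalDegree < n := by
    have hne : c * G ≠ 0 := mul_ne_zero hc hG0
    obtain ⟨s, hs, hs'⟩ := Finset.exists_mem_eq_sup (c * G).support (by simpa using hne)
      (fun s => s.sum fun _ e => e)
    rw [totalDegree, hs']
    exact (mem_DL.1 h) s hs
  rw [mem_DL]
  intro s hs
  have : s.degree ≤ c.totalDegree := le_totalDegree hs
  omega

lemma DL_mul_lt {m n t : ℕ} {a b : MvPolynomial (Fin 2) ℂ} (ha : a ∈ DL m)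
    (hb : b ∈ DL n) (h : 0 < m → 0 < n → m + n ≤ t + 1) : a * b ∈ DL t := by
  rcases m with _ | m
  · rw [DL_zero ha, zero_mul]; exact zero_mem _
  rcases n with _ | n
  · rw [DL_zero hb, mul_zero]; exact zero_mem _
  have := h (by omega) (by omega)
  exact DL_mono (by omega) (DL_mul ha hb)

lemma DL_of_top {d : ℕ} {u F : MvPolynomial (Fin 2) ℂ} (hF : F.IsHomogeneous d)
    (hu : u - F ∈ DL d) : u ∈ DL (d + 1) := by
  have := add_mem (DL_mono (Nat.le_succ d) hu) (DL_of_hom hF (Nat.lt_succ_self d))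
  simpa using this

/-- a key lemma: bounded representation -/
lemma syz {d e : ℕ} {u v F G : MvPolynomial (Fin 2) ℂ} (hF : F.IsHomogeneous d)
    (hG : G.IsHomogeneous e) (hu : u - F ∈ DL d) (hv : v - G ∈ DL e) (hFG : IsRelPrime F G)
    (hG0 : G ≠ 0) (m : ℕ) :
    ∀ (j t : ℕ) (α β : MvPolynomial (Fin 2) ℂ), t ≤ m + j →
      α ∈ DL (t - d) → β ∈ DL (t - e) → α * u + β * v ∈ DL m →
      ∃ γ ∈ DL (t - d - e), α - γ * v ∈ DL (m - d) ∧ β + γ * u ∈ DL (m - e) := by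
  have hu1 := DL_of_top hF hu
  have hv1 := DL_of_top hG hv
  intro j
  induction j with
  | zero =>
    intro t α β h2 hα hβ _
    refine ⟨0, zero_mem _, ?_, ?_⟩
    · simpa using DL_mono (by omega) hα
    · simpa using DL_mono (by omega) hβ
  | succ j ih =>
    intro t α β h2 hα hβ h
    by_cases hle : t ≤ m + j
    · exact ih t α β hle hα hβ h
    obtain ⟨α0, hα0, hα0', hα1⟩ := DL_split hα
    obtain ⟨β0, hβ0, hβ0', hβ1⟩ := DL_split hβ
    have key : α0 * F + β0 * G = 0 := by
      apply eq_zero_of_hom_DL (m := t - 1)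
      · apply IsHomogeneous.add
        · rcases Nat.eq_zero_or_pos (t - d) with h0 | h0
          · rw [h0] at hα0'
            rw [DL_zero hα0', zero_mul]; exact isHomogeneous_zero _ _ _
          · have := hα0.mul hF
            convert this using 1; omega
        · rcases Nat.eq_zero_or_pos (t - e) with h0 | h0
          · rw [h0] at hβ0'
            rw [DL_zero hβ0', zero_mul]; exact isHomogeneous_zero _ _ _
          · have := hβ0.mul hG
            convert this using 1; omega
      · have e1 : α0 * F + β0 * G = (α * u + β * v) - (α - α0) * u - (β - β0) * v
            - α0 * (u - F) - β0 * (v - G) := by ring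
        rw [e1]
        refine sub_mem (sub_mem (sub_mem (sub_mem ?_ ?_) ?_) ?_) ?_
        · exact DL_mono (by omega) h
        · exact DL_mul_lt hα1 hu1 (by omega)
        · exact DL_mul_lt hβ1 hv1 (by omega)
        · exact DL_mul_lt hα0' hu (by omega)
        · exact DL_mul_lt hβ0' hv (by omega)
    have hdvd : G ∣ α0 := by
      have : G ∣ F * α0 := ⟨-β0, by linear_combination key⟩
      exact hFG.symm.dvd_of_dvd_mul_left this
    obtain ⟨c, hc⟩ := hdvd
    have hβ0c : β0 = - c * F := by
      apply mul_right_cancel₀ hG0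
      rw [hc] at key
      linear_combination key
    have hcD : c ∈ DL (t - d - e) := DL_of_mul hG hG0 (by rw [mul_comm, ← hc]; exact hα0')
    have hA : α - c * v ∈ DL (t - 1 - d) := by
      have : α - c * v = (α - α0) - c * (v - G) := by rw [hc]; ring
      rw [this]
      exact sub_mem (DL_mono (by omega) hα1) (DL_mul_lt hcD hv (by omega))
    have hB : β + c * u ∈ DL (t - 1 - e) := by
      have : β + c * u = (β - β0) + c * (u - F) := by rw [hβ0c]; ring
      rw [this]
      exact add_mem (DL_mono (by omega) hβ1) (DL_mul_lt hcD hu (by omega))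
    obtain ⟨γ, hγ, h3, h4⟩ := ih (t - 1) (α - c * v) (β + c * u) (by omega)
        hA hB (by convert h using 1; ring)
    refine ⟨γ + c, add_mem (DL_mono (by omega) hγ) hcD, ?_, ?_⟩
    · convert h3 using 1; ring
    · convert h4 using 1; ring

lemma exists_DL (g : MvPolynomial (Fin 2) ℂ) : ∃ n, ∀ m, n ≤ m → g ∈ DL m := by
  refine ⟨g.totalDegree + 1, fun m hm => ?_⟩
  rw [mem_DL]; intro s hs
  have : s.degree ≤ g.totalDegree := le_totalDegree hs
  omega

/-- elements of the ideal have a representation with degree bounds -/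
lemma ideal_bdd {d e : ℕ} {u v F G : MvPolynomial (Fin 2) ℂ} (hF : F.IsHomogeneous d)
    (hG : G.IsHomogeneous e) (hu : u - F ∈ DL d) (hv : v - G ∈ DL e) (hFG : IsRelPrime F G)
    (hG0 : G ≠ 0) {m : ℕ} {g : MvPolynomial (Fin 2) ℂ} (hg : g ∈ Ideal.span {u, v})
    (hgm : g ∈ DL m) :
    ∃ α ∈ DL (m - d), ∃ β ∈ DL (m - e), g = α * u + β * v := by
  obtain ⟨α, β, rfl⟩ := Ideal.mem_span_pair.1 hg
  obtain ⟨n1, h1⟩ := exists_DL α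
  obtain ⟨n2, h2⟩ := exists_DL β
  obtain ⟨γ, -, h3, h4⟩ := syz hF hG hu hv hFG hG0 m (n1 + d + n2 + e) (n1 + d + n2 + e) α β
    (by omega) (h1 _ (by omega)) (h2 _ (by omega)) hgm
  exact ⟨_, h3, _, h4, by ring⟩


lemma set_deg_eq (m : ℕ) : {s : Fin 2 →₀ ℕ | s.degree < m} =
    ((((Finset.range m).sigma (fun n => Finset.HasAntidiagonal.antidiagonal n)).image
      (fun q : (Σ _ : ℕ, ℕ × ℕ) => (Finsupp.single 0 q.2.1 + Finsupp.single 1 q.2.2 : Fin 2 →₀ ℕ)) :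
      Finset (Fin 2 →₀ ℕ)) : Set (Fin 2 →₀ ℕ)) := by
  ext s
  simp only [Set.mem_ofPred_eq, Finset.coe_image, Set.mem_image, Finset.mem_coe, Finset.mem_sigma,
    Finset.mem_range, Finset.HasAntidiagonal.mem_antidiagonal]
  constructor
  · intro h
    refine ⟨⟨s.degree, (s 0, s 1)⟩, ⟨h, ?_⟩, ?_⟩
    · simp [Finsupp.degree_eq_sum]
    · ext i; fin_cases i <;> simp
  · rintro ⟨⟨n, a, b⟩, ⟨h1, h2⟩, rfl⟩
    simp only at h1 h2 ⊢
    simp [Finsupp.degree_eq_sum]; omega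

lemma ncard_deg (m : ℕ) : 2 * {s : Fin 2 →₀ ℕ | s.degree < m}.ncard = m * (m + 1) := by
  rw [set_deg_eq, Set.ncard_coe_finset, Finset.card_image_of_injOn, Finset.card_sigma]
  · simp only [Finset.Nat.card_antidiagonal]
    induction m with
    | zero => simp
    | succ n ih => rw [Finset.sum_range_succ, mul_add, ih]; ring
  · rintro ⟨n, a, b⟩ h ⟨n', a', b'⟩ h' heq
    simp only [Finset.coe_sigma, Set.mem_sigma_iff, Finset.mem_coe, Finset.HasAntidiagonal.mem_antidiagonal] at h h'
    have h0 := DFunLike.congr_fun heq 0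
    have h1 := DFunLike.congr_fun heq 1
    simp at h0 h1
    obtain ⟨_, rfl⟩ := h
    obtain ⟨_, rfl⟩ := h'
    subst h0; subst h1; rfl

lemma finite_deg (m : ℕ) : {s : Fin 2 →₀ ℕ | s.degree < m}.Finite := by
  rw [set_deg_eq]; exact Finset.finite_toSet _

instance (m : ℕ) : FiniteDimensional ℂ (DL m) := by
  haveI := (finite_deg m).to_subtype
  exact Module.Finite.of_basis (basisRestrictSupport ℂ {s : Fin 2 →₀ ℕ | s.degree < m})

lemma finrank_DL (m : ℕ) : 2 * Module.finrank ℂ (DL m) = m * (m + 1) := by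
  have := Module.finrank_eq_nat_card_basis
    (basisRestrictSupport ℂ {s : Fin 2 →₀ ℕ | s.degree < m})
  rw [← ncard_deg]
  congr 1

lemma lin_mem_DL (i : Fin 2) (c : ℂ) : (X i - C c : MvPolynomial (Fin 2) ℂ) ∈ DL 2 := by
  refine sub_mem (DL_of_hom (isHomogeneous_X ℂ i) (by omega)) (DL_of_hom (m := 0) ?_ (by omega))
  exact isHomogeneous_C _ _

/-- interpolation -/
lemma interp (S : Finset (Fin 2 → ℂ)) (p : Fin 2 → ℂ) (hp : p ∉ S) :
    ∃ g ∈ DL (S.card + 1), eval p g ≠ 0 ∧ ∀ q ∈ S, eval q g = 0 := by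
  classical
  induction S using Finset.induction_on with
  | empty => exact ⟨1, DL_of_hom (m := 0) (isHomogeneous_one _ _) (by simp), by simp, by simp⟩
  | insert q S hq ih =>
    obtain ⟨g, hg, hgp, hgS⟩ := ih (fun h => hp (Finset.mem_insert_of_mem h))
    have hne : p ≠ q := fun h => hp (h ▸ Finset.mem_insert_self _ _)
    obtain ⟨i, hi⟩ := Function.ne_iff.1 hne
    refine ⟨g * (X i - C (q i)), ?_, ?_, ?_⟩
    · rw [Finset.card_insert_of_notMem hq]
      exact DL_mul' hg (lin_mem_DL i _)
    · simp only [map_mul, map_sub, eval_X, eval_C]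
      exact mul_ne_zero hgp (sub_ne_zero.2 hi)
    · intro r hr
      rcases Finset.mem_insert.1 hr with rfl | hr
      · simp
      · simp [hgS r hr]

noncomputable def evS (S : Finset (Fin 2 → ℂ)) : MvPolynomial (Fin 2) ℂ →ₗ[ℂ] (S → ℂ) :=
  LinearMap.pi fun p => (aeval (p : Fin 2 → ℂ)).toLinearMap

lemma evS_apply (S : Finset (Fin 2 → ℂ)) (g : MvPolynomial (Fin 2) ℂ) (p : S) :
    evS S g p = eval (p : Fin 2 → ℂ) g := by
  simp [evS, aeval_eq_eval]

lemma evS_surj (S : Finset (Fin 2 → ℂ)) (m : ℕ) (hm : S.card ≤ m) :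
    Function.Surjective ((evS S).domRestrict (DL m)) := by
  classical
  have h : ∀ p : S, ∃ g ∈ DL m, evS S g = Pi.single p 1 := by
    intro p
    obtain ⟨g, hg, hgp, hgS⟩ := interp (S.erase p) p (by simp)
    refine ⟨(eval (p : Fin 2 → ℂ) g)⁻¹ • g, Submodule.smul_mem _ _ (DL_mono ?_ hg), ?_⟩
    · have := Finset.card_erase_lt_of_mem p.2; omega
    · ext q
      rw [evS_apply, smul_eval]
      by_cases hq : q = p
      · subst hq; simp [hgp]
      · rw [hgS q (by simp [hq, Subtype.coe_ne_coe.2 hq])]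
        simp [hq]
  choose g hg hg2 using h
  intro c
  refine ⟨⟨∑ p, c p • g p, Submodule.sum_mem _ fun p _ => Submodule.smul_mem _ _ (hg p)⟩, ?_⟩
  rw [LinearMap.domRestrict_apply]
  simp only [map_sum, map_smul, hg2]
  ext q
  simp [Finset.sum_apply, Pi.single_apply]

/-- Bezout bound -/
lemma bez {d e : ℕ} {u v F G : MvPolynomial (Fin 2) ℂ} (hF : F.IsHomogeneous d)
    (hG : G.IsHomogeneous e) (hu : u - F ∈ DL d) (hv : v - G ∈ DL e) (hFG : IsRelPrime F G)
    (hG0 : G ≠ 0) (S : Finset (Fin 2 → ℂ))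
    (hS : ∀ p ∈ S, eval p u = 0 ∧ eval p v = 0) : S.card ≤ d * e := by
  have hu1 := DL_of_top hF hu
  have hv1 := DL_of_top hG hv
  obtain ⟨s, hs⟩ : ∃ s, s = S.card := ⟨_, rfl⟩
  let Φ : (DL (e + s) × DL (d + s)) →ₗ[ℂ] DL (d + e + s) :=
    LinearMap.coprod
      (((LinearMap.mulRight ℂ u).comp (DL (e + s)).subtype).codRestrict (DL (d + e + s))
        (fun a => DL_mul_lt a.2 hu1 (by omega)))
      (((LinearMap.mulRight ℂ v).comp (DL (d + s)).subtype).codRestrict (DL (d + e + s))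
        (fun a => DL_mul_lt a.2 hv1 (by omega)))
  have hΦ : ∀ a b, ((Φ (a, b) : DL (d + e + s)) : MvPolynomial (Fin 2) ℂ) = a * u + b * v := by
    intro a b; rfl
  let Ψ : DL s →ₗ[ℂ] (DL (e + s) × DL (d + s)) :=
    LinearMap.prod
      (((LinearMap.mulRight ℂ v).comp (DL s).subtype).codRestrict (DL (e + s))
        (fun a => DL_mul_lt a.2 hv1 (by omega)))
      (((LinearMap.mulRight ℂ (-u)).comp (DL s).subtype).codRestrict (DL (d + s))
        (fun a => DL_mul_lt a.2 (neg_mem hu1) (by omega)))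
  have hker : LinearMap.ker Φ ≤ LinearMap.range Ψ := by
    rintro ⟨a, b⟩ hab
    rw [LinearMap.mem_ker] at hab
    have h1 := hΦ a b
    rw [hab] at h1
    obtain ⟨γ, hγ, h3, h4⟩ := syz hF hG hu hv hFG hG0 0 (d + e + s) (d + e + s) a b (by omega)
      (DL_mono (by omega) a.2) (DL_mono (by omega) b.2) (by rw [← h1]; exact zero_mem _)
    have h3 := DL_zero (DL_mono (by omega) h3)
    have h4 := DL_zero (DL_mono (by omega) h4)
    refine ⟨⟨γ, DL_mono (by omega) hγ⟩, ?_⟩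
    ext1
    · apply Subtype.ext
      change γ * v = (a : MvPolynomial (Fin 2) ℂ)
      linear_combination -h3
    · apply Subtype.ext
      change γ * (-u) = (b : MvPolynomial (Fin 2) ℂ)
      linear_combination -h4
  have hrange : LinearMap.range Φ ≤ LinearMap.ker ((evS S).domRestrict (DL (d + e + s))) := by
    rintro _ ⟨⟨a, b⟩, rfl⟩
    rw [LinearMap.mem_ker, LinearMap.domRestrict_apply, hΦ]
    ext p
    rw [evS_apply]
    simp [(hS p p.2).1, (hS p p.2).2]
  have e1 := LinearMap.finrank_range_add_finrank_ker Φ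
  have e2 := LinearMap.finrank_range_add_finrank_ker ((evS S).domRestrict (DL (d + e + s)))
  rw [LinearMap.range_eq_top.2 (evS_surj S _ (by omega)), finrank_top] at e2
  have e3 := Submodule.finrank_mono hker
  have e4 := Submodule.finrank_mono hrange
  have e5 := LinearMap.finrank_range_le Ψ
  rw [Module.finrank_prod] at e1
  rw [Module.finrank_fintype_fun_eq_card, Fintype.card_coe] at e2
  have t1 := finrank_DL s
  have t2 := finrank_DL (e + s)
  have t3 := finrank_DL (d + s)
  have t4 := finrank_DL (d + e + s)
  nlinarith

lemma bez_finite {d e : ℕ} {u v F G : MvPolynomial (Fin 2) ℂ} (hF : F.IsHomogeneous d)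
    (hG : G.IsHomogeneous e) (hu : u - F ∈ DL d) (hv : v - G ∈ DL e) (hFG : IsRelPrime F G)
    (hG0 : G ≠ 0) : {p : Fin 2 → ℂ | eval p u = 0 ∧ eval p v = 0}.Finite := by
  by_contra h
  obtain ⟨T, hT, hc⟩ := Set.Infinite.exists_subset_card_eq h (d * e + 1)
  have := bez hF hG hu hv hFG hG0 T (fun p hp => hT hp)
  omega

/-- decomposition with respect to a point -/
lemma dec_mon (p : Fin 2 → ℂ) (n : ℕ) : ∀ s : Fin 2 →₀ ℕ, s.degree = n →
    ∃ a ∈ DL n, ∃ b ∈ DL n, (monomial s (1 : ℂ)) - C (eval p (monomial s (1 : ℂ))) =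
      (X 0 - C (p 0)) * a + (X 1 - C (p 1)) * b := by
  induction n with
  | zero =>
    intro s hs
    rw [Finsupp.degree_eq_zero_iff] at hs
    subst hs
    exact ⟨0, zero_mem _, 0, zero_mem _, by simp⟩
  | succ n ih =>
    intro s hs
    have : ∃ i, s i ≠ 0 := by
      by_contra h
      push Not at h
      have : s = 0 := by ext i; exact h i
      rw [this] at hs; simp at hs
    obtain ⟨i, hi⟩ := this
    obtain ⟨t, rfl⟩ : ∃ t : Fin 2 →₀ ℕ, s = t + Finsupp.single i 1 := by
      refine ⟨s - Finsupp.single i 1, ?_⟩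
      rw [tsub_add_cancel_of_le]
      rw [Finsupp.single_le_iff]; omega
    have ht : t.degree = n := by
      rw [map_add, Finsupp.degree_single] at hs; omega
    obtain ⟨a, ha, b, hb, hab⟩ := ih t ht
    have hm : (monomial (t + Finsupp.single i 1) (1 : ℂ)) = monomial t 1 * X i := by
      rw [X, monomial_mul, one_mul]
    have htD : (monomial t (1 : ℂ)) ∈ DL (n + 1) := by
      refine DL_of_hom (isHomogeneous_monomial _ ht) (by omega)
    have hCa : ∀ c : ℂ, ∀ g ∈ DL n, C c * g ∈ DL (n + 1) := by
      intro c g hg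
      rw [← smul_eq_C_mul]
      exact Submodule.smul_mem _ _ (DL_mono (by omega) hg)
    rw [hm, map_mul, eval_X, C_mul]
    fin_cases i
    · refine ⟨monomial t 1 + C (p 0) * a, add_mem htD (hCa _ _ ha), C (p 0) * b, hCa _ _ hb, ?_⟩
      simp only [Fin.zero_eta]
      linear_combination C (p 0) * hab
    · refine ⟨C (p 1) * a, hCa _ _ ha, monomial t 1 + C (p 1) * b, add_mem htD (hCa _ _ hb), ?_⟩
      simp only [Fin.mk_one]
      linear_combination C (p 1) * hab

lemma dec (p : Fin 2 → ℂ) {n : ℕ} {r : MvPolynomial (Fin 2) ℂ} (hr : r ∈ DL (n + 1)) :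
    ∃ a ∈ DL n, ∃ b ∈ DL n, r - C (eval p r) = (X 0 - C (p 0)) * a + (X 1 - C (p 1)) * b := by
  have h : ∀ s : Fin 2 →₀ ℕ, ∃ a b, (s ∈ r.support → a ∈ DL n ∧ b ∈ DL n) ∧
      (monomial s (1 : ℂ)) - C (eval p (monomial s (1 : ℂ))) =
      (X 0 - C (p 0)) * a + (X 1 - C (p 1)) * b := by
    intro s
    obtain ⟨a, ha, b, hb, hab⟩ := dec_mon p s.degree s rfl
    refine ⟨a, b, fun hs => ?_, hab⟩
    have := mem_DL.1 hr s hs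
    exact ⟨DL_mono (by omega) ha, DL_mono (by omega) hb⟩
  choose a b h1 h2 using h
  refine ⟨∑ s ∈ r.support, coeff s r • a s, Submodule.sum_mem _ fun s hs =>
    Submodule.smul_mem _ _ (h1 s hs).1, ∑ s ∈ r.support, coeff s r • b s, Submodule.sum_mem _ fun s hs =>
    Submodule.smul_mem _ _ (h1 s hs).2, ?_⟩
  have hrs : r = ∑ s ∈ r.support, coeff s r • monomial s (1 : ℂ) := by
    conv_lhs => rw [r.as_sum]
    refine Finset.sum_congr rfl fun s _ => ?_
    rw [smul_monomial, smul_eq_mul, mul_one]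
  conv_lhs => rw [hrs]
  rw [map_sum, map_sum, ← Finset.sum_sub_distrib, Finset.mul_sum, Finset.mul_sum,
    ← Finset.sum_add_distrib]
  refine Finset.sum_congr rfl fun s _ => ?_
  rw [smul_eval, C_mul, ← smul_eq_C_mul, ← smul_sub, h2 s]
  simp only [smul_eq_C_mul]
  ring


lemma DL_pderiv {m : ℕ} {g : MvPolynomial (Fin 2) ℂ} (hg : g ∈ DL (m + 1)) (i : Fin 2) :
    pderiv i g ∈ DL m := by
  rw [mem_DL] at *
  intro s hs
  rw [mem_support_iff, coeff_pderiv] at hs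
  have := hg (s + Finsupp.single i 1) (by
    rw [mem_support_iff]; intro h; simp [h] at hs)
  rw [map_add, Finsupp.degree_single] at this
  omega

lemma euler2 {n : ℕ} {F : MvPolynomial (Fin 2) ℂ} (hF : F.IsHomogeneous n) :
    X 0 * pderiv 0 F + X 1 * pderiv 1 F = C (n : ℂ) * F := by
  have := hF.sum_X_mul_pderiv
  rw [Fin.sum_univ_two] at this
  rw [this, nsmul_eq_mul]; simp

/-- a vanishing polynomial with prescribed top form decomposes -/
lemma dec_top {n : ℕ} {u F : MvPolynomial (Fin 2) ℂ} (hF : F.IsHomogeneous (n + 1))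
    (hu : u - F ∈ DL (n + 1)) (p : Fin 2 → ℂ) (hp : eval p u = 0) :
    ∃ a b : MvPolynomial (Fin 2) ℂ, u = (X 0 - C (p 0)) * a + (X 1 - C (p 1)) * b ∧
      a - C ((n + 1 : ℂ)⁻¹) * pderiv 0 F ∈ DL n ∧ b - C ((n + 1 : ℂ)⁻¹) * pderiv 1 F ∈ DL n := by
  have hn : (n + 1 : ℂ) ≠ 0 := by exact_mod_cast Nat.succ_ne_zero n
  have hFx : ∀ i, C ((n + 1 : ℂ)⁻¹) * pderiv i F ∈ DL (n + 1) := fun i => by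
    rw [← smul_eq_C_mul]
    exact Submodule.smul_mem _ _ (DL_of_hom (m := n) (by simpa using hF.pderiv (i := i)) (by omega))
  have he := euler2 hF
  have he' : X 0 * (C ((n + 1 : ℂ)⁻¹) * pderiv 0 F) + X 1 * (C ((n + 1 : ℂ)⁻¹) * pderiv 1 F) = F := by
    have : C ((n + 1 : ℂ)⁻¹) * (C ((n + 1 : ℕ) : ℂ) : MvPolynomial (Fin 2) ℂ) = 1 := by
      rw [← C_mul]; push_cast; rw [inv_mul_cancel₀ hn, C_1]
    linear_combination (C ((n + 1 : ℂ)⁻¹)) * he + F * this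
  set A := C ((n + 1 : ℂ)⁻¹) * pderiv 0 F with hA
  set B := C ((n + 1 : ℂ)⁻¹) * pderiv 1 F with hB
  have hr : u - ((X 0 - C (p 0)) * A + (X 1 - C (p 1)) * B) ∈ DL (n + 1) := by
    have : u - ((X 0 - C (p 0)) * A + (X 1 - C (p 1)) * B) = (u - F) + (p 0 • A + p 1 • B) := by
      rw [smul_eq_C_mul, smul_eq_C_mul]; linear_combination -he'
    rw [this]
    exact add_mem hu (add_mem (Submodule.smul_mem _ _ (hFx 0)) (Submodule.smul_mem _ _ (hFx 1)))
  obtain ⟨a, ha, b, hb, hab⟩ := dec p hr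
  have h0 : eval p (u - ((X 0 - C (p 0)) * A + (X 1 - C (p 1)) * B)) = 0 := by
    simp [hp]
  rw [h0, C_0, sub_zero] at hab
  refine ⟨A + a, B + b, by linear_combination hab, by simpa using ha, by simpa using hb⟩

noncomputable def Etop (n : ℕ) (F : MvPolynomial (Fin 2) ℂ) : MvPolynomial (Fin 2) ℂ :=
  C ((n + 2 : ℂ)⁻¹ * (n + 1 : ℂ)⁻¹) *
    (pderiv 0 F * pderiv 1 (pderiv 1 F) - pderiv 1 F * pderiv 0 (pderiv 1 F))

lemma DL_top_mul {a b m n t : ℕ} {u v F G : MvPolynomial (Fin 2) ℂ}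
    (hF : F ∈ DL a) (hG : v ∈ DL b)
    (hu : u - F ∈ DL m) (hv : v - G ∈ DL n) (h1 : a + n ≤ t + 1) (h2 : m + b ≤ t + 1) :
    u * v - F * G ∈ DL t := by
  have : u * v - F * G = (u - F) * v + F * (v - G) := by ring
  rw [this]
  exact add_mem (DL_mul_lt hu hG (by omega)) (DL_mul_lt hF hv (by omega))

lemma Ep_exists {n : ℕ} {u F : MvPolynomial (Fin 2) ℂ} (hF : F.IsHomogeneous (n + 2))
    (hu : u - F ∈ DL (n + 2)) (p : Fin 2 → ℂ) (hp : eval p u = 0) (hp1 : eval p (pderiv 1 u) = 0) :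
    ∃ E : MvPolynomial (Fin 2) ℂ,
      (∀ i, (X i - C (p i)) * E ∈ Ideal.span {u, pderiv 1 u}) ∧
      eval p E = eval p (pderiv 0 u) * eval p (pderiv 1 (pderiv 1 u)) ∧
      E - Etop n F ∈ DL (2 * n + 1) := by
  have hF1 : (pderiv 1 F).IsHomogeneous (n + 1) := by simpa using hF.pderiv (i := 1)
  have hu1 : pderiv 1 u - pderiv 1 F ∈ DL (n + 1) := by
    rw [← map_sub]; exact DL_pderiv hu 1
  obtain ⟨a, b, hab, ha, hb⟩ := dec_top hF hu p hp
  obtain ⟨c, e, hce, hc, he⟩ := dec_top hF1 hu1 p hp1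
  have hsm : ∀ (z : ℂ) (q : MvPolynomial (Fin 2) ℂ) (m : ℕ), q.IsHomogeneous m →
      C z * q ∈ DL (m + 1) := by
    intro z q m hq
    rw [← smul_eq_C_mul]; exact Submodule.smul_mem _ _ (DL_of_hom hq (by omega))
  have hF0 : (pderiv 0 F).IsHomogeneous (n + 1) := by simpa using hF.pderiv (i := 0)
  have hF11 : (pderiv 1 (pderiv 1 F)).IsHomogeneous n := by simpa using hF1.pderiv (i := 1)
  have hF01 : (pderiv 0 (pderiv 1 F)).IsHomogeneous n := by simpa using hF1.pderiv (i := 0)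
  have hlow : ∀ {q r : MvPolynomial (Fin 2) ℂ} {m : ℕ}, q - r ∈ DL m → r ∈ DL (m + 1) →
      q ∈ DL (m + 1) := by
    intro q r m h1 h2
    have := add_mem (DL_mono (Nat.le_succ m) h1) h2
    simpa using this
  refine ⟨a * e - b * c, ?_, ?_, ?_⟩
  · intro i
    rw [Ideal.mem_span_pair]
    fin_cases i
    · exact ⟨e, -b, by simp only [Fin.zero_eta]; linear_combination e * hab - b * hce⟩
    · exact ⟨-c, a, by simp only [Fin.mk_one]; linear_combination -c * hab + a * hce⟩
  · have h1 := congrArg (fun q => eval p (pderiv 0 q)) hab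
    have h2 := congrArg (fun q => eval p (pderiv 1 q)) hab
    have h3 := congrArg (fun q => eval p (pderiv 1 q)) hce
    simp [pderiv_X] at h1 h2 h3
    rw [hp1] at h2
    rw [map_sub, map_mul, map_mul, ← h2, h1, h3]; ring
  · have e1 := DL_top_mul (t := 2 * n + 1) (hsm _ _ _ hF0) (hlow he (hsm _ _ _ hF11)) ha he
      (by omega) (by omega)
    have e2 := DL_top_mul (t := 2 * n + 1) (hsm _ _ _ hF1) (hlow hc (hsm _ _ _ hF01)) hb hc
      (by omega) (by omega)
    have := sub_mem e1 e2
    convert this using 1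
    rw [Etop, C_mul]
    push_cast
    rw [show (n : ℂ) + 1 + 1 = n + 2 by ring]
    ring

lemma mem_of_vanish {n : ℕ} {u F : MvPolynomial (Fin 2) ℂ} (hF : F.IsHomogeneous (n + 2))
    (hu : u - F ∈ DL (n + 2))
    (hJ : ∀ p, eval p u = 0 → eval p (pderiv 1 u) = 0 →
      eval p (pderiv 0 u) * eval p (pderiv 1 (pderiv 1 u)) ≠ 0)
    {g : MvPolynomial (Fin 2) ℂ}
    (hg : ∀ p, eval p u = 0 → eval p (pderiv 1 u) = 0 → eval p g = 0) :
    g ∈ Ideal.span {u, pderiv 1 u} := by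
  set I := Ideal.span {u, pderiv 1 u} with hI
  let K : Ideal (MvPolynomial (Fin 2) ℂ) := Submodule.comap (LinearMap.mulRight (MvPolynomial (Fin 2) ℂ) g) I
  have hK : ∀ h, h ∈ K ↔ h * g ∈ I := fun h => Iff.rfl
  by_cases htop : K = ⊤
  · have : (1 : MvPolynomial (Fin 2) ℂ) ∈ K := by rw [htop]; trivial
    rw [hK, one_mul] at this
    exact this
  exfalso
  obtain ⟨M, hM, hKM⟩ := Ideal.exists_le_maximal K htop
  obtain ⟨p, rfl⟩ := (isMaximal_iff_eq_vanishingIdeal_singleton).1 hM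
  have hev : ∀ h ∈ K, eval p h = 0 := by
    intro h hh
    have := (mem_vanishingIdeal_singleton_iff p h).1 (hKM hh)
    rwa [aeval_eq_eval] at this
  have hIK : ∀ h ∈ I, h ∈ K := fun h hh => by rw [hK]; exact Ideal.mul_mem_right _ _ hh
  have hpu := hev u (hIK _ (Ideal.subset_span (by simp)))
  have hpv := hev _ (hIK (pderiv 1 u) (Ideal.subset_span (by simp)))
  obtain ⟨E, hE1, hE2, -⟩ := Ep_exists hF hu p hpu hpv
  obtain ⟨m, hm⟩ := exists_DL g
  obtain ⟨a, -, b, -, hab⟩ := dec p (hm (m + 1) (by omega))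
  rw [hg p hpu hpv, C_0, sub_zero] at hab
  have : E ∈ K := by
    rw [hK, hab]
    have := add_mem (Ideal.mul_mem_right a _ (hE1 0)) (Ideal.mul_mem_right b _ (hE1 1))
    convert this using 1; ring
  exact hJ p hpu hpv (hE2 ▸ hev E this)

lemma relprime_grad {n : ℕ} {F : MvPolynomial (Fin 2) ℂ} (hF : F.IsHomogeneous (n + 2))
    (hR : IsRelPrime F (pderiv 1 F)) : IsRelPrime (pderiv 0 F) (pderiv 1 F) := by
  intro c h0 h1
  refine hR ?_ h1
  have he := euler2 hF
  have hn : (n + 2 : ℂ) ≠ 0 := by exact_mod_cast Nat.succ_ne_zero (n + 1)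
  have : C ((n + 2 : ℂ)⁻¹) * (C ((n + 2 : ℕ) : ℂ) : MvPolynomial (Fin 2) ℂ) = 1 := by
    rw [← C_mul]; push_cast; rw [inv_mul_cancel₀ hn, C_1]
  have h2 : F = C ((n + 2 : ℂ)⁻¹) * (X 0 * pderiv 0 F + X 1 * pderiv 1 F) := by
    rw [he, ← mul_assoc, this, one_mul]
  rw [h2]
  exact Dvd.dvd.mul_left (dvd_add (Dvd.dvd.mul_left h0 _) (Dvd.dvd.mul_left h1 _)) _

/-- Euler-Jacobi vanishing -/
lemma euler_jacobi {n : ℕ} {u F : MvPolynomial (Fin 2) ℂ} (hF : F.IsHomogeneous (n + 2))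
    (hu : u - F ∈ DL (n + 2)) (hR : IsRelPrime F (pderiv 1 F))
    (hc : coeff (Finsupp.single 1 (n + 2)) F ≠ 0)
    (hJ : ∀ p, eval p u = 0 → eval p (pderiv 1 u) = 0 →
      eval p (pderiv 0 u) * eval p (pderiv 1 (pderiv 1 u)) ≠ 0)
    (S : Finset (Fin 2 → ℂ)) (hS : ∀ p, p ∈ S ↔ eval p u = 0 ∧ eval p (pderiv 1 u) = 0)
    {w h' h : MvPolynomial (Fin 2) ℂ} (hw : w ∈ DL n) (hh' : h' ∈ DL n) (hh : h = X 0 * w + h') :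
    ∑ p ∈ S, eval p h / eval p (pderiv 1 (pderiv 1 u)) = 0 := by
  classical
  have hF1 : (pderiv 1 F).IsHomogeneous (n + 1) := by simpa using hF.pderiv (i := 1)
  have hF0 : (pderiv 0 F).IsHomogeneous (n + 1) := by simpa using hF.pderiv (i := 0)
  have hF11 : (pderiv 1 (pderiv 1 F)).IsHomogeneous n := by simpa using hF1.pderiv (i := 1)
  have hF01 : (pderiv 0 (pderiv 1 F)).IsHomogeneous n := by simpa using hF1.pderiv (i := 0)
  have hc11 : coeff (Finsupp.single 1 n) (pderiv 1 (pderiv 1 F)) ≠ 0 := by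
    rw [coeff_pderiv, coeff_pderiv, ← Finsupp.single_add, ← Finsupp.single_add]
    refine mul_ne_zero (mul_ne_zero hc ?_) ?_
    · exact Nat.cast_add_one_ne_zero _
    · exact Nat.cast_add_one_ne_zero _
  have hG0 : pderiv 1 F ≠ 0 := by
    intro h; rw [h] at hc11; simp at hc11
  have hu1 : pderiv 1 u - pderiv 1 F ∈ DL (n + 1) := by
    rw [← map_sub]; exact DL_pderiv hu 1
  have hu0 : pderiv 0 u - pderiv 0 F ∈ DL (n + 1) := by
    rw [← map_sub]; exact DL_pderiv hu 0
  have hX : ∀ i, (X i : MvPolynomial (Fin 2) ℂ) ∈ DL 2 := fun i =>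
    DL_of_hom (isHomogeneous_X ℂ i) (by omega)
  have hEp : ∀ p : Fin 2 → ℂ, ∃ E : MvPolynomial (Fin 2) ℂ, p ∈ S →
      (∀ i, (X i - C (p i)) * E ∈ Ideal.span {u, pderiv 1 u}) ∧
      eval p E = eval p (pderiv 0 u) * eval p (pderiv 1 (pderiv 1 u)) ∧
      E - Etop n F ∈ DL (2 * n + 1) := by
    intro p
    by_cases hp : p ∈ S
    · obtain ⟨E, hE⟩ := Ep_exists hF hu p ((hS p).1 hp).1 ((hS p).1 hp).2
      exact ⟨E, fun _ => hE⟩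
    · exact ⟨0, fun h => absurd h hp⟩
  choose E hE using hEp
  set c : (Fin 2 → ℂ) → ℂ := fun p => eval p h / eval p (pderiv 1 (pderiv 1 u)) with hcdef
  set s := ∑ p ∈ S, c p with hs
  have hIev : ∀ q ∈ S, ∀ g ∈ Ideal.span {u, pderiv 1 u}, eval q g = 0 := by
    intro q hq g hg
    obtain ⟨α, β, rfl⟩ := Ideal.mem_span_pair.1 hg
    simp [((hS q).1 hq).1, ((hS q).1 hq).2]
  set Q := h * pderiv 0 u - ∑ p ∈ S, C (c p) * E p with hQ
  have hQI : Q ∈ Ideal.span {u, pderiv 1 u} := by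
    refine mem_of_vanish hF hu hJ ?_
    intro q hq1 hq2
    have hqS : q ∈ S := (hS q).2 ⟨hq1, hq2⟩
    rw [hQ, map_sub, map_sum, Finset.sum_eq_single q]
    · simp only [map_mul, eval_C, (hE q hqS).2.1, hcdef]
      have := hJ q hq1 hq2
      have : eval q (pderiv 1 (pderiv 1 u)) ≠ 0 := right_ne_zero_of_mul this
      field_simp
      ring
    · intro p hp hpq
      obtain ⟨i, hi⟩ := Function.ne_iff.1 hpq.symm
      have := hIev q hqS _ ((hE p hp).1 i)
      simp only [map_mul, map_sub, eval_X, eval_C, mul_eq_zero, sub_eq_zero] at this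
      rw [map_mul, this.resolve_left hi, mul_zero]
    · intro h; exact absurd hqS h
  have hhD : h ∈ DL (n + 1) := by
    rw [hh]
    exact add_mem (DL_mul_lt (hX 0) hw (by omega)) (DL_mono (by omega) hh')
  have hux : pderiv 0 u ∈ DL (n + 2) := DL_of_top hF0 hu0
  -- top part of Q
  have hQtop : Q - (X 0 * w * pderiv 0 F - C s * Etop n F) ∈ DL (2 * n + 1) := by
    have e1 : h * pderiv 0 u - (X 0 * w) * pderiv 0 F ∈ DL (2 * n + 1) := by
      refine DL_top_mul (a := n + 1) (b := n + 2) (m := n) (n := n + 1) ?_ hux ?_ hu0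
        (by omega) (by omega)
      · exact DL_mul_lt (hX 0) hw (by omega)
      · rw [hh]; simpa using hh'
    have e2 : ∑ p ∈ S, C (c p) * E p - C s * Etop n F ∈ DL (2 * n + 1) := by
      rw [hs, map_sum, Finset.sum_mul, ← Finset.sum_sub_distrib]
      refine Submodule.sum_mem _ fun p hp => ?_
      rw [← mul_sub, ← smul_eq_C_mul]
      exact Submodule.smul_mem _ _ (hE p hp).2.2
    have := sub_mem e1 e2
    convert this using 1
    rw [hQ]; ring
  have hEtop : Etop n F ∈ DL (2 * n + 2) := by
    rw [Etop, ← smul_eq_C_mul]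
    refine Submodule.smul_mem _ _ (sub_mem ?_ ?_)
    · exact DL_of_hom (hF0.mul hF11) (by omega)
    · exact DL_of_hom (hF1.mul hF01) (by omega)
  have hQD : Q ∈ DL (2 * n + 2) := by
    have e1 : X 0 * w * pderiv 0 F - C s * Etop n F ∈ DL (2 * n + 2) := by
      refine sub_mem ?_ ?_
      · exact DL_mul_lt (DL_mul_lt (hX 0) hw (t := n + 1) (by omega))
          (DL_of_hom hF0 (n := n + 2) (by omega)) (by omega)
      · rw [← smul_eq_C_mul]; exact Submodule.smul_mem _ _ hEtop
    have := add_mem (DL_mono (Nat.le_succ _) hQtop) e1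
    simpa using this
  obtain ⟨α, hα, β, hβ, hQe⟩ := ideal_bdd hF hF1 hu hu1 hR hG0 hQI hQD
  replace hα : α ∈ DL n := DL_mono (by omega) hα
  replace hβ : β ∈ DL (n + 1) := DL_mono (by omega) hβ
  have hn2 : (n + 2 : ℂ) ≠ 0 := by exact_mod_cast Nat.succ_ne_zero (n + 1)
  have hn1 : (n + 1 : ℂ) ≠ 0 := by exact_mod_cast Nat.succ_ne_zero n
  have hαu : α * u - α * F ∈ DL (2 * n + 1) := by
    rw [← mul_sub]; exact DL_mul_lt hα hu (by omega)
  have hβv : β * pderiv 1 u - β * pderiv 1 F ∈ DL (2 * n + 1) := by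
    rw [← mul_sub]; exact DL_mul_lt hβ hu1 (by omega)
  -- combine
  set z : ℂ := (n + 2 : ℂ)⁻¹ * (n + 1 : ℂ)⁻¹ with hz
  have hz0 : z ≠ 0 := mul_ne_zero (inv_ne_zero hn2) (inv_ne_zero hn1)
  set A := C (s * z) * pderiv 1 (pderiv 1 F) - X 0 * (w - C ((n + 2 : ℂ)⁻¹) * α) with hA
  set B := C ((n + 2 : ℂ)⁻¹) * X 1 * α + β - C (s * z) * pderiv 0 (pderiv 1 F) with hB
  have hα' : ∀ t : ℂ, C t * α ∈ DL n := fun t => by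
    rw [← smul_eq_C_mul]; exact Submodule.smul_mem _ _ hα
  have hsm : ∀ (z : ℂ) (q : MvPolynomial (Fin 2) ℂ) (m : ℕ), q.IsHomogeneous m →
      C z * q ∈ DL (m + 1) := by
    intro z q m hq
    rw [← smul_eq_C_mul]; exact Submodule.smul_mem _ _ (DL_of_hom hq (by omega))
  have hAD : A ∈ DL (n + 1) := sub_mem (hsm _ _ _ hF11)
    (DL_mul_lt (hX 0) (sub_mem hw (hα' _)) (by omega))
  have hBD : B ∈ DL (n + 1) := by
    refine sub_mem (add_mem ?_ hβ) (hsm _ _ _ hF01)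
    rw [mul_assoc, mul_left_comm]
    exact DL_mul_lt (hX 1) (hα' _) (by omega)
  have key : A * pderiv 0 F + B * pderiv 1 F ∈ DL (2 * n + 1) := by
    have h3 := sub_mem hQtop (add_mem hαu hβv)
    have he := euler2 hF
    have h1 : C ((n + 2 : ℂ)⁻¹) * (C ((n + 2 : ℕ) : ℂ) : MvPolynomial (Fin 2) ℂ) = 1 := by
      rw [← C_mul]; push_cast; rw [inv_mul_cancel₀ hn2, C_1]
    convert h3 using 1
    rw [hQe, hA, hB, Etop, ← hz, C_mul]
    linear_combination (C ((n + 2 : ℂ)⁻¹) * α) * he + α * F * h1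
  obtain ⟨γ, hγ, h3, -⟩ := syz hF0 hF1 (by simp) (by simp)
    (relprime_grad hF hR) hG0 (2 * n + 1) 1 (2 * n + 2) A B (by omega) (DL_mono (by omega) hAD)
    (DL_mono (by omega) hBD) key
  have hγ0 := DL_zero (DL_mono (by omega) hγ)
  rw [hγ0, zero_mul, sub_zero] at h3
  have h4 : coeff (Finsupp.single 1 n) A = 0 := by
    by_contra hne
    have := mem_DL.1 h3 _ (mem_support_iff.2 hne)
    rw [Finsupp.degree_single] at this
    omega
  rw [hA, coeff_sub, coeff_C_mul, coeff_X_mul', if_neg (by simp), sub_zero] at h4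
  have h5 := (mul_eq_zero.1 h4).resolve_right hc11
  exact (mul_eq_zero.1 h5).resolve_right hz0


/-- complexification of a real polynomial -/
noncomputable def cx {σ : Type*} (g : MvPolynomial σ ℝ) : MvPolynomial σ ℂ :=
  MvPolynomial.map (algebraMap ℝ ℂ) g

lemma eval_cx_conj (g : MvPolynomial (Fin 2) ℝ) (p : Fin 2 → ℂ) :
    eval (fun i => (starRingEnd ℂ) (p i)) (cx g) = (starRingEnd ℂ) (eval p (cx g)) := by
  unfold cx
  induction g using MvPolynomial.induction_on with
  | C a => simp
  | add a b ha hb => simp only [map_add, ha, hb]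
  | mul_X a i ha => simp only [map_mul, map_X, eval_X, ha]

lemma eval_cx_real {σ : Type*} (g : MvPolynomial σ ℝ) (p : σ → ℝ) :
    eval (fun i => (p i : ℂ)) (cx g) = ((eval p g : ℝ) : ℂ) := by
  unfold cx
  induction g using MvPolynomial.induction_on with
  | C a => simp
  | add a b ha hb => simp only [map_add, ha, hb, Complex.ofReal_add]
  | mul_X a i ha => simp only [map_mul, map_X, eval_X, ha, Complex.ofReal_mul]

lemma cx_pderiv {σ : Type*} (g : MvPolynomial σ ℝ) (i : σ) : pderiv i (cx g) = cx (pderiv i g) := by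
  unfold cx; rw [pderiv_map]

lemma cx_injective {σ : Type*} : Function.Injective (cx : MvPolynomial σ ℝ → MvPolynomial σ ℂ) :=
  map_injective _ (algebraMap ℝ ℂ).injective

def TT (m : ℕ) : Set (Fin 2 →₀ ℕ) := {s | s.degree < m + 1} \ {Finsupp.single 1 m}

lemma TT_finite (m : ℕ) : (TT m).Finite := (finite_deg (m + 1)).subset Set.sdiff_subset

lemma TT_ncard (m : ℕ) : 2 * (TT m).ncard + 2 = (m + 1) * (m + 2) := by
  have h : (Finsupp.single 1 m : Fin 2 →₀ ℕ) ∈ {s : Fin 2 →₀ ℕ | s.degree < m + 1} := by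
    simp [Finsupp.degree_single]
  have := Set.ncard_sdiff_singleton_add_one h (finite_deg (m + 1))
  have h2 := ncard_deg (m + 1)
  rw [← TT] at this
  rw [← this] at h2
  linarith

noncomputable def UU (m : ℕ) : Submodule ℝ (MvPolynomial (Fin 2) ℝ) := restrictSupport ℝ (TT m)

instance (m : ℕ) : FiniteDimensional ℝ (UU m) := by
  have := (TT_finite m).to_subtype
  exact Module.Finite.of_basis (basisRestrictSupport ℝ (TT m))

lemma finrank_UU (m : ℕ) : 2 * Module.finrank ℝ (UU m) + 2 = (m + 1) * (m + 2) := by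
  have := Module.finrank_eq_nat_card_basis (basisRestrictSupport ℝ (TT m))
  rw [← TT_ncard]
  congr 2

lemma UU_decomp {m : ℕ} {g : MvPolynomial (Fin 2) ℝ} (hg : g ∈ UU m) :
    ∃ g1 ∈ DL m, ∃ g' ∈ DL m, cx g = X 0 * g1 + g' := by
  have key : cx g ∈ (DL m).map (LinearMap.mulLeft ℂ (X 0)) ⊔ DL m := by
    rw [(cx g).as_sum]
    refine Submodule.sum_mem _ fun s hs => ?_
    have hs' : s ∈ TT m := by
      rw [UU, mem_restrictSupport_iff] at hg
      exact hg (support_map_subset _ _ hs)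
    obtain ⟨h1, h2⟩ := hs'
    rw [Set.mem_ofPred_eq] at h1
    by_cases h0 : s 0 = 0
    · refine Submodule.mem_sup_right ?_
      have hd : s.degree = s 1 := by rw [Finsupp.degree_eq_sum, Fin.sum_univ_two, h0, zero_add]
      refine DL_of_hom (isHomogeneous_monomial _ rfl) ?_
      rcases Nat.lt_succ_iff_lt_or_eq.1 h1 with h | h
      · exact h
      · exfalso; apply h2
        rw [Set.mem_singleton_iff]
        ext i; fin_cases i
        · simp [h0]
        · simp [← hd, h]
    · refine Submodule.mem_sup_left ⟨monomial (s - Finsupp.single 0 1) (coeff s (cx g)), ?_, ?_⟩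
      · refine DL_of_hom (isHomogeneous_monomial _ rfl) ?_
        have : s.degree = (s - Finsupp.single 0 1).degree + 1 := by
          conv_lhs => rw [← tsub_add_cancel_of_le (show Finsupp.single 0 1 ≤ s by
            rw [Finsupp.single_le_iff]; omega)]
          rw [map_add, Finsupp.degree_single]
        omega
      · rw [LinearMap.mulLeft_apply, X, monomial_mul, one_mul, add_tsub_cancel_of_le]
        rw [Finsupp.single_le_iff]; omega
  obtain ⟨_, ⟨g1, hg1, rfl⟩, g', hg', h⟩ := Submodule.mem_sup.1 key
  exact ⟨g1, hg1, g', hg', h.symm⟩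

lemma count_algebra {m : ℕ} {u F : MvPolynomial (Fin 2) ℝ}
    (hF : F.IsHomogeneous (2 * m + 2))
    (hu : cx u - cx F ∈ DL (2 * m + 2)) (hR : IsRelPrime (cx F) (cx (pderiv 1 F)))
    (hc : coeff (Finsupp.single 1 (2 * m + 2)) F ≠ 0)
    (hJ : ∀ p, eval p (cx u) = 0 → eval p (cx (pderiv 1 u)) = 0 →
      eval p (cx (pderiv 0 u)) * eval p (cx (pderiv 1 (pderiv 1 u))) ≠ 0)
    (Rp Rm : Finset (Fin 2 → ℝ))
    (hRp : ∀ q ∈ Rp, eval q u = 0 ∧ eval q (pderiv 1 u) = 0 ∧ 0 < eval q (pderiv 1 (pderiv 1 u)))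
    (hRm : ∀ q, eval q u = 0 → eval q (pderiv 1 u) = 0 → eval q (pderiv 1 (pderiv 1 u)) < 0 →
      q ∈ Rm) :
    Rp.card ≤ Rm.card + (3 * m ^ 2 + 3 * m + 2) := by
  classical
  have hFc : (cx F).IsHomogeneous (2 * m + 2) := hF.map _
  have hc' : coeff (Finsupp.single 1 (2 * m + 2)) (cx F) ≠ 0 := by
    rw [cx, coeff_map]; simpa using hc
  have hF1 : (cx (pderiv 1 F)).IsHomogeneous (2 * m + 1) := by
    rw [← cx_pderiv]; simpa using hFc.pderiv (i := 1)
  have hG0 : cx (pderiv 1 F) ≠ 0 := by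
    intro h
    have : coeff (Finsupp.single 1 (2 * m + 1)) (cx (pderiv 1 F)) = 0 := by rw [h]; simp
    rw [← cx_pderiv, coeff_pderiv, ← Finsupp.single_add] at this
    exact (mul_ne_zero hc' (Nat.cast_add_one_ne_zero _)) this
  have hu1 : cx (pderiv 1 u) - cx (pderiv 1 F) ∈ DL (2 * m + 1) := by
    rw [← cx_pderiv, ← cx_pderiv, ← map_sub]; exact DL_pderiv hu 1
  have hfin := bez_finite hFc hF1 hu hu1 hR hG0
  set S := hfin.toFinset with hSdef
  have hS : ∀ p, p ∈ S ↔ eval p (cx u) = 0 ∧ eval p (cx (pderiv 1 u)) = 0 := by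
    intro p; rw [hSdef, Set.Finite.mem_toFinset]; rfl
  have hbez := bez hFc hF1 hu hu1 hR hG0 S (fun p hp => (hS p).1 hp)
  set uyy := pderiv 1 (pderiv 1 u) with huyy
  have hyy0 : ∀ p ∈ S, eval p (cx uyy) ≠ 0 := fun p hp =>
    right_ne_zero_of_mul (hJ p ((hS p).1 hp).1 ((hS p).1 hp).2)
  let cj : (Fin 2 → ℂ) → (Fin 2 → ℂ) := fun p i => (starRingEnd ℂ) (p i)
  have hcj : ∀ g p, eval (cj p) (cx g) = (starRingEnd ℂ) (eval p (cx g)) := eval_cx_conj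
  have hcjcj : ∀ p, cj (cj p) = p := fun p => by ext i; simp [cj]
  have hcjS : ∀ p ∈ S, cj p ∈ S := by
    intro p hp
    rw [hS] at hp ⊢
    rw [hcj, hcj, hp.1, hp.2]; simp
  let isR : (Fin 2 → ℂ) → Prop := fun p => ∀ i, (p i).im = 0
  let re : (Fin 2 → ℂ) → (Fin 2 → ℝ) := fun p i => (p i).re
  have hre : ∀ p, isR p → (fun i => ((re p i : ℝ) : ℂ)) = p := by
    intro p hp; ext i; apply Complex.ext
    · simp [re]
    · simp [hp i]
  have hreal : ∀ p, isR p → ∀ g, eval p (cx g) = ((eval (re p) g : ℝ) : ℂ) := by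
    intro p hp g
    rw [← eval_cx_real, hre p hp]
  let hf : (Fin 2 → ℂ) → Prop := fun p => 0 < (p 0).im ∨ ((p 0).im = 0 ∧ 0 < (p 1).im)
  let Sp := S.filter fun p => isR p ∧ 0 < eval (re p) uyy
  let Sm := S.filter fun p => isR p ∧ eval (re p) uyy < 0
  let H := S.filter hf
  let H' := H.image cj
  have hH' : H'.card = H.card := Finset.card_image_of_injective _
    (Function.Involutive.injective hcjcj)
  have hcover : ∀ p ∈ S, p ∈ Sp ∨ p ∈ Sm ∨ p ∈ H ∨ cj p ∈ H := by
    intro p hp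
    by_cases h : isR p
    · have := hyy0 p hp
      rw [hreal p h, Ne, Complex.ofReal_eq_zero] at this
      rcases lt_or_gt_of_ne this with h1 | h1
      · right; left; exact Finset.mem_filter.2 ⟨hp, h, h1⟩
      · left; exact Finset.mem_filter.2 ⟨hp, h, h1⟩
    · right; right
      have h2 : ¬ ((p 0).im = 0 ∧ (p 1).im = 0) := by
        intro h'; apply h; intro i; fin_cases i
        · exact h'.1
        · exact h'.2
      have : hf p ∨ hf (cj p) := by
        simp only [hf, cj, Complex.conj_im]
        rcases lt_trichotomy (p 0).im 0 with h0 | h0 | h0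
        · right; left; linarith
        · rcases lt_trichotomy (p 1).im 0 with h1 | h1 | h1
          · right; right; constructor <;> linarith
          · exact absurd ⟨h0, h1⟩ h2
          · left; right; exact ⟨h0, h1⟩
        · left; left; exact h0
      rcases this with h | h
      · left; exact Finset.mem_filter.2 ⟨hp, h⟩
      · right; exact Finset.mem_filter.2 ⟨hcjS p hp, h⟩
  have hnf : ∀ p, hf p → ¬ isR p := by
    intro p hp h
    rcases hp with hp | hp
    · rw [h 0] at hp; exact lt_irrefl _ hp
    · have := hp.2; rw [h 1] at this; exact lt_irrefl _ this
  have hHim : ∀ p ∈ H', hf (cj p) ∧ p ∈ S := by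
    intro p hp
    obtain ⟨q, hq, rfl⟩ := Finset.mem_image.1 hp
    rw [hcjcj]
    exact ⟨(Finset.mem_filter.1 hq).2, hcjS q (Finset.mem_filter.1 hq).1⟩
  have hRcj : ∀ p, isR p → isR (cj p) := by
    intro p hp i; simp [cj, hp i]
  -- cardinalities
  have hcard : Sp.card + Sm.card + 2 * H.card ≤ S.card := by
    have d1 : Disjoint Sp Sm := by
      rw [Finset.disjoint_left]; intro p h1 h2
      have := (Finset.mem_filter.1 h1).2.2
      have := (Finset.mem_filter.1 h2).2.2
      linarith
    have d2 : Disjoint H H' := by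
      rw [Finset.disjoint_left]; intro p h1 h2
      have h1 := (Finset.mem_filter.1 h1).2
      have h2 := (hHim p h2).1
      simp only [hf, cj, Complex.conj_im] at h1 h2
      rcases h1 with h1 | h1 <;> rcases h2 with h2 | h2 <;> linarith [h1, h2]
    have d3 : Disjoint (Sp ∪ Sm) (H ∪ H') := by
      rw [Finset.disjoint_left]; intro p h1 h2
      have h1 : isR p := by
        rcases Finset.mem_union.1 h1 with h | h
        · exact (Finset.mem_filter.1 h).2.1
        · exact (Finset.mem_filter.1 h).2.1
      rcases Finset.mem_union.1 h2 with h | h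
      · exact hnf p (Finset.mem_filter.1 h).2 h1
      · exact hnf _ (hHim p h).1 (hRcj p h1)
    have : (Sp ∪ Sm) ∪ (H ∪ H') ⊆ S := by
      intro p hp
      simp only [Finset.mem_union] at hp
      rcases hp with (hp | hp) | (hp | hp)
      · exact (Finset.mem_filter.1 hp).1
      · exact (Finset.mem_filter.1 hp).1
      · exact (Finset.mem_filter.1 hp).1
      · exact (hHim p hp).2
    have := Finset.card_le_card this
    rw [Finset.card_union_of_disjoint d3, Finset.card_union_of_disjoint d1,
      Finset.card_union_of_disjoint d2, hH'] at this
    omega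
  have hRpc : Rp.card ≤ Sp.card := by
    refine Finset.card_le_card_of_injOn (fun q i => (q i : ℂ)) ?_ ?_
    · intro q hq
      obtain ⟨h1, h2, h3⟩ := hRp q hq
      refine Finset.mem_coe.2 (Finset.mem_filter.2 ⟨?_, ?_, ?_⟩)
      · rw [hS, eval_cx_real, eval_cx_real, h1, h2]; simp
      · intro i; simp
      · exact h3
    · intro q _ q' _ h
      ext i
      have := congrFun h i
      simpa using this
  have hRmc : Sm.card ≤ Rm.card := by
    refine Finset.card_le_card_of_injOn re ?_ ?_
    · intro p hp
      obtain ⟨h1, h2, h3⟩ := Finset.mem_filter.1 (Finset.mem_coe.1 hp)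
      rw [hS, hreal p h2, hreal p h2] at h1
      exact hRm _ (by exact_mod_cast h1.1) (by exact_mod_cast h1.2) h3
    · intro p hp q hq h
      rw [← hre p (Finset.mem_filter.1 (Finset.mem_coe.1 hp)).2.1,
        ← hre q (Finset.mem_filter.1 (Finset.mem_coe.1 hq)).2.1, h]
  -- linear algebra
  have hdim : Module.finrank ℝ (UU m) ≤ Sm.card + H.card := by
    by_contra hlt
    push Not at hlt
    have hsq : ∀ p : Fin 2 → ℂ, ∃ s : ℂ, s * s = (eval p (cx uyy))⁻¹ := fun p => by
      obtain ⟨s, hs⟩ := IsAlgClosed.exists_eq_mul_self (eval p (cx uyy))⁻¹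
      exact ⟨s, hs.symm⟩
    choose sq hsq using hsq
    let ev : (Fin 2 → ℂ) → (UU m →ₗ[ℝ] ℂ) := fun p =>
      ((aeval p : MvPolynomial (Fin 2) ℝ →ₐ[ℝ] ℂ).toLinearMap).comp (UU m).subtype
    have hev : ∀ p g, ev p g = eval p (cx (g : MvPolynomial (Fin 2) ℝ)) := by
      intro p g
      simp only [ev, cx, LinearMap.comp_apply, eval_map]
      rfl
    let L : UU m →ₗ[ℝ] ((Sm → ℝ) × (H → ℝ)) :=
      LinearMap.prod (LinearMap.pi fun p => Complex.reLm.comp (ev p))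
        (LinearMap.pi fun p => Complex.imLm.comp ((LinearMap.mulLeft ℝ (sq p)).comp (ev p)))
    have hk : LinearMap.ker L ≠ ⊥ := by
      apply LinearMap.ker_ne_bot_of_finrank_lt
      rw [Module.finrank_prod, Module.finrank_fintype_fun_eq_card,
        Module.finrank_fintype_fun_eq_card, Fintype.card_coe, Fintype.card_coe]
      exact hlt
    obtain ⟨g, hgk, hg0⟩ := Submodule.exists_mem_ne_zero_of_ne_bot hk
    rw [LinearMap.mem_ker] at hgk
    have hg1 : ∀ p ∈ Sm, (eval p (cx (g : MvPolynomial (Fin 2) ℝ))).re = 0 := by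
      intro p hp
      have := congrFun (congrArg Prod.fst hgk) ⟨p, hp⟩
      rw [← hev]; exact this
    have hg2 : ∀ p ∈ H, (sq p * eval p (cx (g : MvPolynomial (Fin 2) ℝ))).im = 0 := by
      intro p hp
      have := congrFun (congrArg Prod.snd hgk) ⟨p, hp⟩
      rw [← hev]; exact this
    obtain ⟨g1, hg1D, g', hg'D, hdec⟩ := UU_decomp g.2
    set gc := cx (g : MvPolynomial (Fin 2) ℝ) with hgc
    have hX : ∀ i, (X i : MvPolynomial (Fin 2) ℂ) ∈ DL 2 := fun i =>
      DL_of_hom (isHomogeneous_X ℂ i) (by omega)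
    have hEJ := euler_jacobi (n := 2 * m) (u := cx u) (F := cx F) hFc hu
      (by rw [cx_pderiv]; exact hR) hc'
      (by intro p; rw [cx_pderiv, cx_pderiv, cx_pderiv]; exact hJ p)
      S (by intro p; rw [cx_pderiv]; exact hS p)
      (w := X 0 * (g1 * g1) + (g1 * g' + g1 * g')) (h' := g' * g') (h := gc * gc)
      (by
        have e1 : g1 * g1 ∈ DL (2 * m - 1) := DL_mul_lt hg1D hg1D (by omega)
        have e2 : g1 * g' ∈ DL (2 * m) := DL_mul_lt hg1D hg'D (by omega)
        exact add_mem (DL_mul_lt (hX 0) e1 (by omega)) (add_mem e2 e2))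
      (DL_mul_lt hg'D hg'D (by omega)) (by rw [hdec]; ring)
    rw [cx_pderiv, cx_pderiv, ← huyy] at hEJ
    set τ : (Fin 2 → ℂ) → ℝ := fun p => (eval p (gc * gc) / eval p (cx uyy)).re with hτ
    have hsum : ∑ p ∈ S, τ p = 0 := by
      have := congrArg Complex.re hEJ
      rw [Complex.re_sum] at this
      exact this
    have hH : ∀ p ∈ H, 0 ≤ τ p ∧ (τ p = 0 → eval p gc = 0) := by
      intro p hp
      have him := hg2 p hp
      obtain ⟨r, hr⟩ : ∃ r : ℝ, sq p * eval p gc = r :=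
        ⟨(sq p * eval p gc).re, by apply Complex.ext <;> simp [him]⟩
      have : τ p = r * r := by
        have h1 : eval p (gc * gc) / eval p (cx uyy) = (sq p * eval p gc) * (sq p * eval p gc) := by
          rw [div_eq_mul_inv, ← hsq, map_mul]; ring
        rw [hτ]; simp only
        rw [h1, hr, ← Complex.ofReal_mul, Complex.ofReal_re]
      rw [this]
      refine ⟨mul_self_nonneg r, fun h => ?_⟩
      have hr0 : r = 0 := mul_self_eq_zero.1 h
      rw [hr0, Complex.ofReal_zero] at hr
      refine (mul_eq_zero.1 hr).resolve_left fun h0 => ?_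
      have h1 := hsq p
      rw [h0, mul_zero] at h1
      exact inv_ne_zero (hyy0 p (Finset.mem_filter.1 hp).1) h1.symm
    have hall : ∀ p ∈ S, 0 ≤ τ p ∧ (τ p = 0 → eval p gc = 0) := by
      intro p hp
      rcases hcover p hp with h | h | h | h
      · obtain ⟨_, h1, h2⟩ := Finset.mem_filter.1 h
        have e : τ p = eval (re p) (g : MvPolynomial (Fin 2) ℝ) ^ 2 / eval (re p) uyy := by
          rw [hτ]; simp only
          rw [map_mul, hgc, hreal p h1, hreal p h1, ← Complex.ofReal_mul, ← Complex.ofReal_div,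
            Complex.ofReal_re, pow_two]
        rw [e]
        refine ⟨by positivity, fun h3 => ?_⟩
        have h4 := (div_eq_zero_iff.1 h3).resolve_right h2.ne'
        have h5 := pow_eq_zero_iff (two_ne_zero) |>.1 h4
        rw [hgc, hreal p h1, h5]; simp
      · have h1 := (Finset.mem_filter.1 h).2.1
        have h0 : eval p gc = 0 := by
          have := hg1 p h
          rw [hgc, hreal p h1, Complex.ofReal_re] at this
          rw [hgc, hreal p h1, this]; simp
        refine ⟨?_, fun _ => h0⟩
        rw [hτ]; simp [h0]
      · exact hH p h
      · have h1 := hH _ h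
        have e : τ (cj p) = τ p := by
          rw [hτ]; simp only
          rw [map_mul, map_mul, hgc, hcj, hcj, ← map_mul, ← map_div₀, Complex.conj_re]
        rw [e, hgc, hcj] at h1
        refine ⟨h1.1, fun h2 => ?_⟩
        have := h1.2 h2
        simpa using this
    have hz : ∀ p ∈ S, τ p = 0 := (Finset.sum_eq_zero_iff_of_nonneg fun p hp => (hall p hp).1).1 hsum
    have hmem := mem_of_vanish (n := 2 * m) (u := cx u) (F := cx F) (g := gc) hFc hu
      (by intro p; rw [cx_pderiv, cx_pderiv, cx_pderiv]; exact hJ p)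
      (by
        intro p h1 h2
        rw [cx_pderiv] at h2
        have hp := (hS p).2 ⟨h1, h2⟩
        exact (hall p hp).2 (hz p hp))
    rw [cx_pderiv] at hmem
    have hgcD : gc ∈ DL (m + 1) := by
      rw [hdec]
      exact add_mem (DL_mul_lt (hX 0) hg1D (by omega)) (DL_mono (by omega) hg'D)
    obtain ⟨α, hα, β, hβ, he⟩ := ideal_bdd hFc hF1 hu hu1 hR hG0 hmem hgcD
    have hα := DL_zero (DL_mono (by omega) hα)
    have hβ := DL_zero (DL_mono (by omega) hβ)
    rw [hα, hβ, zero_mul, zero_mul, add_zero] at he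
    apply hg0
    apply Subtype.ext
    apply cx_injective
    rw [← hgc, he, cx]; simp
  have hd := finrank_UU m
  have : S.card ≤ (2 * m + 2) * (2 * m + 1) := hbez
  nlinarith

section
open Filter Topology Set

/-- a function of two variables with the derivatives needed -/
structure Smth (f fx fy fyy : ℝ → ℝ → ℝ) : Prop where
  cf : Continuous (fun q : ℝ × ℝ => f q.1 q.2)
  cfx : Continuous (fun q : ℝ × ℝ => fx q.1 q.2)
  cfy : Continuous (fun q : ℝ × ℝ => fy q.1 q.2)
  cfyy : Continuous (fun q : ℝ × ℝ => fyy q.1 q.2)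
  hx : ∀ x y, HasDerivAt (fun t => f t y) (fx x y) x
  hy : ∀ x y, HasDerivAt (fun t => f x t) (fy x y) y
  hyy : ∀ x y, HasDerivAt (fun t => fy x t) (fyy x y) y

lemma mvt (g g' : ℝ → ℝ) (h : ∀ t, HasDerivAt g (g' t) t) (s t : ℝ) :
    ∃ z ∈ uIcc s t, g t - g s = g' z * (t - s) := by
  rcases lt_trichotomy s t with hst | hst | hst
  · obtain ⟨z, hz, hz2⟩ := exists_hasDerivAt_eq_slope g g' hst
      (fun x _ => (h x).continuousAt.continuousWithinAt) (fun x _ => h x)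
    refine ⟨z, by rw [uIcc_of_le hst.le]; exact ⟨hz.1.le, hz.2.le⟩, ?_⟩
    rw [hz2]; field_simp [sub_ne_zero.2 hst.ne']
  · subst hst; exact ⟨s, by simp, by simp⟩
  · obtain ⟨z, hz, hz2⟩ := exists_hasDerivAt_eq_slope g g' hst
      (fun x _ => (h x).continuousAt.continuousWithinAt) (fun x _ => h x)
    refine ⟨z, by rw [uIcc_of_ge hst.le]; exact ⟨hz.1.le, hz.2.le⟩, ?_⟩
    rw [hz2]
    have : s - t ≠ 0 := sub_ne_zero.2 hst.ne'
    field_simp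
    ring

lemma abs_lt_of_uIcc {s t z y η : ℝ} (hz : z ∈ uIcc s t) (hs : |s - y| < η) (ht : |t - y| < η) :
    |z - y| < η := by
  rw [abs_lt] at *
  rw [mem_uIcc] at hz
  rcases hz with hz | hz <;> constructor <;> linarith

lemma box_of_eventually {Q : ℝ × ℝ → Prop} {x0 y0 : ℝ} (h : ∀ᶠ q in 𝓝 (x0, y0), Q q) :
    ∃ η > 0, ∀ x y, |x - x0| < η → |y - y0| < η → Q (x, y) := by
  obtain ⟨η, hη, h⟩ := Metric.eventually_nhds_iff.1 h
  refine ⟨η, hη, fun x y hx hy => h ?_⟩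
  rw [Prod.dist_eq, max_lt_iff, Real.dist_eq, Real.dist_eq]
  exact ⟨hx, hy⟩

section
variable {f fx fy fyy : ℝ → ℝ → ℝ}

lemma nz_box {g : ℝ → ℝ → ℝ} (hg : Continuous (fun q : ℝ × ℝ => g q.1 q.2)) {x0 y0 : ℝ}
    (h : 0 < g x0 y0) : ∃ η > 0, ∀ x y, |x - x0| < η → |y - y0| < η → 0 < g x y :=
  box_of_eventually (hg.continuousAt.eventually (lt_mem_nhds h))

/-- second order comparison along a vertical line -/
lemma vert (H : Smth f fx fy fyy) {x y : ℝ} (h0 : fy x y = 0) (y' : ℝ) :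
    ∃ z ∈ uIcc y y', ∃ t ≥ 0, f x y' - f x y = fyy x z * t := by
  obtain ⟨z, hz, h1⟩ := mvt (fun t => f x t) (fun t => fy x t) (H.hy x) y y'
  obtain ⟨w, hw, h2⟩ := mvt (fun t => fy x t) (fun t => fyy x t) (H.hyy x) y z
  simp only [h0, sub_zero] at h1 h2
  refine ⟨w, ?_, (z - y) * (y' - y), ?_, ?_⟩
  · rw [mem_uIcc] at *
    rcases hz with hz | hz <;> rcases hw with hw | hw
    · left; constructor <;> linarith
    · left; constructor <;> linarith
    · right; constructor <;> linarith
    · right; constructor <;> linarith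
  · rw [mem_uIcc] at hz
    rcases hz with hz | hz
    · exact mul_nonneg (by linarith) (by linarith)
    · exact mul_nonneg_of_nonpos_of_nonpos (by linarith) (by linarith)
  · rw [h1, h2]; ring

lemma horiz (H : Smth f fx fy fyy) (x x' y : ℝ) :
    ∃ z ∈ uIcc x x', f x' y - f x y = fx z y * (x' - x) :=
  mvt (fun t => f t y) (fun t => fx t y) (fun t => H.hx t y) x x'

lemma LM (H : Smth f fx fy fyy) {x0 y0 : ℝ} (h0 : fy x0 y0 = 0) (hx : 0 < fx x0 y0)
    (hyy : fyy x0 y0 ≠ 0) :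
    ∃ η > 0, ∀ x y, |x - x0| < η → |y - y0| < η → fy x y = 0 →
      (x0 ≤ x → f x0 y0 ≤ f x y) ∧ (x < x0 → f x y < f x0 y0) ∧ (x0 < x → f x0 y0 < f x y) := by
  obtain ⟨η1, hη1, B1⟩ := nz_box H.cfx hx
  have a1 : ∀ y x x', |y - y0| < η1 → |x - x0| < η1 → |x' - x0| < η1 → x ≤ x' → f x y ≤ f x' y := by
    intro y x x' hy hx hx' hxx
    obtain ⟨z, hz, h⟩ := horiz H x x' y
    have := B1 z y (abs_lt_of_uIcc hz hx hx') hy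
    nlinarith
  have a2 : ∀ y x x', |y - y0| < η1 → |x - x0| < η1 → |x' - x0| < η1 → x < x' → f x y < f x' y := by
    intro y x x' hy hx hx' hxx
    obtain ⟨z, hz, h⟩ := horiz H x x' y
    have := B1 z y (abs_lt_of_uIcc hz hx hx') hy
    nlinarith
  rcases lt_or_gt_of_ne hyy with hneg | hpos
  · obtain ⟨η2, hη2, B2⟩ := nz_box (g := fun x y => - fyy x y) H.cfyy.neg (x0 := x0) (y0 := y0)
      (by simpa using hneg)
    refine ⟨min η1 η2, lt_min hη1 hη2, fun x y hx hy hr => ?_⟩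
    rw [lt_min_iff] at hx hy
    obtain ⟨z, hz, t, ht, e1⟩ := vert H hr y0
    obtain ⟨w, hw, s, hs, e2⟩ := vert H h0 y
    have b1 := B2 x z hx.2 (abs_lt_of_uIcc hz hy.2 (by simpa using hη2))
    have b2 := B2 x0 w (by simpa using hη2) (abs_lt_of_uIcc hw (by simpa using hη2) hy.2)
    have c1 : f x y0 ≤ f x y := by nlinarith
    have c2 : f x0 y ≤ f x0 y0 := by nlinarith
    refine ⟨fun h => ?_, fun h => ?_, fun h => ?_⟩
    · exact (a1 y0 x0 x (by simpa using hη1) (by simpa using hη1) hx.1 h).trans c1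
    · exact (a2 y x x0 hy.1 hx.1 (by simpa using hη1) h).trans_le c2
    · exact (a2 y0 x0 x (by simpa using hη1) (by simpa using hη1) hx.1 h).trans_le c1
  · obtain ⟨η2, hη2, B2⟩ := nz_box H.cfyy hpos
    refine ⟨min η1 η2, lt_min hη1 hη2, fun x y hx hy hr => ?_⟩
    rw [lt_min_iff] at hx hy
    obtain ⟨z, hz, t, ht, e1⟩ := vert H hr y0
    obtain ⟨w, hw, s, hs, e2⟩ := vert H h0 y
    have b1 := B2 x z hx.2 (abs_lt_of_uIcc hz hy.2 (by simpa using hη2))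
    have b2 := B2 x0 w (by simpa using hη2) (abs_lt_of_uIcc hw (by simpa using hη2) hy.2)
    have c1 : f x y ≤ f x y0 := by nlinarith
    have c2 : f x0 y0 ≤ f x0 y := by nlinarith
    refine ⟨fun h => ?_, fun h => ?_, fun h => ?_⟩
    · exact c2.trans (a1 y x0 x hy.1 (by simpa using hη1) hx.1 h)
    · exact c1.trans_lt (a2 y0 x x0 (by simpa using hη1) hx.1 (by simpa using hη1) h)
    · exact c2.trans_lt (a2 y x0 x hy.1 (by simpa using hη1) hx.1 h)

lemma Smth.neg (H : Smth f fx fy fyy) : Smth (fun x y => -f x y) (fun x y => -fx x y)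
    (fun x y => -fy x y) (fun x y => -fyy x y) :=
  ⟨H.cf.neg, H.cfx.neg, H.cfy.neg, H.cfyy.neg, fun x y => (H.hx x y).neg, fun x y => (H.hy x y).neg,
    fun x y => (H.hyy x y).neg⟩

lemma Smth.refl (H : Smth f fx fy fyy) : Smth (fun x y => f (-x) y) (fun x y => -fx (-x) y)
    (fun x y => fy (-x) y) (fun x y => fyy (-x) y) := by
  have c : Continuous (fun q : ℝ × ℝ => ((-q.1, q.2) : ℝ × ℝ)) := by fun_prop
  refine ⟨H.cf.comp c, (H.cfx.comp c).neg, H.cfy.comp c, H.cfyy.comp c, fun x y => ?_,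
    fun x y => H.hy (-x) y, fun x y => H.hyy (-x) y⟩
  have := (H.hx (-x) y).comp x (hasDerivAt_neg x)
  rw [mul_neg_one] at this
  exact this

/-- local continuation of a simple root, positive slope -/
lemma cont_root_pos (H : Smth f fx fy fyy) {x0 y0 : ℝ} (h0 : fy x0 y0 = 0)
    (hyy : 0 < fyy x0 y0) :
    ∃ η0 > 0, ∀ η, 0 < η → η < η0 → ∀ᶠ x in 𝓝 x0, ∃! y, |y - y0| < η ∧ fy x y = 0 := by
  obtain ⟨η0, hη0, B⟩ := nz_box H.cfyy hyy
  refine ⟨η0, hη0, fun η hη hlt => ?_⟩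
  have hz : |x0 - x0| < η0 := by simpa using hη0
  have hzy : |y0 - y0| < η0 := by simpa using hη0
  have m1 : 0 < fy x0 (y0 + η / 2) := by
    obtain ⟨z, hz1, h⟩ := mvt (fun t => fy x0 t) (fun t => fyy x0 t) (H.hyy x0) y0 (y0 + η / 2)
    have := B x0 z hz (abs_lt_of_uIcc hz1 hzy (by rw [abs_lt]; constructor <;> linarith))
    simp only [h0, sub_zero, add_sub_cancel_left] at h
    rw [h]; positivity
  have m2 : fy x0 (y0 - η / 2) < 0 := by
    obtain ⟨z, hz1, h⟩ := mvt (fun t => fy x0 t) (fun t => fyy x0 t) (H.hyy x0) y0 (y0 - η / 2)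
    have := B x0 z hz (abs_lt_of_uIcc hz1 hzy (by rw [abs_lt]; constructor <;> linarith))
    simp only [h0, sub_zero] at h
    rw [h]; nlinarith
  have cx : ∀ y, Continuous (fun x => fy x y) := fun y =>
    H.cfy.comp (by fun_prop : Continuous (fun x : ℝ => ((x, y) : ℝ × ℝ)))
  have cy : ∀ x, Continuous (fun y => fy x y) := fun x =>
    H.cfy.comp (by fun_prop : Continuous (fun y : ℝ => ((x, y) : ℝ × ℝ)))
  filter_upwards [(cx (y0 + η / 2)).continuousAt.eventually (lt_mem_nhds m1),
    (cx (y0 - η / 2)).continuousAt.eventually (gt_mem_nhds m2),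
    Metric.ball_mem_nhds x0 hη0] with x e1 e2 e3
  rw [Metric.mem_ball, Real.dist_eq] at e3
  obtain ⟨y, hy, hy0⟩ := intermediate_value_Icc (by linarith : y0 - η / 2 ≤ y0 + η / 2)
    (cy x).continuousOn (show (0 : ℝ) ∈ _ from ⟨e2.le, e1.le⟩)
  refine ⟨y, ⟨by rw [abs_lt]; constructor <;> linarith [hy.1, hy.2], hy0⟩, ?_⟩
  rintro y' ⟨h1, h2⟩
  have hyη : |y - y0| < η0 := by rw [abs_lt]; constructor <;> linarith [hy.1, hy.2]
  obtain ⟨z, hz1, h⟩ := mvt (fun t => fy x t) (fun t => fyy x t) (H.hyy x) y y'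
  have := B x z e3 (abs_lt_of_uIcc hz1 hyη (h1.trans hlt))
  simp only at hy0
  simp only [h2, hy0, sub_zero] at h
  have := (mul_eq_zero.1 h.symm).resolve_left this.ne'
  linarith

lemma cont_root (H : Smth f fx fy fyy) {x0 y0 : ℝ} (h0 : fy x0 y0 = 0)
    (hyy : fyy x0 y0 ≠ 0) :
    ∃ η0 > 0, ∀ η, 0 < η → η < η0 → ∀ᶠ x in 𝓝 x0, ∃! y, |y - y0| < η ∧ fy x y = 0 := by
  rcases lt_or_gt_of_ne hyy with h | h
  · have := cont_root_pos H.neg (x0 := x0) (y0 := y0) (by simpa using h0) (by simpa using h)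
    simpa using this
  · exact cont_root_pos H h0 h

/-- counting lemma -/
lemma count_cont (H : Smth f fx fy fyy) {c e x0 : ℝ}
    (R : ℝ → Finset ℝ) (hR : ∀ x y, y ∈ R x ↔ y ∈ Icc c e ∧ fy x y = 0)
    (hc : fy x0 c ≠ 0) (he : fy x0 e ≠ 0) (hs : ∀ y ∈ R x0, fyy x0 y ≠ 0)
    (A : Set ℝ) (φ : ℝ → ℝ → ℤ) (k : ℝ → ℤ)
    (hφ : ∀ y0 ∈ R x0, ∃ η > 0, ∀ x y, |x - x0| < η → |y - y0| < η → x ∈ A → fy x y = 0 → φ x y = k y0) :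
    ∀ᶠ x in 𝓝 x0, x ∈ A → ∑ y ∈ R x, φ x y = ∑ y ∈ R x0, k y := by
  classical
  -- choose η
  have hη : ∀ y0 ∈ R x0, ∃ η0 > 0, ∀ η, 0 < η → η < η0 →
      (∀ᶠ x in 𝓝 x0, ∃! y, |y - y0| < η ∧ fy x y = 0) ∧
      (∀ x y, |x - x0| < η → |y - y0| < η → x ∈ A → fy x y = 0 → φ x y = k y0) ∧
      (∀ y1 ∈ R x0, y1 ≠ y0 → 2 * η < |y1 - y0|) ∧ c < y0 - η ∧ y0 + η < e := by
    intro y0 hy0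
    obtain ⟨⟨hyc, hye⟩, hyr⟩ := (hR x0 y0).1 hy0
    have hyc : c < y0 := lt_of_le_of_ne hyc (by rintro rfl; exact hc hyr)
    have hye : y0 < e := lt_of_le_of_ne hye (by rintro rfl; exact he hyr)
    obtain ⟨η1, p1, h1⟩ := cont_root H hyr (hs y0 hy0)
    obtain ⟨η2, p2, h2⟩ := hφ y0 hy0
    have : ∃ η3 > 0, ∀ y1 ∈ R x0, y1 ≠ y0 → η3 ≤ |y1 - y0| := by
      by_cases hne : ((R x0).erase y0).Nonempty
      · obtain ⟨y1, hy1, hmin⟩ := Finset.exists_min_image _ (fun y1 => |y1 - y0|) hne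
        refine ⟨|y1 - y0|, abs_pos.2 (sub_ne_zero.2 (Finset.ne_of_mem_erase hy1)), ?_⟩
        intro y2 hy2 hne2
        exact hmin y2 (Finset.mem_erase.2 ⟨hne2, hy2⟩)
      · refine ⟨1, one_pos, fun y1 hy1 hne1 => ?_⟩
        exact absurd ⟨y1, Finset.mem_erase.2 ⟨hne1, hy1⟩⟩ hne
    obtain ⟨η3, p3, h3⟩ := this
    refine ⟨min (min η1 η2) (min (η3 / 2) (min (y0 - c) (e - y0))), ?_, ?_⟩
    · refine lt_min (lt_min p1 p2) (lt_min (by linarith) (lt_min (by linarith) (by linarith)))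
    · intro η hη hlt
      simp only [lt_min_iff] at hlt
      obtain ⟨⟨l1, l2⟩, l3, l4, l5⟩ := hlt
      refine ⟨h1 η hη l1, fun x y hx hy => h2 x y (hx.trans l2) (hy.trans l2), ?_, by linarith, by linarith⟩
      intro y1 hy1 hne
      have := h3 y1 hy1 hne
      linarith
  have : ∃ η > 0, ∀ y0 ∈ R x0,
      (∀ᶠ x in 𝓝 x0, ∃! y, |y - y0| < η ∧ fy x y = 0) ∧
      (∀ x y, |x - x0| < η → |y - y0| < η → x ∈ A → fy x y = 0 → φ x y = k y0) ∧
      (∀ y1 ∈ R x0, y1 ≠ y0 → 2 * η < |y1 - y0|) ∧ c < y0 - η ∧ y0 + η < e := by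
    choose! g g1 g2 using hη
    by_cases hne : (R x0).Nonempty
    · obtain ⟨y1, hy1, hmin⟩ := Finset.exists_min_image _ g hne
      refine ⟨g y1 / 2, by linarith [g1 y1 hy1], fun y0 hy0 => g2 y0 hy0 _ (by linarith [g1 y1 hy1]) ?_⟩
      linarith [hmin y0 hy0, g1 y1 hy1]
    · exact ⟨1, one_pos, fun y0 hy0 => absurd ⟨y0, hy0⟩ hne⟩
  obtain ⟨η, hη0, hη⟩ := this
  have hK : IsCompact (Icc c e \ ⋃ y0 ∈ R x0, Metric.ball y0 η) :=
    isCompact_Icc.diff (isOpen_biUnion fun _ _ => Metric.isOpen_ball)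
  have hev : ∀ᶠ x in 𝓝 x0, ∀ y ∈ (Icc c e \ ⋃ y0 ∈ R x0, Metric.ball y0 η), fy x y ≠ 0 := by
    refine hK.eventually_forall_of_forall_eventually fun y hy => ?_
    refine (H.cfy.continuousAt (x := (x0, y))).eventually_ne ?_
    intro h
    apply hy.2
    rw [mem_iUnion₂]
    exact ⟨y, (hR x0 y).2 ⟨hy.1, h⟩, Metric.mem_ball_self hη0⟩
  have hall : ∀ᶠ x in 𝓝 x0, ∀ y0 ∈ R x0, ∃! y, |y - y0| < η ∧ fy x y = 0 :=
    (Filter.eventually_all_finset _).2 fun y0 hy0 => (hη y0 hy0).1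
  filter_upwards [hev, hall, Metric.ball_mem_nhds x0 hη0] with x h1 h2 h3 hxA
  rw [Metric.mem_ball, Real.dist_eq] at h3
  choose! Y hY1 hY2 using h2
  symm
  refine Finset.sum_bij (fun y0 _ => Y y0) ?_ ?_ ?_ ?_
  · intro y0 hy0
    obtain ⟨a1, a2⟩ := hY1 y0 hy0
    obtain ⟨-, -, -, b1, b2⟩ := hη y0 hy0
    rw [abs_lt] at a1
    exact (hR _ _).2 ⟨⟨by linarith, by linarith⟩, a2⟩
  · intro y0 hy0 y1 hy1 heq
    by_contra hne
    have b := (hη y0 hy0).2.2.1 y1 hy1 (Ne.symm hne)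
    have a0 := (hY1 y0 hy0).1
    have a1 := (hY1 y1 hy1).1
    rw [heq] at a0
    have : |y1 - y0| ≤ |Y y1 - y0| + |Y y1 - y1| := by
      have := abs_sub_le y1 (Y y1) y0
      rw [abs_sub_comm y1 (Y y1)] at this
      linarith
    linarith
  · intro y hy
    obtain ⟨hyI, hy0⟩ := (hR x y).1 hy
    by_contra hne
    push Not at hne
    refine h1 y ⟨hyI, ?_⟩ hy0
    rw [mem_iUnion₂]
    rintro ⟨y0, hy0R, hb⟩
    rw [Metric.mem_ball, Real.dist_eq] at hb
    exact hne y0 hy0R (hY2 y0 hy0R y ⟨hb, hy0⟩).symm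
  · intro y0 hy0
    obtain ⟨a1, a2⟩ := hY1 y0 hy0
    exact ((hη y0 hy0).2.1 x _ h3 a1 hxA a2).symm

end
end

section
open Filter Topology Set

/-- integer valued sign -/
noncomputable def sg (x : ℝ) : ℤ := if 0 < x then 1 else -1

lemma sg_pos {x : ℝ} (h : 0 < x) : sg x = 1 := if_pos h
lemma sg_neg {x : ℝ} (h : x < 0) : sg x = -1 := if_neg (not_lt.2 h.le)

lemma sg_congr {x y : ℝ} (hx : x ≠ 0) (h : 0 < x * y) : sg x = sg y := by
  rcases lt_or_gt_of_ne hx with h1 | h1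
  · rw [sg_neg h1, sg_neg (by nlinarith)]
  · rw [sg_pos h1, sg_pos (by nlinarith)]

lemma sg_opp {x y : ℝ} (hx : x ≠ 0) (h : x * y < 0) : sg x = - sg y := by
  rcases lt_or_gt_of_ne hx with h1 | h1
  · rw [sg_neg h1, sg_pos (by nlinarith)]
  · rw [sg_pos h1, sg_neg (by nlinarith), neg_neg]

lemma sg_noroot {g : ℝ → ℝ} (hg : Continuous g) {c e : ℝ} (hce : c ≤ e)
    (h : ∀ y ∈ Icc c e, g y ≠ 0) : sg (g c) = sg (g e) := by
  apply sg_congr (h c (left_mem_Icc.2 hce))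
  by_contra hneg
  push Not at hneg
  have hc := h c (left_mem_Icc.2 hce)
  have he := h e (right_mem_Icc.2 hce)
  have : (0 : ℝ) ∈ g '' Icc c e := by
    rcases lt_or_gt_of_ne hc with h1 | h1
    · exact intermediate_value_Icc hce hg.continuousOn ⟨h1.le, by nlinarith⟩
    · exact intermediate_value_Icc' hce hg.continuousOn ⟨by nlinarith, h1.le⟩
  obtain ⟨y, hy, hy0⟩ := this
  exact h y hy hy0

lemma near_root {g : ℝ → ℝ} {m y1 : ℝ} (hd : HasDerivAt g m y1) (h0 : g y1 = 0) (hm : m ≠ 0) :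
    ∃ η > 0, ∀ y, |y - y1| < η → y ≠ y1 → 0 < g y * m * (y - y1) := by
  have h := hasDerivAt_iff_tendsto_slope.1 hd
  have h2 : ∀ᶠ y in 𝓝[≠] y1, 0 < slope g y1 y * m := by
    have : Tendsto (fun y => slope g y1 y * m) (𝓝[≠] y1) (𝓝 (m * m)) := h.mul_const m
    exact this.eventually (lt_mem_nhds (mul_self_pos.2 hm))
  rw [eventually_nhdsWithin_iff, Metric.eventually_nhds_iff] at h2
  obtain ⟨η, hη, h2⟩ := h2
  refine ⟨η, hη, fun y hy hne => ?_⟩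
  have h3 := h2 (y := y) (by rw [Real.dist_eq]; exact hy) hne
  rw [slope_def_field, h0, sub_zero] at h3
  have hs : 0 < (y - y1) ^ 2 := by
    have := sub_ne_zero.2 hne
    positivity
  have := mul_pos h3 hs
  have e : g y / (y - y1) * m * (y - y1) ^ 2 = g y * m * (y - y1) := by
    have := sub_ne_zero.2 hne
    field_simp
  rwa [e] at this

lemma sgn_sum {g g' : ℝ → ℝ} (hg : ∀ y, HasDerivAt g (g' y) y) (c : ℝ) (hc : g c ≠ 0) (n : ℕ) :
    ∀ (e : ℝ) (R : Finset ℝ), R.card = n → c ≤ e → g e ≠ 0 → (∀ y, y ∈ R ↔ y ∈ Icc c e ∧ g y = 0) →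
      (∀ y ∈ R, g' y ≠ 0) → 2 * ∑ y ∈ R, sg (g' y) = sg (g e) - sg (g c) := by
  classical
  have gc : Continuous g := continuous_iff_continuousAt.2 fun y => (hg y).continuousAt
  induction n with
  | zero =>
    intro e R hn hce he hR hs
    rw [Finset.card_eq_zero] at hn
    subst hn
    rw [sg_noroot gc hce (fun y hy h0 => by
      have := (hR y).2 ⟨hy, h0⟩; simp at this)]
    simp
  | succ n ih =>
    intro e R hn hce he hR hs
    have hne : R.Nonempty := by rw [← Finset.card_pos]; omega
    obtain ⟨y1, hy1, hmax⟩ := Finset.exists_max_image R id hne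
    simp only [id] at hmax
    obtain ⟨⟨l1, l2⟩, hr⟩ := (hR y1).1 hy1
    have l1 : c < y1 := lt_of_le_of_ne l1 (by rintro rfl; exact hc hr)
    have l2 : y1 < e := lt_of_le_of_ne l2 (by rintro rfl; exact he hr)
    obtain ⟨η, hη, hn1⟩ := near_root (hg y1) hr (hs y1 hy1)
    -- right point
    have er : sg (g e) = sg (g' y1) := by
      set t := min e (y1 + η / 2) with ht
      have t1 : y1 < t := lt_min l2 (by linarith)
      have t2 : t ≤ e := min_le_left _ _
      have t3 : t ≤ y1 + η / 2 := min_le_right _ _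
      have h1 := hn1 t (by rw [abs_lt]; constructor <;> linarith) t1.ne'
      have h2 : 0 < g t * g' y1 := by
        by_contra hh; push Not at hh
        nlinarith
      have h3 := sg_noroot gc t2 (fun y hy h0 => by
        have := hmax y ((hR y).2 ⟨⟨by linarith [hy.1], hy.2⟩, h0⟩)
        linarith [hy.1])
      rw [← h3]
      exact sg_congr (left_ne_zero_of_mul h2.ne') h2
    have : ∃ t, c < t ∧ t < y1 ∧ |t - y1| < η ∧ ∀ y ∈ R.erase y1, y < t := by
      have h1 : ∀ᶠ t in 𝓝[<] y1, c < t := eventually_nhdsWithin_of_eventually_nhds (lt_mem_nhds l1)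
      have h2 : ∀ᶠ t in 𝓝[<] y1, t < y1 := self_mem_nhdsWithin
      have h3 : ∀ᶠ t in 𝓝[<] y1, |t - y1| < η := by
        apply eventually_nhdsWithin_of_eventually_nhds
        filter_upwards [Metric.ball_mem_nhds y1 hη] with t ht
        rwa [Metric.mem_ball, Real.dist_eq] at ht
      have h4 : ∀ᶠ t in 𝓝[<] y1, ∀ y ∈ R.erase y1, y < t := by
        rw [Filter.eventually_all_finset]
        intro y hy
        apply eventually_nhdsWithin_of_eventually_nhds
        apply lt_mem_nhds
        exact lt_of_le_of_ne (hmax y (Finset.mem_of_mem_erase hy)) (Finset.ne_of_mem_erase hy)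
      exact (h1.and (h2.and (h3.and h4))).exists
    obtain ⟨t, t1, t2, t3, t4⟩ := this
    have h1 := hn1 t t3 t2.ne
    have h2 : g t * g' y1 < 0 := by
      by_contra hh; push Not at hh
      nlinarith
    have hgt : g t ≠ 0 := left_ne_zero_of_mul h2.ne
    have el : sg (g t) = - sg (g' y1) := sg_opp hgt h2
    have hi := ih t (R.erase y1) (by rw [Finset.card_erase_of_mem hy1]; omega) t1.le hgt (by
      intro y
      rw [Finset.mem_erase, hR]
      constructor
      · rintro ⟨h1, h2, h3⟩
        exact ⟨⟨h2.1, (t4 y (Finset.mem_erase.2 ⟨h1, (hR y).2 ⟨h2, h3⟩⟩)).le⟩, h3⟩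
      · rintro ⟨h2, h3⟩
        exact ⟨by linarith [h2.2] |> fun (h : y < y1) => h.ne, ⟨h2.1, by linarith [h2.2]⟩, h3⟩)
      (fun y hy => hs y (Finset.mem_of_mem_erase hy))
    rw [← Finset.add_sum_erase R _ hy1, mul_add, hi, er, el]
    ring

section
variable {f fx fy fyy : ℝ → ℝ → ℝ}

/-- sign of `fx` on the polar curve, right of the base point -/
lemma fx_pos (H : Smth f fx fy fyy) {a m b c e : ℝ}
    (h1c : ∀ x ∈ Icc a m, fy x c < 0) (h1e : ∀ x ∈ Icc a m, 0 < fy x e)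
    (h2 : ∀ x ∈ Icc a m, ∀ y ∈ Icc c e, fy x y = 0 →
      (x = a ∧ y = b) ∨ (a < x ∧ fx x y ≠ 0 ∧ fyy x y ≠ 0))
    (h3 : ∀ x ∈ Icc a m, ∀ y ∈ Icc c e, (x ≠ a ∨ y ≠ b) → 0 < f x y) (h30 : f a b = 0)
    {x0 y0 : ℝ} (hx0 : x0 ∈ Icc a m) (hy0 : y0 ∈ Icc c e) (hr : fy x0 y0 = 0) (hne : a < x0) :
    0 < fx x0 y0 := by
  have hfx : fx x0 y0 ≠ 0 := by
    rcases h2 x0 hx0 y0 hy0 hr with h | h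
    · exact absurd h.1 hne.ne'
    · exact h.2.1
  by_contra hneg
  have hneg : fx x0 y0 < 0 := lt_of_le_of_ne (not_lt.1 hneg) hfx
  let K : Set (ℝ × ℝ) := (Icc a x0 ×ˢ Icc c e) ∩
    ({q | fy q.1 q.2 = 0} ∩ ({q | f x0 y0 ≤ f q.1 q.2} ∩ {q | fx q.1 q.2 ≤ 0}))
  have hK : IsCompact K := by
    refine (isCompact_Icc.prod isCompact_Icc).inter_right ?_
    refine (isClosed_eq H.cfy continuous_const).inter ?_
    exact (isClosed_le continuous_const H.cf).inter (isClosed_le H.cfx continuous_const)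
  have hmem : (x0, y0) ∈ K := ⟨⟨⟨hne.le, le_rfl⟩, hy0⟩, hr, le_refl (f x0 y0), hneg.le⟩
  obtain ⟨⟨x1, y1⟩, hq, hmin⟩ := hK.exists_isMinOn ⟨_, hmem⟩ continuous_fst.continuousOn
  obtain ⟨⟨hx1, hy1⟩, hr1, hf1, hfx1⟩ := hq
  simp only [mem_ofPred_eq] at hx1 hy1 hr1 hf1 hfx1
  have hx1m : x1 ∈ Icc a m := ⟨hx1.1, hx1.2.trans hx0.2⟩
  have hf0 : 0 < f x0 y0 := h3 x0 hx0 y0 hy0 (Or.inl hne.ne')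
  rcases h2 x1 hx1m y1 hy1 hr1 with h | ⟨ha1, hfx1n, hyy1⟩
  · rw [h.1, h.2, h30] at hf1; linarith
  have hfx1 : fx x1 y1 < 0 := lt_of_le_of_ne hfx1 hfx1n
  have hyc : c < y1 := lt_of_le_of_ne hy1.1 (by rintro rfl; exact (h1c x1 hx1m).ne hr1)
  have hye : y1 < e := lt_of_le_of_ne hy1.2 (by rintro rfl; exact (h1e x1 hx1m).ne' hr1)
  obtain ⟨η1, p1, hLM⟩ := LM H.neg (x0 := x1) (y0 := y1) (by simpa using hr1) (by simpa using hfx1)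
    (by simpa using hyy1)
  obtain ⟨η2, p2, hcr⟩ := cont_root H hr1 hyy1
  obtain ⟨η3, p3, hfxn⟩ := nz_box (g := fun x y => - fx x y) H.cfx.neg (x0 := x1) (y0 := y1)
    (by simpa using hfx1)
  set η := min (min η1 η2) (min η3 (min (y1 - c) (e - y1))) / 2 with hη
  have hmp : 0 < min (min η1 η2) (min η3 (min (y1 - c) (e - y1))) :=
    lt_min (lt_min p1 p2) (lt_min p3 (lt_min (by linarith) (by linarith)))
  have hlt : η < min (min η1 η2) (min η3 (min (y1 - c) (e - y1))) := by linarith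
  have hη0 : 0 < η := by linarith
  simp only [lt_min_iff] at hlt
  obtain ⟨⟨l1, l2⟩, l3, l4, l5⟩ := hlt
  have hev := hcr η hη0 l2
  have : ∃ x, (∃! y, |y - y1| < η ∧ fy x y = 0) ∧ a < x ∧ x < x1 ∧ |x - x1| < η := by
    have e1 : ∀ᶠ t in 𝓝[<] x1, a < t := eventually_nhdsWithin_of_eventually_nhds (lt_mem_nhds ha1)
    have e2 : ∀ᶠ t in 𝓝[<] x1, t < x1 := self_mem_nhdsWithin
    have e3 : ∀ᶠ t in 𝓝[<] x1, |t - x1| < η := by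
      apply eventually_nhdsWithin_of_eventually_nhds
      filter_upwards [Metric.ball_mem_nhds x1 hη0] with t ht
      rwa [Metric.mem_ball, Real.dist_eq] at ht
    exact ((eventually_nhdsWithin_of_eventually_nhds hev).and (e1.and (e2.and e3))).exists
  obtain ⟨x, ⟨y, ⟨hy, hyr⟩, -⟩, hax, hxx, hxη⟩ := this
  have h5 := ((hLM x y (hxη.trans l1) (hy.trans l1) (by simpa using hyr)).2.1 hxx)
  have h6 := hfxn x y (hxη.trans l3) (hy.trans l3)
  rw [abs_lt] at hy
  have hin : (x, y) ∈ K := ⟨⟨⟨hax.le, by simp only; linarith [hx1.2]⟩, ⟨by simp only; linarith, by simp only; linarith⟩⟩,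
    hyr, by simp only [mem_ofPred_eq]; linarith, by simp only [mem_ofPred_eq]; linarith⟩
  have := hmin hin
  simp only [mem_ofPred_eq] at this
  linarith


lemma right_half (H : Smth f fx fy fyy) {a m b c e ε : ℝ} (ham : a < m) (hcb : c < b) (hbe : b < e)
    (h1c : ∀ x ∈ Icc a m, fy x c < 0) (h1e : ∀ x ∈ Icc a m, 0 < fy x e)
    (h2 : ∀ x ∈ Icc a m, ∀ y ∈ Icc c e, fy x y = 0 →
      (x = a ∧ y = b) ∨ (a < x ∧ fx x y ≠ 0 ∧ fyy x y ≠ 0))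
    (h3 : ∀ x ∈ Icc a m, ∀ y ∈ Icc c e, (x ≠ a ∨ y ≠ b) → 0 < f x y) (h30 : f a b = 0)
    (hε : 0 < ε) (h4 : ∀ y ∈ Icc c e, ε < f m y) (hfin : ∀ x, {y | fy x y = 0}.Finite)
    (Z : Finset (ℝ × ℝ)) (hZ : ∀ q, q ∈ Z ↔ q.1 ∈ Icc a m ∧ q.2 ∈ Icc c e ∧
      f q.1 q.2 = ε ∧ fy q.1 q.2 = 0) :
    ∑ q ∈ Z, sg (fyy q.1 q.2) = 1 := by
  classical
  obtain ⟨R, hR⟩ : ∃ R : ℝ → Finset ℝ, ∀ x y, y ∈ R x ↔ y ∈ Icc c e ∧ fy x y = 0 := by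
    refine ⟨fun x => (hfin x).toFinset.filter (fun y => y ∈ Icc c e), ?_⟩
    intro x y
    simp only [Finset.mem_filter, Set.Finite.mem_toFinset, mem_ofPred_eq]
    exact and_comm
  have hpos : ∀ x ∈ Ioc a m, ∀ y ∈ Icc c e, fy x y = 0 → 0 < fx x y ∧ fyy x y ≠ 0 := by
    intro x hx y hy hr
    have hx' : x ∈ Icc a m := ⟨hx.1.le, hx.2⟩
    refine ⟨fx_pos H h1c h1e h2 h3 h30 hx' hy hr hx.1, ?_⟩
    rcases h2 x hx' y hy hr with h | h
    · exact absurd h.1 hx.1.ne'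
    · exact h.2.2
  let Φ : ℝ → ℤ := fun x => ∑ y ∈ R x, (if f x y < ε then sg (fyy x y) else 0) +
    ∑ q ∈ Z.filter (fun q => q.1 ≤ x), sg (fyy q.1 q.2)
  -- local constancy
  have hloc : ∀ x0 ∈ Ioc a m, ∀ᶠ x in 𝓝 x0, Φ x = Φ x0 := by
    intro x0 hx0
    have hx0' : x0 ∈ Icc a m := ⟨hx0.1.le, hx0.2⟩
    -- local behaviour of the sign
    have hsgl : ∀ y0 ∈ R x0, ∃ η > 0, ∀ x y, |x - x0| < η → |y - y0| < η →
        sg (fyy x y) = sg (fyy x0 y0) := by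
      intro y0 hy0
      obtain ⟨hyI, hyr⟩ := (hR _ _).1 hy0
      have hn := (hpos x0 hx0 y0 hyI hyr).2
      obtain ⟨η, hη, h⟩ := nz_box (g := fun x y => fyy x y * fyy x0 y0)
        (H.cfyy.mul continuous_const) (x0 := x0) (y0 := y0) (mul_self_pos.2 hn)
      refine ⟨η, hη, fun x y hx hy => ?_⟩
      have := h x y hx hy
      exact sg_congr (left_ne_zero_of_mul this.ne') this
    have hpt : ∀ y0 ∈ R x0, ∃ η > 0, ∀ x y, |x - x0| < η → |y - y0| < η → fy x y = 0 →
        sg (fyy x y) = sg (fyy x0 y0) ∧ (x0 ≤ x → (f x y < ε ↔ f x0 y0 < ε)) ∧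
        (x < x0 → (f x y < ε ↔ f x0 y0 ≤ ε)) := by
      intro y0 hy0
      obtain ⟨hyI, hyr⟩ := (hR _ _).1 hy0
      obtain ⟨η1, p1, b1⟩ := hsgl y0 hy0
      obtain ⟨hfx0, hn⟩ := hpos x0 hx0 y0 hyI hyr
      obtain ⟨η2, p2, b2⟩ := LM H hyr hfx0 hn
      rcases lt_trichotomy (f x0 y0) ε with hlt | heq | hgt
      · obtain ⟨η3, p3, b3⟩ := nz_box (g := fun x y => ε - f x y)
          (continuous_const.sub H.cf) (x0 := x0) (y0 := y0) (by linarith)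
        refine ⟨min η1 η3, lt_min p1 p3, fun x y hx hy hr => ?_⟩
        rw [lt_min_iff] at hx hy
        have := b3 x y hx.2 hy.2
        exact ⟨b1 x y hx.1 hy.1, fun _ => ⟨fun _ => hlt, fun _ => by linarith⟩,
          fun _ => ⟨fun _ => hlt.le, fun _ => by linarith⟩⟩
      · refine ⟨min η1 η2, lt_min p1 p2, fun x y hx hy hr => ?_⟩
        rw [lt_min_iff] at hx hy
        have := b2 x y hx.2 hy.2 hr
        refine ⟨b1 x y hx.1 hy.1, fun h => ⟨fun h' => ?_, fun h' => ?_⟩, fun h => ⟨fun _ => heq.le, fun _ => ?_⟩⟩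
        · linarith [this.1 h]
        · linarith
        · linarith [this.2.1 h]
      · obtain ⟨η3, p3, b3⟩ := nz_box (g := fun x y => f x y - ε)
          (H.cf.sub continuous_const) (x0 := x0) (y0 := y0) (by linarith)
        refine ⟨min η1 η3, lt_min p1 p3, fun x y hx hy hr => ?_⟩
        rw [lt_min_iff] at hx hy
        have := b3 x y hx.2 hy.2
        exact ⟨b1 x y hx.1 hy.1, fun _ => ⟨fun _ => by linarith, fun _ => by linarith⟩,
          fun _ => ⟨fun _ => by linarith, fun _ => by linarith⟩⟩
    have hs0 : ∀ y ∈ R x0, fyy x0 y ≠ 0 := fun y hy =>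
      (hpos x0 hx0 y ((hR _ _).1 hy).1 ((hR _ _).1 hy).2).2
    have c1 := count_cont H R hR (h1c x0 hx0').ne (h1e x0 hx0').ne' hs0 (Ici x0)
      (fun x y => if f x y < ε then sg (fyy x y) else 0)
      (fun y => if f x0 y < ε then sg (fyy x0 y) else 0) (by
        intro y0 hy0
        obtain ⟨η, hη, h⟩ := hpt y0 hy0
        refine ⟨η, hη, fun x y hx hy hA hr => ?_⟩
        obtain ⟨e1, e2, -⟩ := h x y hx hy hr
        simp only [e1, e2 hA])
    have c2 := count_cont H R hR (h1c x0 hx0').ne (h1e x0 hx0').ne' hs0 (Iio x0)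
      (fun x y => if f x y < ε then sg (fyy x y) else 0)
      (fun y => if f x0 y ≤ ε then sg (fyy x0 y) else 0) (by
        intro y0 hy0
        obtain ⟨η, hη, h⟩ := hpt y0 hy0
        refine ⟨η, hη, fun x y hx hy hA hr => ?_⟩
        obtain ⟨e1, -, e2⟩ := h x y hx hy hr
        simp only [e1, e2 hA])
    have z1 : ∀ᶠ x in 𝓝 x0, ∀ q ∈ Z, (x0 ≤ x → (q.1 ≤ x ↔ q.1 ≤ x0)) ∧ (x < x0 → (q.1 ≤ x ↔ q.1 < x0)) := by
      rw [Filter.eventually_all_finset]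
      intro q hq
      rcases lt_trichotomy q.1 x0 with h | h | h
      · filter_upwards [lt_mem_nhds h] with x hx
        exact ⟨fun _ => ⟨fun _ => h.le, fun _ => hx.le⟩, fun _ => ⟨fun _ => h, fun _ => hx.le⟩⟩
      · filter_upwards with x
        exact ⟨fun h' => ⟨fun _ => h.le, fun _ => by linarith⟩,
          fun h' => ⟨fun _ => by linarith, fun _ => by linarith⟩⟩
      · filter_upwards [gt_mem_nhds h] with x hx
        exact ⟨fun h' => ⟨fun _ => by linarith, fun _ => by linarith⟩,
          fun h' => ⟨fun _ => by linarith, fun _ => by linarith⟩⟩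
    filter_upwards [c1, c2, z1] with x k1 k2 k3
    rcases le_or_gt x0 x with hx | hx
    · simp only [Φ]
      rw [k1 hx]
      congr 1
      refine Finset.sum_congr (Finset.filter_congr fun q hq => (k3 q hq).1 hx) fun _ _ => rfl
    · simp only [Φ]
      rw [k2 hx, Finset.filter_congr (fun q hq => (k3 q hq).2 hx)]
      have s1 : ∑ y ∈ R x0, (if f x0 y ≤ ε then sg (fyy x0 y) else 0) =
          ∑ y ∈ R x0, (if f x0 y < ε then sg (fyy x0 y) else 0) +
          ∑ y ∈ R x0 with f x0 y = ε, sg (fyy x0 y) := by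
        rw [Finset.sum_filter (s := R x0) (p := fun y => f x0 y = ε), ← Finset.sum_add_distrib]
        refine Finset.sum_congr rfl fun y _ => ?_
        rcases lt_trichotomy (f x0 y) ε with h | h | h
        · simp [h, h.le, h.ne]
        · simp [h]
        · simp [not_le.2 h, not_lt.2 h.le, h.ne']
      have s2 : ∑ q ∈ Z with q.1 ≤ x0, sg (fyy q.1 q.2) = ∑ q ∈ Z with q.1 < x0, sg (fyy q.1 q.2) +
          ∑ q ∈ Z with q.1 = x0, sg (fyy q.1 q.2) := by
        rw [Finset.sum_filter, Finset.sum_filter, Finset.sum_filter, ← Finset.sum_add_distrib]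
        refine Finset.sum_congr rfl fun q _ => ?_
        rcases lt_trichotomy q.1 x0 with h | h | h
        · simp [h, h.le, h.ne]
        · simp [h]
        · simp [not_le.2 h, not_lt.2 h.le, h.ne']
      have s3 : ∑ y ∈ R x0 with f x0 y = ε, sg (fyy x0 y) =
          ∑ q ∈ Z with q.1 = x0, sg (fyy q.1 q.2) := by
        refine Finset.sum_bij (fun y _ => (x0, y)) ?_ ?_ ?_ ?_
        · intro y hy
          rw [Finset.mem_filter, hR] at hy
          rw [Finset.mem_filter, hZ]
          exact ⟨⟨hx0', hy.1.1, hy.2, hy.1.2⟩, rfl⟩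
        · intro y _ y' _ h
          exact (Prod.ext_iff.1 h).2
        · rintro ⟨q1, q2⟩ hq
          rw [Finset.mem_filter, hZ] at hq
          obtain ⟨⟨w1, w2, w3, w4⟩, w5⟩ := hq
          simp only at w1 w2 w3 w4 w5
          subst w5
          exact ⟨q2, by rw [Finset.mem_filter, hR]; exact ⟨⟨w2, w4⟩, w3⟩, rfl⟩
        · intro y _; rfl
      rw [s1, s2, s3]; ring
  have hconst : ∀ x ∈ Ioc a m, ∀ x' ∈ Ioc a m, Φ x = Φ x' := by
    intro x hx x' hx'
    refine isPreconnected_Ioc.constant ?_ hx hx'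
    intro x0 hx0
    have : Tendsto Φ (𝓝 x0) (𝓝 (Φ x0)) := by
      refine (tendsto_const_nhds (x := Φ x0)).congr' ?_
      filter_upwards [hloc x0 hx0] with t ht
      exact ht.symm
    exact this.mono_left nhdsWithin_le_nhds
  -- near a
  have hnear : ∀ᶠ x in 𝓝 a, ∀ y ∈ Icc c e, fy x y ≠ 0 ∨ f x y < ε := by
    refine isCompact_Icc.eventually_forall_of_forall_eventually fun y hy => ?_
    by_cases h : fy a y = 0
    · have hb : f a y < ε := by
        rcases h2 a ⟨le_rfl, ham.le⟩ y hy h with h | h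
        · rw [h.2, h30]; exact hε
        · exact absurd h.1 (lt_irrefl _)
      filter_upwards [(H.cf.continuousAt (x := (a, y))).eventually (gt_mem_nhds hb)] with q hq
      exact Or.inr hq
    · filter_upwards [(H.cfy.continuousAt (x := (a, y))).eventually_ne h] with q hq
      exact Or.inl hq
  obtain ⟨η, hη, hn⟩ := Metric.eventually_nhds_iff.1 hnear
  set x1 := min m (a + η / 2) with hx1
  have hx1I : x1 ∈ Ioc a m := ⟨lt_min ham (by linarith), min_le_left _ _⟩
  have hx1I' : x1 ∈ Icc a m := ⟨hx1I.1.le, hx1I.2⟩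
  have hx1η : x1 ≤ a + η / 2 := min_le_right _ _
  have hn' : ∀ x, a ≤ x → x ≤ x1 → ∀ y ∈ Icc c e, fy x y ≠ 0 ∨ f x y < ε := by
    intro x h1 h2
    refine hn ?_
    rw [Real.dist_eq, abs_lt]; constructor <;> linarith
  have hΦ1 : Φ x1 = ∑ y ∈ R x1, sg (fyy x1 y) := by
    simp only [Φ]
    rw [Finset.filter_eq_empty_iff.2, Finset.sum_empty, add_zero]
    · refine Finset.sum_congr rfl fun y hy => ?_
      obtain ⟨g1, g2⟩ := (hR _ _).1 hy
      rw [if_pos ((hn' x1 hx1I.1.le le_rfl y g1).resolve_left (not_not.2 g2))]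
    · intro q hq hle
      obtain ⟨w1, w2, w3, w4⟩ := (hZ q).1 hq
      have := (hn' q.1 w1.1 hle q.2 w2).resolve_left (not_not.2 w4)
      linarith
  have hsum := sgn_sum (H.hyy x1) c (h1c x1 hx1I').ne _ e (R x1) rfl (hcb.trans hbe).le
    (h1e x1 hx1I').ne' (hR x1)
    (fun y hy => (hpos x1 hx1I y ((hR _ _).1 hy).1 ((hR _ _).1 hy).2).2)
  rw [sg_pos (h1e x1 hx1I'), sg_neg (h1c x1 hx1I')] at hsum
  have hΦm : Φ m = ∑ q ∈ Z, sg (fyy q.1 q.2) := by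
    simp only [Φ]
    rw [Finset.sum_eq_zero, zero_add, Finset.filter_true_of_mem]
    · intro q hq
      exact ((hZ q).1 hq).1.2
    · intro y hy
      rw [if_neg (not_lt.2 (h4 y ((hR _ _).1 hy).1).le)]
  rw [← hΦm, hconst m ⟨ham, le_rfl⟩ x1 hx1I, hΦ1]
  linarith

lemma box_count (H : Smth f fx fy fyy) {a δ b c e ε : ℝ} (hδ : 0 < δ) (hcb : c < b) (hbe : b < e)
    (h1c : ∀ x ∈ Icc (a - δ) (a + δ), fy x c < 0) (h1e : ∀ x ∈ Icc (a - δ) (a + δ), 0 < fy x e)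
    (h2 : ∀ x ∈ Icc (a - δ) (a + δ), ∀ y ∈ Icc c e, fy x y = 0 →
      (x = a ∧ y = b) ∨ (x ≠ a ∧ fx x y ≠ 0 ∧ fyy x y ≠ 0))
    (h3 : ∀ x ∈ Icc (a - δ) (a + δ), ∀ y ∈ Icc c e, (x ≠ a ∨ y ≠ b) → 0 < f x y)
    (h30 : f a b = 0)
    (hε : 0 < ε) (h4 : ∀ y ∈ Icc c e, ε < f (a - δ) y ∧ ε < f (a + δ) y)
    (hfin : ∀ x, {y | fy x y = 0}.Finite)
    (Z : Finset (ℝ × ℝ)) (hZ : ∀ q, q ∈ Z ↔ q.1 ∈ Icc (a - δ) (a + δ) ∧ q.2 ∈ Icc c e ∧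
      f q.1 q.2 = ε ∧ fy q.1 q.2 = 0) :
    ∑ q ∈ Z, sg (fyy q.1 q.2) = 2 := by
  classical
  have hna : ∀ q ∈ Z, q.1 ≠ a := by
    rintro ⟨x, y⟩ hq hqa
    obtain ⟨w1, w2, w3, w4⟩ := (hZ _).1 hq
    simp only at *
    rcases h2 x w1 y w2 w4 with h | h
    · rw [h.1, h.2, h30] at w3; linarith
    · exact h.1 hqa
  have hr := right_half H (a := a) (m := a + δ) (b := b) (c := c) (e := e) (ε := ε)
    (by linarith) hcb hbe
    (fun x hx => h1c x ⟨by linarith [hx.1], hx.2⟩) (fun x hx => h1e x ⟨by linarith [hx.1], hx.2⟩)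
    (fun x hx y hy h0 => by
      rcases h2 x ⟨by linarith [hx.1], hx.2⟩ y hy h0 with h | h
      · exact Or.inl h
      · exact Or.inr ⟨lt_of_le_of_ne hx.1 h.1.symm, h.2⟩)
    (fun x hx => h3 x ⟨by linarith [hx.1], hx.2⟩) h30 hε (fun y hy => (h4 y hy).2) hfin
    (Z.filter (fun q => a ≤ q.1)) (by
      intro q
      rw [Finset.mem_filter, hZ]
      constructor
      · rintro ⟨⟨w1, w2⟩, w3⟩
        exact ⟨⟨w3, w1.2⟩, w2⟩
      · rintro ⟨w1, w2⟩
        exact ⟨⟨⟨by linarith [w1.1], w1.2⟩, w2⟩, w1.1⟩)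
  have hl := right_half H.refl (a := -a) (m := -a + δ) (b := b) (c := c) (e := e) (ε := ε)
    (by linarith) hcb hbe
    (fun x hx => h1c (-x) ⟨by linarith [hx.2], by linarith [hx.1]⟩)
    (fun x hx => h1e (-x) ⟨by linarith [hx.2], by linarith [hx.1]⟩)
    (fun x hx y hy h0 => by
      rcases h2 (-x) ⟨by linarith [hx.2], by linarith [hx.1]⟩ y hy h0 with h | h
      · exact Or.inl ⟨by linarith [h.1], h.2⟩
      · exact Or.inr ⟨lt_of_le_of_ne hx.1 (fun h' => h.1 (by linarith)), neg_ne_zero.2 h.2.1, h.2.2⟩)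
    (fun x hx y hy h => h3 (-x) ⟨by linarith [hx.2], by linarith [hx.1]⟩ y hy
      (h.imp_left (fun h h' => h (by linarith))))
    (by simpa using h30) hε (fun y hy => by
      have := (h4 y hy).1
      rwa [show -(-a + δ) = a - δ by ring]) (fun x => hfin (-x))
    ((Z.filter (fun q => ¬ a ≤ q.1)).map ((Equiv.neg ℝ).prodCongr (Equiv.refl ℝ)).toEmbedding) (by
      rintro ⟨x, y⟩
      rw [Finset.mem_map_equiv, Finset.mem_filter, hZ]
      simp only [Equiv.prodCongr_symm, Equiv.prodCongr_apply, Prod.map, Equiv.neg_symm,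
        Equiv.neg_apply, Equiv.refl_symm, Equiv.refl_apply]
      constructor
      · rintro ⟨⟨w1, w2⟩, w3⟩
        exact ⟨⟨by linarith, by linarith [w1.1]⟩, w2⟩
      · rintro ⟨w1, w2⟩
        have hq : (-x, y) ∈ Z := (hZ _).2 ⟨⟨by linarith [w1.2], by linarith [w1.1]⟩, w2⟩
        refine ⟨(hZ _).1 hq, fun h => hna _ hq ?_⟩
        have := w1.1
        simp only
        linarith)
  rw [Finset.sum_map] at hl
  rw [← Finset.sum_filter_add_sum_filter_not Z (fun q => a ≤ q.1), hr]
  simp only [Equiv.coe_toEmbedding, Equiv.prodCongr_apply, Prod.map, Equiv.neg_apply, neg_neg,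
    Equiv.refl_apply] at hl
  rw [hl]; norm_num

end
end

section
open Filter Topology Set

section
variable {f fx fy fyy : ℝ → ℝ → ℝ}

lemma ev_small {ι : Type*} (s : Finset ι) (g : ι → ℝ) (h : ∀ i ∈ s, 0 < g i) :
    ∀ᶠ r in 𝓝[>] (0 : ℝ), ∀ i ∈ s, r < g i := by
  rw [Filter.eventually_all_finset]
  intro i hi
  exact eventually_nhdsWithin_of_eventually_nhds (gt_mem_nhds (h i hi))

/-- the data of a good box around a zero -/
structure GBox (f fx fy fyy : ℝ → ℝ → ℝ) (σ a b r δ : ℝ) : Prop where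
  hr : 0 < r
  hδ : 0 < δ
  hσ : δ < σ
  h1c : ∀ x ∈ Icc (a - δ) (a + δ), fy x (b - r) < 0
  h1e : ∀ x ∈ Icc (a - δ) (a + δ), 0 < fy x (b + r)
  h2 : ∀ x ∈ Icc (a - δ) (a + δ), ∀ y ∈ Icc (b - r) (b + r), fy x y = 0 →
      (x = a ∧ y = b) ∨ (x ≠ a ∧ fx x y ≠ 0 ∧ fyy x y ≠ 0)

lemma exists_gbox (H : Smth f fx fy fyy) {a b σ : ℝ} (hσ : 0 < σ)
    (h0 : f a b = 0) (hpos : ∀ y, y ≠ b → 0 < f a y)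
    (hfin : {y | fy a y = 0}.Finite)
    (hB : {q : ℝ × ℝ | fy q.1 q.2 = 0 ∧ (fx q.1 q.2 = 0 ∨ fyy q.1 q.2 = 0)}.Finite) :
    ∃ r δ, GBox f fx fy fyy σ a b r δ := by
  classical
  have e1 := ev_small (hfin.toFinset.filter (fun y => y ≠ b)) (fun y => |y - b|) (by
    intro y hy
    exact abs_pos.2 (sub_ne_zero.2 (Finset.mem_filter.1 hy).2))
  obtain ⟨r, hr1, hr⟩ := (e1.and self_mem_nhdsWithin).exists
  replace hr : 0 < r := hr
  have hroot : ∀ y, |y - b| ≤ r → fy a y = 0 → y = b := by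
    intro y hy h
    by_contra hne
    have := hr1 y (by simp [h, hne])
    linarith
  have hcy : Continuous (fun y => fy a y) := H.cfy.comp (by fun_prop : Continuous fun y : ℝ => (a, y))
  have hup : 0 < fy a (b + r) := by
    obtain ⟨z, hz, h1⟩ := mvt (fun t => f a t) (fun t => fy a t) (H.hy a) b (b + r)
    have h2 := hpos (b + r) (by linarith)
    simp only [h0, sub_zero, add_sub_cancel_left] at h1
    rw [uIcc_of_le (by linarith)] at hz
    have h3 : 0 < fy a z := by
      rw [h1] at h2
      exact pos_of_mul_pos_left h2 hr.le
    by_contra hcon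
    push Not at hcon
    obtain ⟨w, hw, hw0⟩ := intermediate_value_Icc' hz.2 hcy.continuousOn ⟨hcon, h3.le⟩
    have hwb := hroot w (by rw [abs_le]; constructor <;> linarith [hw.1, hw.2, hz.1]) hw0
    have : w = z := le_antisymm (by linarith [hz.1]) hw.1
    rw [← this] at h3
    exact h3.ne' hw0
  have hdn : fy a (b - r) < 0 := by
    obtain ⟨z, hz, h1⟩ := mvt (fun t => f a t) (fun t => fy a t) (H.hy a) b (b - r)
    have h2 := hpos (b - r) (by linarith)
    simp only [h0, sub_zero] at h1
    rw [uIcc_of_ge (by linarith)] at hz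
    have h3 : fy a z < 0 := by
      rw [h1] at h2
      by_contra hcon
      push Not at hcon
      nlinarith
    by_contra hcon
    push Not at hcon
    obtain ⟨w, hw, hw0⟩ := intermediate_value_Icc' hz.1 hcy.continuousOn ⟨h3.le, hcon⟩
    have hwb := hroot w (by rw [abs_le]; constructor <;> linarith [hw.1, hw.2, hz.2]) hw0
    have : w = z := le_antisymm hw.2 (by linarith [hz.2])
    rw [← this] at h3
    exact h3.ne hw0
  have d1 := ev_small (hB.toFinset.filter (fun q => q.1 ≠ a)) (fun q => |q.1 - a|) (by
    intro y hy
    exact abs_pos.2 (sub_ne_zero.2 (Finset.mem_filter.1 hy).2))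
  obtain ⟨η1, p1, b1⟩ := nz_box (g := fun x y => fy x y) H.cfy (x0 := a) (y0 := b + r) hup
  obtain ⟨η2, p2, b2⟩ := nz_box (g := fun x y => - fy x y) H.cfy.neg (x0 := a) (y0 := b - r)
    (by linarith)
  have d2 : ∀ᶠ δ in 𝓝[>] (0:ℝ), δ < σ ∧ δ < η1 ∧ δ < η2 := by
    apply eventually_nhdsWithin_of_eventually_nhds
    exact (gt_mem_nhds hσ).and ((gt_mem_nhds p1).and (gt_mem_nhds p2))
  obtain ⟨δ, ⟨hδ1, hδσ, hδ2, hδ3⟩, hδ⟩ := ((d1.and d2).and self_mem_nhdsWithin).exists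
  replace hδ : 0 < δ := hδ
  refine ⟨r, δ, hr, hδ, hδσ, ?_, ?_, ?_⟩
  · intro x hx
    have := b2 x (b - r) (by rw [abs_lt]; constructor <;> linarith [hx.1, hx.2]) (by simpa using p2)
    linarith
  · intro x hx
    exact b1 x (b + r) (by rw [abs_lt]; constructor <;> linarith [hx.1, hx.2]) (by simpa using p1)
  · intro x hx y hy hxy
    by_cases hxa : x = a
    · subst hxa
      exact Or.inl ⟨rfl, hroot y (by rw [abs_le]; constructor <;> linarith [hy.1, hy.2]) hxy⟩
    · refine Or.inr ⟨hxa, ?_⟩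
      by_contra hcon
      have := hδ1 (x, y) (by
        simp only [Finset.mem_filter, Set.Finite.mem_toFinset, mem_ofPred_eq]
        refine ⟨⟨hxy, ?_⟩, hxa⟩
        tauto)
      have h' : |x - a| ≤ δ := by rw [abs_le]; constructor <;> linarith [hx.1, hx.2]
      simp only at this
      linarith

lemma real_count (H : Smth f fx fy fyy) (hnn : ∀ x y, 0 ≤ f x y)
    (Zs : Finset (ℝ × ℝ)) (hZs : ∀ q, q ∈ Zs ↔ f q.1 q.2 = 0)
    (hinj : ∀ p ∈ Zs, ∀ q ∈ Zs, p.1 = q.1 → p = q)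
    (hfin : ∀ x, {y | fy x y = 0}.Finite)
    (hB : {q : ℝ × ℝ | fy q.1 q.2 = 0 ∧ (fx q.1 q.2 = 0 ∨ fyy q.1 q.2 = 0)}.Finite)
    {ε0 : ℝ} (hε0 : 0 < ε0) (hK : IsCompact {q : ℝ × ℝ | f q.1 q.2 ≤ ε0}) :
    ∃ c0 > 0, ∀ ε, 0 < ε → ε < c0 → ∀ Z : Finset (ℝ × ℝ),
      (∀ q, q ∈ Z ↔ f q.1 q.2 = ε ∧ fy q.1 q.2 = 0) →
      ∑ q ∈ Z, sg (fyy q.1 q.2) = 2 * Zs.card := by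
  classical
  have e1 := ev_small ((Zs ×ˢ Zs).filter (fun p => p.1 ≠ p.2)) (fun p => |p.1.1 - p.2.1| / 2) (by
    rintro ⟨p, q⟩ h
    simp only [Finset.mem_filter, Finset.mem_product] at h
    have : p.1 - q.1 ≠ 0 := fun h' => h.2 (hinj p h.1.1 q h.1.2 (sub_eq_zero.1 h'))
    have := abs_pos.2 this
    simp only
    linarith)
  obtain ⟨σ, hσ1, hσ⟩ := (e1.and self_mem_nhdsWithin).exists
  replace hσ : 0 < σ := hσ
  have hsep : ∀ p ∈ Zs, ∀ q ∈ Zs, p ≠ q → 2 * σ < |p.1 - q.1| := by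
    intro p hp q hq hpq
    have := hσ1 (p, q) (by simp [hp, hq, hpq])
    simp only at this
    linarith
  have hbox : ∀ z : ℝ × ℝ, ∃ r δ, z ∈ Zs → GBox f fx fy fyy σ z.1 z.2 r δ := by
    intro z
    by_cases hz : z ∈ Zs
    · obtain ⟨r, δ, h⟩ := exists_gbox H hσ ((hZs z).1 hz) (fun y hy => by
        refine lt_of_le_of_ne (hnn _ _) fun h => hy ?_
        have := hinj (z.1, y) ((hZs _).2 h.symm) z hz rfl
        rw [← this]) (hfin z.1) hB
      exact ⟨r, δ, fun _ => h⟩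
    · exact ⟨0, 0, fun h => absurd h hz⟩
  choose r δ hG using hbox
  let U : Set (ℝ × ℝ) := ⋃ z ∈ Zs, (Ioo (z.1 - δ z) (z.1 + δ z)) ×ˢ (Ioo (z.2 - r z) (z.2 + r z))
  have hU : IsOpen U := isOpen_biUnion fun z _ => isOpen_Ioo.prod isOpen_Ioo
  have hK' : IsCompact ({q : ℝ × ℝ | f q.1 q.2 ≤ ε0} \ U) := hK.diff hU
  have hc1 : ∃ c1 > 0, ∀ q, f q.1 q.2 ≤ ε0 → q ∉ U → c1 ≤ f q.1 q.2 := by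
    rcases ({q : ℝ × ℝ | f q.1 q.2 ≤ ε0} \ U).eq_empty_or_nonempty with he | hne
    · refine ⟨1, one_pos, fun q h1 h2 => ?_⟩
      have : q ∈ ({q : ℝ × ℝ | f q.1 q.2 ≤ ε0} \ U) := ⟨h1, h2⟩
      rw [he] at this
      exact absurd this (notMem_empty _)
    · obtain ⟨q0, hq0, hmin⟩ := hK'.exists_isMinOn hne H.cf.continuousOn
      refine ⟨f q0.1 q0.2, ?_, fun q h1 h2 => hmin ⟨h1, h2⟩⟩
      refine lt_of_le_of_ne (hnn _ _) fun h => hq0.2 ?_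
      have hz : q0 ∈ Zs := (hZs _).2 h.symm
      have := hG q0 hz
      exact mem_biUnion hz ⟨⟨by linarith [this.hδ], by linarith [this.hδ]⟩,
        ⟨by linarith [this.hr], by linarith [this.hr]⟩⟩
  obtain ⟨c1, hc1p, hc1⟩ := hc1
  refine ⟨min ε0 c1, lt_min hε0 hc1p, fun ε hε hεc Z hZ => ?_⟩
  rw [lt_min_iff] at hεc
  have hin : ∀ q : ℝ × ℝ, f q.1 q.2 ≤ ε → q ∈ U := by
    intro q hq
    by_contra hqU
    have := hc1 q (by linarith) hqU
    linarith
  have hZU : Z = Zs.biUnion (fun z => Z.filter (fun q => q.1 ∈ Icc (z.1 - δ z) (z.1 + δ z) ∧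
      q.2 ∈ Icc (z.2 - r z) (z.2 + r z))) := by
    ext q
    simp only [Finset.mem_biUnion, Finset.mem_filter]
    constructor
    · intro hq
      have := hin q ((hZ q).1 hq).1.le
      simp only [U, mem_iUnion] at this
      obtain ⟨z, hz, w1, w2⟩ := this
      exact ⟨z, hz, hq, Ioo_subset_Icc_self w1, Ioo_subset_Icc_self w2⟩
    · rintro ⟨z, hz, h, -⟩
      exact h
  rw [hZU, Finset.sum_biUnion, Finset.sum_congr rfl (g := fun _ => (2 : ℤ)), Finset.sum_const]
  · simp [mul_comm]
  · intro z hz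
    have g := hG z hz
    refine box_count H (a := z.1) (δ := δ z) (b := z.2) (c := z.2 - r z) (e := z.2 + r z) (ε := ε)
      g.hδ (by linarith [g.hr]) (by linarith [g.hr]) g.h1c g.h1e g.h2 ?_ ((hZs z).1 hz) hε ?_ hfin _ ?_
    · intro x hx y hy hne
      refine lt_of_le_of_ne (hnn _ _) fun h => ?_
      have hq : (x, y) ∈ Zs := (hZs _).2 h.symm
      have hne' : (x, y) ≠ z := by
        rintro rfl
        simp at hne
      have h1 := hsep _ hq _ hz hne'
      have h2 : |x - z.1| ≤ δ z := by rw [abs_le]; constructor <;> linarith [hx.1, hx.2]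
      simp only at h1
      linarith [g.hσ]
    · have key : ∀ x y, |x - z.1| = δ z → ε < f x y := by
        intro x y hx
        by_contra hcon
        push Not at hcon
        have := hin (x, y) hcon
        simp only [U, mem_iUnion] at this
        obtain ⟨z', hz', w1, w2⟩ := this
        simp only at w1
        have h1 : |x - z'.1| < δ z' := by rw [abs_lt]; constructor <;> linarith [w1.1, w1.2]
        have hne : z ≠ z' := by
          rintro rfl
          linarith
        have h2 := hsep z hz z' hz' hne
        have h3 : |z.1 - z'.1| ≤ |x - z.1| + |x - z'.1| := by
          rw [abs_sub_comm x z.1]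
          exact abs_sub_le _ _ _
        linarith [g.hσ, (hG z' hz').hσ]
      intro y _
      have := g.hδ
      exact ⟨key _ _ (by rw [show z.1 - δ z - z.1 = - δ z by ring, abs_neg, abs_of_pos this]),
        key _ _ (by rw [show z.1 + δ z - z.1 = δ z by ring, abs_of_pos this])⟩
    · intro q
      rw [Finset.mem_filter, hZ]
      tauto
  · intro z hz z' hz' hne
    rw [Function.onFun, Finset.disjoint_left]
    intro q hq hq'
    rw [Finset.mem_filter] at hq hq'
    have h2 := hsep z hz z' hz' hne
    have h1 : |q.1 - z.1| ≤ δ z := by rw [abs_le]; constructor <;> linarith [hq.2.1.1, hq.2.1.2]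
    have h1' : |q.1 - z'.1| ≤ δ z' := by rw [abs_le]; constructor <;> linarith [hq'.2.1.1, hq'.2.1.2]
    have h3 : |z.1 - z'.1| ≤ |q.1 - z.1| + |q.1 - z'.1| := by
      rw [abs_sub_comm q.1 z.1]
      exact abs_sub_le _ _ _
    linarith [(hG z hz).hσ, (hG z' hz').hσ]

end
end


/-- two-variable function attached to a polynomial -/
noncomputable def ev2 (f : MvPolynomial (Fin 2) ℝ) (x y : ℝ) : ℝ := eval ![x, y] f

lemma ev2_cont (f : MvPolynomial (Fin 2) ℝ) : Continuous (fun q : ℝ × ℝ => ev2 f q.1 q.2) := by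
  unfold ev2
  refine (MvPolynomial.continuous_eval f).comp ?_
  refine continuous_pi fun i => ?_
  fin_cases i
  · exact continuous_fst
  · exact continuous_snd

lemma ev2_hx (f : MvPolynomial (Fin 2) ℝ) (x y : ℝ) :
    HasDerivAt (fun t => ev2 f t y) (ev2 (pderiv 0 f) x y) x := by
  unfold ev2
  induction f using MvPolynomial.induction_on with
  | C a => simpa using hasDerivAt_const x a
  | add a b ha hb =>
    have h := ha.fun_add hb
    simp only [map_add]
    exact h
  | mul_X a i ha =>
    have h : HasDerivAt (fun t => (![t, y] : Fin 2 → ℝ) i) (if i = 0 then 1 else 0) x := by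
      fin_cases i
      · exact (hasDerivAt_id' x).congr_deriv (by simp)
      · simpa using hasDerivAt_const x y
    have := ha.fun_mul h
    simp only [map_mul, eval_X]
    refine this.congr_deriv ?_
    rw [Derivation.leibniz, pderiv_X]
    fin_cases i <;> simp <;> ring

lemma ev2_hy (f : MvPolynomial (Fin 2) ℝ) (x y : ℝ) :
    HasDerivAt (fun t => ev2 f x t) (ev2 (pderiv 1 f) x y) y := by
  unfold ev2
  induction f using MvPolynomial.induction_on with
  | C a => simpa using hasDerivAt_const y a
  | add a b ha hb =>
    have h := ha.fun_add hb
    simp only [map_add]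
    exact h
  | mul_X a i ha =>
    have h : HasDerivAt (fun t => (![x, t] : Fin 2 → ℝ) i) (if i = 1 then 1 else 0) y := by
      fin_cases i
      · simpa using hasDerivAt_const y x
      · exact (hasDerivAt_id' y).congr_deriv (by simp)
    have := ha.fun_mul h
    simp only [map_mul, eval_X]
    refine this.congr_deriv ?_
    rw [Derivation.leibniz, pderiv_X]
    fin_cases i <;> simp <;> ring

lemma ev2_smth (f : MvPolynomial (Fin 2) ℝ) :
    Smth (ev2 f) (ev2 (pderiv 0 f)) (ev2 (pderiv 1 f)) (ev2 (pderiv 1 (pderiv 1 f))) :=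
  ⟨ev2_cont _, ev2_cont _, ev2_cont _, ev2_cont _, ev2_hx _, ev2_hy _, ev2_hy _⟩

lemma cx_eq_zero_iff (g : MvPolynomial (Fin 2) ℝ) (x y : ℝ) :
    eval (fun i => ((![x, y] i : ℝ) : ℂ)) (cx g) = 0 ↔ ev2 g x y = 0 := by
  rw [eval_cx_real, Complex.ofReal_eq_zero]; rfl

/-- finite complex zero sets have finite real part -/
lemma real_fin {g h : MvPolynomial (Fin 2) ℝ}
    (hf : {p : Fin 2 → ℂ | eval p (cx g) = 0 ∧ eval p (cx h) = 0}.Finite) :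
    {q : ℝ × ℝ | ev2 g q.1 q.2 = 0 ∧ ev2 h q.1 q.2 = 0}.Finite := by
  refine Set.Finite.of_finite_image (f := fun q : ℝ × ℝ => fun i => ((![q.1, q.2] i : ℝ) : ℂ))
    (hf.subset ?_) ?_
  · rintro _ ⟨q, ⟨h1, h2⟩, rfl⟩
    exact ⟨(cx_eq_zero_iff _ _ _).2 h1, (cx_eq_zero_iff _ _ _).2 h2⟩
  · rintro ⟨a, b⟩ - ⟨c, d⟩ - h
    have h0 := congrFun h 0
    have h1 := congrFun h 1
    simp at h0 h1
    simp [h0, h1]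

lemma lower_bd {d : ℕ} {g : MvPolynomial (Fin 2) ℝ} (hg : cx g ∈ DL (d + 1)) :
    ∃ C ≥ 0, ∀ (p : Fin 2 → ℝ) (M : ℝ), 1 ≤ M → ‖p‖ ≤ M → |eval p g| ≤ C * M ^ d := by
  rw [mem_DL] at hg
  have hs : (cx g).support = g.support := support_map_of_injective _ (algebraMap ℝ ℂ).injective
  rw [hs] at hg
  refine ⟨∑ s ∈ g.support, |coeff s g|, Finset.sum_nonneg fun _ _ => abs_nonneg _, ?_⟩
  intro p M hM hp
  rw [eval_eq', Finset.sum_mul]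
  refine (Finset.abs_sum_le_sum_abs _ _).trans (Finset.sum_le_sum fun s hs => ?_)
  rw [abs_mul]
  refine mul_le_mul_of_nonneg_left ?_ (abs_nonneg _)
  rw [Finset.abs_prod]
  calc ∏ i, |p i ^ s i| ≤ ∏ i, M ^ s i := by
        refine Finset.prod_le_prod (fun i _ => abs_nonneg _) fun i _ => ?_
        rw [abs_pow]
        exact pow_le_pow_left₀ (abs_nonneg _) ((norm_le_pi_norm p i).trans hp) _
    _ = M ^ (s.degree) := by
        rw [Finset.prod_pow_eq_pow_sum, Finsupp.degree_eq_sum]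
    _ ≤ M ^ d := pow_le_pow_right₀ hM (by have := hg s hs; omega)

lemma hom_smul {σ R : Type*} [CommRing R] {d : ℕ} {F : MvPolynomial σ R} (hF : F.IsHomogeneous d)
    (t : R) (p : σ → R) : eval (t • p) F = t ^ d * eval p F := by
  rw [eval_eq, eval_eq, Finset.mul_sum]
  refine Finset.sum_congr rfl fun s hs => ?_
  have : s.degree = d := by
    rw [Finsupp.degree_eq_weight_one]
    exact hF (mem_support_iff.1 hs)
  simp only [Pi.smul_apply, smul_eq_mul, mul_pow, Finset.prod_mul_distrib,
    Finset.prod_pow_eq_pow_sum]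
  rw [← this, Finsupp.degree_apply]
  ring

lemma top_nonneg {d : ℕ} {f F : MvPolynomial (Fin 2) ℝ} (hF : F.IsHomogeneous (d + 1))
    (hf : cx f - cx F ∈ DL (d + 1)) (hnn : ∀ p, 0 ≤ eval p f) (p : Fin 2 → ℝ) : 0 ≤ eval p F := by
  have hg : cx (f - F) ∈ DL (d + 1) := by
    have : cx (f - F) = cx f - cx F := map_sub _ _ _
    rwa [this]
  obtain ⟨C, hC, hb⟩ := lower_bd hg
  by_contra hcon
  push Not at hcon
  set A := - eval p F with hA
  have hA0 : 0 < A := by linarith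
  set B := C * (‖p‖ + 1) ^ d with hB
  have hB0 : 0 ≤ B := by positivity
  set t := 1 + B / A with ht
  have ht1 : 1 ≤ t := by
    have : 0 ≤ B / A := by positivity
    linarith
  have h1 := hb (t • p) (t * (‖p‖ + 1)) (by nlinarith [norm_nonneg p]) (by
    rw [norm_smul, Real.norm_of_nonneg (by linarith)]
    nlinarith [norm_nonneg p])
  have h2 := hnn (t • p)
  rw [map_sub, hom_smul hF] at h1
  have h3 := (abs_le.1 h1).2
  rw [mul_pow] at h3
  have h4 : t ^ (d + 1) * A ≤ t ^ d * B := by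
    rw [hB]; rw [hA]; nlinarith
  have htd : 0 < t ^ d := by positivity
  have h5 : t * A ≤ B := by
    rw [pow_succ] at h4
    have : t ^ d * (t * A) ≤ t ^ d * B := by linarith
    exact le_of_mul_le_mul_left this htd
  have h6 : t * A = A + B := by rw [ht]; field_simp
  linarith

lemma sublevel_compact {d : ℕ} {f F : MvPolynomial (Fin 2) ℝ} (hF : F.IsHomogeneous (d + 1))
    (hf : cx f - cx F ∈ DL (d + 1)) (hpos : ∀ p ≠ 0, 0 < eval p F) :
    IsCompact {q : ℝ × ℝ | ev2 f q.1 q.2 ≤ 1} := by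
  have hg : cx (f - F) ∈ DL (d + 1) := by
    have : cx (f - F) = cx f - cx F := map_sub _ _ _
    rwa [this]
  obtain ⟨C, hC, hb⟩ := lower_bd hg
  obtain ⟨p0, hp0, hmin⟩ := (isCompact_sphere (0 : Fin 2 → ℝ) 1).exists_isMinOn
    ((NormedSpace.sphere_nonempty (x := (0 : Fin 2 → ℝ))).2 zero_le_one) (MvPolynomial.continuous_eval F).continuousOn
  have hp0n : ‖p0‖ = 1 := by simpa using hp0
  have hc : 0 < eval p0 F := hpos p0 (by rintro rfl; simp at hp0n)
  set c := eval p0 F with hcdef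
  have hlow : ∀ p, 0 < ‖p‖ → c * ‖p‖ ^ (d + 1) ≤ eval p F := by
    intro p hp
    have h1 : c ≤ eval (‖p‖⁻¹ • p) F := hmin (by
      rw [mem_sphere_zero_iff_norm, norm_smul, norm_inv, norm_norm, inv_mul_cancel₀ hp.ne'])
    rw [hom_smul hF, inv_pow] at h1
    have h2 : 0 < ‖p‖ ^ (d + 1) := by positivity
    rw [inv_mul_eq_div, le_div_iff₀ h2] at h1
    exact h1
  refine Metric.isCompact_of_isClosed_isBounded
    (isClosed_le (ev2_cont f) continuous_const) ?_
  refine (Metric.isBounded_closedBall (x := (0 : ℝ × ℝ)) (r := max 1 ((C + 1) / c))).subset ?_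
  rintro ⟨x, y⟩ hq
  rw [mem_closedBall_zero_iff]
  have hn : ‖((x, y) : ℝ × ℝ)‖ = ‖(![x, y] : Fin 2 → ℝ)‖ := by
    rw [Prod.norm_def]
    apply le_antisymm
    · exact max_le (norm_le_pi_norm (![x, y] : Fin 2 → ℝ) 0) (norm_le_pi_norm (![x, y] : Fin 2 → ℝ) 1)
    · rw [pi_norm_le_iff_of_nonneg (by positivity)]
      intro i
      fin_cases i
      · exact le_max_left _ _
      · exact le_max_right _ _
  rw [hn]
  by_contra hcon
  push Not at hcon
  rw [max_lt_iff] at hcon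
  obtain ⟨hM1, hM2⟩ := hcon
  set p := (![x, y] : Fin 2 → ℝ) with hp
  have h1 := hb p ‖p‖ hM1.le le_rfl
  have h2 := hlow p (by linarith)
  have h3 : eval p f ≤ 1 := hq
  rw [map_sub] at h1
  have h4 := (abs_le.1 h1).1
  have h5 : 1 ≤ ‖p‖ ^ d := one_le_pow₀ hM1.le
  have h6 : c * ‖p‖ * ‖p‖ ^ d ≤ (C + 1) * ‖p‖ ^ d := by
    rw [pow_succ] at h2
    nlinarith
  have h7 := le_of_mul_le_mul_right h6 (by linarith)
  rw [div_lt_iff₀ hc] at hM2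
  linarith


lemma hom_deg {σ R : Type*} [CommRing R] {d : ℕ} {F : MvPolynomial σ R} (hF : F.IsHomogeneous d)
    {s : σ →₀ ℕ} (hs : coeff s F ≠ 0) : s.degree = d := by
  rw [Finsupp.degree_eq_weight_one]; exact hF hs

lemma cx_hom {σ : Type*} {d : ℕ} {F : MvPolynomial σ ℝ} (hF : F.IsHomogeneous d) :
    (cx F).IsHomogeneous d := hF.map _

lemma coeff_top_ne {d : ℕ} {F : MvPolynomial (Fin 2) ℝ} (hF : F.IsHomogeneous d)
    (h : eval ![0, 1] F ≠ 0) : coeff (Finsupp.single 1 d) F ≠ 0 := by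
  intro hc
  apply h
  rw [eval_eq']
  refine Finset.sum_eq_zero fun s hs => ?_
  have hd := hom_deg hF (mem_support_iff.1 hs)
  have hs0 : s 0 ≠ 0 := by
    intro h0
    have : s = Finsupp.single 1 d := by
      rw [Finsupp.degree_eq_sum, Fin.sum_univ_two, h0, zero_add] at hd
      ext i
      fin_cases i
      · simpa using h0
      · simpa using hd
    rw [this] at hs
    exact (mem_support_iff.1 hs) hc
  rw [Fin.prod_univ_two]
  simp [hs0]

lemma affine_bound {m : ℕ} {f F : MvPolynomial (Fin 2) ℝ} (hF : F.IsHomogeneous (2 * m + 2))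
    (hf : cx f - cx F ∈ DL (2 * m + 2))
    (hR1 : IsRelPrime (cx F) (cx (pderiv 1 F)))
    (hR3 : IsRelPrime (cx (pderiv 1 F)) (cx (pderiv 1 (pderiv 1 F))))
    (hFne : ∀ p ≠ 0, eval p F ≠ 0) (hnn : ∀ p, 0 ≤ eval p f)
    (Zs : Finset (ℝ × ℝ)) (hZs : ∀ q, q ∈ Zs ↔ ev2 f q.1 q.2 = 0)
    (hinj : ∀ p ∈ Zs, ∀ q ∈ Zs, p.1 = q.1 → p = q) :
    2 * Zs.card ≤ 3 * m ^ 2 + 3 * m + 2 := by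
  classical
  have hpos : ∀ p ≠ 0, 0 < eval p F := fun p hp =>
    lt_of_le_of_ne (top_nonneg (d := 2 * m + 1) hF hf hnn p) (hFne p hp).symm
  have h01 : (![0, 1] : Fin 2 → ℝ) ≠ 0 := by
    intro h
    have := congrFun h 1
    simp at this
  have hc := coeff_top_ne hF (hFne _ h01)
  have hFy : (cx (pderiv 1 F)).IsHomogeneous (2 * m + 1) := cx_hom (hF.pderiv (i := 1))
  have hFyy : (cx (pderiv 1 (pderiv 1 F))).IsHomogeneous (2 * m) :=
    cx_hom ((hF.pderiv (i := 1)).pderiv (i := 1))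
  have hFx : (cx (pderiv 0 F)).IsHomogeneous (2 * m + 1) := cx_hom (hF.pderiv (i := 0))
  have hfx : cx (pderiv 0 f) - cx (pderiv 0 F) ∈ DL (2 * m + 1) := by
    rw [← cx_pderiv, ← cx_pderiv, ← map_sub]; exact DL_pderiv hf 0
  have hfy : cx (pderiv 1 f) - cx (pderiv 1 F) ∈ DL (2 * m + 1) := by
    rw [← cx_pderiv, ← cx_pderiv, ← map_sub]; exact DL_pderiv hf 1
  have hfyy : cx (pderiv 1 (pderiv 1 f)) - cx (pderiv 1 (pderiv 1 F)) ∈ DL (2 * m) := by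
    rw [← cx_pderiv, ← cx_pderiv (pderiv 1 F), ← map_sub]; exact DL_pderiv hfy 1
  have hFye : eval ![0, 1] (pderiv 1 F) = (2 * m + 2 : ℝ) * eval ![0, 1] F := by
    have := hF.sum_X_mul_pderiv
    rw [Fin.sum_univ_two] at this
    have := congrArg (eval ![0, 1]) this
    simpa using this
  have hFyne : eval ![0, 1] (pderiv 1 F) ≠ 0 := by
    rw [hFye]
    exact mul_ne_zero (by positivity) (hFne _ h01)
  have hFy0 : cx (pderiv 1 F) ≠ 0 := by
    intro h
    apply hFyne
    have : pderiv 1 F = 0 := cx_injective (by rw [h]; simp [cx])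
    rw [this, map_zero]
  have hgr : IsRelPrime (cx (pderiv 0 F)) (cx (pderiv 1 F)) := by
    rw [← cx_pderiv, ← cx_pderiv]
    exact relprime_grad (n := 2 * m) (cx_hom hF) (by rw [cx_pderiv]; exact hR1)
  have A1 := bez_finite hFx hFy hfx hfy hgr hFy0
  have A2 := bez_finite hFyy hFy hfyy hfy hR3.symm hFy0
  -- finiteness on vertical lines
  have hfin : ∀ x, {y | ev2 (pderiv 1 f) x y = 0}.Finite := by
    intro x
    have hrel : IsRelPrime (cx (X 0 : MvPolynomial (Fin 2) ℝ)) (cx (pderiv 1 F)) := by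
      have hX : cx (X 0 : MvPolynomial (Fin 2) ℝ) = X 0 := map_X _ _
      rw [hX]
      have hirr : Irreducible (X 0 : MvPolynomial (Fin 2) ℂ) := (MvPolynomial.X_prime (i := 0)).irreducible
      rw [hirr.isRelPrime_iff_not_dvd]
      rintro ⟨g, hg⟩
      apply hFyne
      have := congrArg (eval (fun i => ((![0, 1] i : ℝ) : ℂ))) hg
      rw [eval_cx_real] at this
      simpa using this
    have := bez_finite (d := 1) (u := cx (X 0 - C x)) (cx_hom (isHomogeneous_X ℝ 0)) hFy (by
      have : cx (X 0 - C x : MvPolynomial (Fin 2) ℝ) - cx (X 0) = C (-(x : ℂ)) := by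
        simp [cx]
      rw [this, mem_DL]
      intro s hs
      have h0 : s = 0 := by
        by_contra hne
        rw [mem_support_iff, coeff_C, if_neg (Ne.symm hne)] at hs
        exact hs rfl
      rw [h0]; simp) hfy hrel hFy0
    have := (real_fin this).image Prod.snd
    refine this.subset ?_
    intro y hy
    refine ⟨(x, y), ⟨?_, hy⟩, rfl⟩
    simp [ev2]
  have hB : {q : ℝ × ℝ | ev2 (pderiv 1 f) q.1 q.2 = 0 ∧ (ev2 (pderiv 0 f) q.1 q.2 = 0 ∨
      ev2 (pderiv 1 (pderiv 1 f)) q.1 q.2 = 0)}.Finite := by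
    refine ((real_fin A1).union (real_fin A2)).subset ?_
    rintro q ⟨h1, h2 | h2⟩
    · exact Or.inl ⟨h2, h1⟩
    · exact Or.inr ⟨h2, h1⟩
  obtain ⟨c0, hc0, hcount⟩ := real_count (ev2_smth f) (fun x y => hnn _) Zs hZs hinj hfin hB one_pos
    (sublevel_compact (d := 2 * m + 1) hF hf hpos)
  -- choice of the level
  have hV := ((A1.union A2).image (fun p => eval p (cx f)))
  have hV' : {ε : ℝ | (ε : ℂ) ∈ (fun p => eval p (cx f)) '' ({p : Fin 2 → ℂ | eval p (cx (pderiv 0 f)) = 0 ∧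
      eval p (cx (pderiv 1 f)) = 0} ∪ {p : Fin 2 → ℂ | eval p (cx (pderiv 1 (pderiv 1 f))) = 0 ∧
      eval p (cx (pderiv 1 f)) = 0})}.Finite :=
    hV.preimage (Complex.ofReal_injective.injOn)
  obtain ⟨ε, ⟨hε0, hεc⟩, hεV⟩ := ((Set.Ioo_infinite hc0).sdiff hV').nonempty
  -- the perturbed polynomial
  set u := f - C ε with hu
  have hux : pderiv 0 u = pderiv 0 f := by simp [hu]
  have huy : pderiv 1 u = pderiv 1 f := by simp [hu]
  have hcxu : cx u = cx f - C (ε : ℂ) := by simp [hu, cx]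
  have huF : cx u - cx F ∈ DL (2 * m + 2) := by
    have : cx u - cx F = (cx f - cx F) - C (ε : ℂ) := by rw [hcxu]; ring
    rw [this]
    refine Submodule.sub_mem _ hf ?_
    rw [mem_DL]
    intro s hs
    have h0 : s = 0 := by
      by_contra hne
      rw [mem_support_iff, coeff_C, if_neg (Ne.symm hne)] at hs
      exact hs rfl
    rw [h0]; simp
  have hJ : ∀ p, eval p (cx u) = 0 → eval p (cx (pderiv 1 u)) = 0 →
      eval p (cx (pderiv 0 u)) * eval p (cx (pderiv 1 (pderiv 1 u))) ≠ 0 := by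
    intro p h1 h2 h3
    rw [hux, huy] at h3
    rw [huy] at h2
    rw [hcxu, map_sub, eval_C, sub_eq_zero] at h1
    refine hεV ⟨p, ?_, h1⟩
    rcases mul_eq_zero.1 h3 with h | h
    · exact Or.inl ⟨h, h2⟩
    · exact Or.inr ⟨h, h2⟩
  have hZf := real_fin (bez_finite (cx_hom hF) hFy huF hfy hR1 hFy0)
  set Z := hZf.toFinset with hZdef
  have hue : ∀ x y, ev2 u x y = ev2 f x y - ε := by intro x y; simp [ev2, hu]
  have hZ : ∀ q, q ∈ Z ↔ ev2 f q.1 q.2 = ε ∧ ev2 (pderiv 1 f) q.1 q.2 = 0 := by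
    intro q
    rw [hZdef, Set.Finite.mem_toFinset]
    simp only [Set.mem_ofPred_eq]
    rw [hue, sub_eq_zero]
  have hsum := hcount ε hε0 hεc Z hZ
  have hyyne : ∀ q ∈ Z, ev2 (pderiv 1 (pderiv 1 f)) q.1 q.2 ≠ 0 := by
    intro q hq h0
    obtain ⟨w1, w2⟩ := (hZ q).1 hq
    refine hJ (fun i => ((![q.1, q.2] i : ℝ) : ℂ)) ?_ ?_ ?_
    · rw [cx_eq_zero_iff, hue, w1, sub_self]
    · rw [cx_eq_zero_iff, huy, w2]
    · rw [huy, (cx_eq_zero_iff _ _ _).2 h0, mul_zero]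
  set emb : ℝ × ℝ ↪ (Fin 2 → ℝ) := ⟨fun q => ![q.1, q.2], by
    rintro ⟨a, b⟩ ⟨c, d⟩ h
    have h0 := congrFun h 0
    have h1 := congrFun h 1
    simp at h0 h1
    simp [h0, h1]⟩ with hemb
  have hmain := count_algebra hF huF hR1 hc hJ
    ((Z.filter (fun q => 0 < ev2 (pderiv 1 (pderiv 1 f)) q.1 q.2)).map emb)
    ((Z.filter (fun q => ¬ 0 < ev2 (pderiv 1 (pderiv 1 f)) q.1 q.2)).map emb) (by
      intro p hp
      obtain ⟨q, hq, rfl⟩ := Finset.mem_map.1 hp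
      rw [Finset.mem_filter, hZ] at hq
      obtain ⟨⟨w1, w2⟩, w3⟩ := hq
      rw [huy]
      refine ⟨?_, w2, w3⟩
      have := hue q.1 q.2
      rw [w1, sub_self] at this
      exact this) (by
      intro p h1 h2 h3
      have hp : p = ![p 0, p 1] := by ext i; fin_cases i <;> rfl
      rw [Finset.mem_map]
      refine ⟨(p 0, p 1), ?_, hp.symm⟩
      rw [huy] at h2 h3
      rw [hp] at h1 h2 h3
      rw [Finset.mem_filter, hZ]
      refine ⟨⟨?_, h2⟩, not_lt.2 (le_of_lt h3)⟩
      have := hue (p 0) (p 1)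
      have h1' : ev2 u (p 0) (p 1) = 0 := h1
      simp only
      linarith)
  rw [Finset.card_map, Finset.card_map] at hmain
  have s1 : ∑ q ∈ Z with 0 < ev2 (pderiv 1 (pderiv 1 f)) q.1 q.2,
      sg (ev2 (pderiv 1 (pderiv 1 f)) q.1 q.2) =
      (Z.filter (fun q => 0 < ev2 (pderiv 1 (pderiv 1 f)) q.1 q.2)).card := by
    rw [Finset.sum_congr rfl (g := fun _ => (1 : ℤ)) (fun q hq => sg_pos (Finset.mem_filter.1 hq).2)]
    simp
  have s2 : ∑ q ∈ Z with ¬ 0 < ev2 (pderiv 1 (pderiv 1 f)) q.1 q.2,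
      sg (ev2 (pderiv 1 (pderiv 1 f)) q.1 q.2) =
      - ((Z.filter (fun q => ¬ 0 < ev2 (pderiv 1 (pderiv 1 f)) q.1 q.2)).card : ℤ) := by
    rw [Finset.sum_congr rfl (g := fun _ => (-1 : ℤ)) (fun q hq => by
      have h := Finset.mem_filter.1 hq
      exact sg_neg (lt_of_le_of_ne (not_lt.1 h.2) (hyyne q h.1)))]
    simp
  rw [← Finset.sum_filter_add_sum_filter_not Z (fun q => 0 < ev2 (pderiv 1 (pderiv 1 f)) q.1 q.2),
    s1, s2] at hsum
  omega


lemma sign_const {f : MvPolynomial (Fin 2) ℝ} (Zs : Finset (ℝ × ℝ))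
    (hZs : ∀ q, q ∈ Zs ↔ ev2 f q.1 q.2 = 0) :
    (∀ p, 0 ≤ eval p f) ∨ (∀ p, 0 ≤ eval p (-f)) := by
  by_contra hcon
  push Not at hcon
  obtain ⟨⟨p, hp⟩, ⟨q, hq⟩⟩ := hcon
  rw [map_neg] at hq
  have hfin : {p : Fin 2 → ℝ | eval p f = 0}.Finite := by
    refine (Zs.finite_toSet.image (fun q : ℝ × ℝ => ![q.1, q.2])).subset ?_
    intro r hr
    have hr' : eval r f = 0 := hr
    have e : ![r 0, r 1] = r := by ext i; fin_cases i <;> rfl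
    refine ⟨(r 0, r 1), ?_, e⟩
    rw [Finset.mem_coe, hZs]
    show eval ![r 0, r 1] f = 0
    rw [e]; exact hr'
  have hc := (Set.Countable.isPathConnected_compl_of_one_lt_rank (E := Fin 2 → ℝ)
    (by rw [rank_fin_fun]; norm_num) hfin.countable).isConnected.isPreconnected
  have hp' : p ∈ {p : Fin 2 → ℝ | eval p f = 0}ᶜ := fun h => hp.ne h
  have hq' : q ∈ {p : Fin 2 → ℝ | eval p f = 0}ᶜ := fun h => by
    have h' : eval q f = 0 := h
    linarith
  obtain ⟨r, hr, hr0⟩ := hc.intermediate_value hp' hq'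
    (MvPolynomial.continuous_eval f).continuousOn (⟨hp.le, by linarith⟩ : (0:ℝ) ∈ Set.Icc _ _)
  exact hr hr0

lemma affine_bound' {m : ℕ} {f F : MvPolynomial (Fin 2) ℝ} (hF : F.IsHomogeneous (2*m+2))
    (hf : cx f - cx F ∈ DL (2*m+2)) (hR1 : IsRelPrime (cx F) (cx (pderiv 1 F)))
    (hR3 : IsRelPrime (cx (pderiv 1 F)) (cx (pderiv 1 (pderiv 1 F))))
    (hFne : ∀ p ≠ 0, eval p F ≠ 0) (Zs : Finset (ℝ × ℝ))
    (hZs : ∀ q, q ∈ Zs ↔ ev2 f q.1 q.2 = 0)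
    (hinj : ∀ p ∈ Zs, ∀ q ∈ Zs, p.1 = q.1 → p = q) : 2 * Zs.card ≤ 3*m^2 + 3*m + 2 := by
  rcases sign_const Zs hZs with h | h
  · exact affine_bound hF hf hR1 hR3 hFne h Zs hZs hinj
  · refine affine_bound (f := -f) (F := -F) hF.neg ?_ ?_ ?_ ?_ h Zs ?_ hinj
    · have : cx (-f) - cx (-F) = -(cx f - cx F) := by simp [cx]; ring
      rw [this]; exact neg_mem hf
    · have e1 : cx (-F) = - cx F := by simp [cx]
      have e2 : cx (pderiv 1 (-F)) = - cx (pderiv 1 F) := by simp [cx]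
      rw [e1, e2]; exact hR1.neg_neg
    · have e1 : cx (pderiv 1 (-F)) = - cx (pderiv 1 F) := by simp [cx]
      have e2 : cx (pderiv 1 (pderiv 1 (-F))) = - cx (pderiv 1 (pderiv 1 F)) := by simp [cx]
      rw [e1, e2]; exact hR3.neg_neg
    · intro p hp
      rw [map_neg]; exact neg_ne_zero.2 (hFne p hp)
    · intro q
      rw [hZs]; simp [ev2]


/-- dehomogenisation -/
noncomputable def dlt : MvPolynomial (Fin 2) ℂ →ₐ[ℂ] Polynomial ℂ := aeval ![Polynomial.X, 1]

lemma dlt_pderiv (H : MvPolynomial (Fin 2) ℂ) :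
    dlt (pderiv 0 H) = Polynomial.derivative (dlt H) := by
  unfold dlt
  induction H using MvPolynomial.induction_on with
  | C a => simp
  | add p q hp hq => simp [hp, hq]
  | mul_X p i hp =>
    rw [Derivation.leibniz, map_add, map_mul, Polynomial.derivative_mul, smul_eq_mul, smul_eq_mul,
      map_mul, map_mul, hp]
    fin_cases i <;> simp <;> ring

lemma dlt_natDegree {n : ℕ} {H : MvPolynomial (Fin 2) ℂ} (hH : H.IsHomogeneous n) :
    (dlt H).natDegree ≤ n := by
  unfold dlt
  rw [aeval_def, eval₂_eq']
  refine Polynomial.natDegree_sum_le_of_forall_le _ _ fun s hs => ?_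
  have hd := hom_deg hH (mem_support_iff.1 hs)
  rw [Finsupp.degree_eq_sum, Fin.sum_univ_two] at hd
  rw [Fin.prod_univ_two]
  simp only [Matrix.cons_val_zero, Matrix.cons_val_one, one_pow, mul_one]
  refine (Polynomial.natDegree_C_mul_X_pow_le _ _).trans ?_
  omega

lemma sep_relprime {n : ℕ} {H : MvPolynomial (Fin 2) ℂ} (hH : H.IsHomogeneous (n + 1))
    (hs : (dlt H).Separable) (h10 : eval ![1, 0] H ≠ 0) (h01 : eval ![0, 1] H ≠ 0) :
    IsRelPrime H (pderiv 1 H) := by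
  have hH0 : H ≠ 0 := by rintro rfl; simp at h10
  refine WfDvdMonoid.isRelPrime_of_no_irreducible_factors (fun h => hH0 h.1) ?_
  intro c hc h1 h2
  have hp := hc.prime
  have he := euler2 hH
  have h3 : c ∣ X 0 * pderiv 0 H := by
    have : X 0 * pderiv 0 H = C ((n + 1 : ℕ) : ℂ) * H - X 1 * pderiv 1 H := by
      rw [← he]; ring
    rw [this]; exact dvd_sub (h1.mul_left _) (h2.mul_left _)
  have key : ∀ (i : Fin 2) (v : Fin 2 → ℂ), v i = 0 → eval v H ≠ 0 → ¬ c ∣ X i := by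
    intro i v hv hev hci
    have ha := hp.irreducible.associated_of_dvd (MvPolynomial.X_prime (R := ℂ) (i := i)).irreducible hci
    obtain ⟨g, hg⟩ := ha.symm.dvd.trans h1
    rw [hg] at hev; simp [hv] at hev
  rcases hp.dvd_or_dvd h3 with h4 | h4
  · exact key 0 _ (by simp) h01 h4
  · obtain ⟨a, b, hab⟩ := hs
    set N := max a.natDegree b.natDegree
    have hd0 : (dlt (pderiv 0 H)).natDegree ≤ n := dlt_natDegree hH.pderiv
    have hH' : (dlt H).homogenize (n+1) = H := Polynomial.homogenize_eq_of_isHomogeneous hH rfl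
    have hH0' : (dlt (pderiv 0 H)).homogenize n = pderiv 0 H :=
      Polynomial.homogenize_eq_of_isHomogeneous hH.pderiv rfl
    have e1 := Polynomial.homogenize_mul a (dlt H) (m := N) (le_max_left _ _) (dlt_natDegree hH)
    have e2 := Polynomial.homogenize_mul b (dlt (pderiv 0 H)) (m := N+1) (n := n) ((le_max_right _ _).trans (Nat.le_succ _)) hd0
    rw [hH'] at e1
    rw [hH0'] at e2
    rw [← dlt_pderiv] at hab
    have e3 := congrArg (fun p => Polynomial.homogenize p (N + (n+1))) hab
    simp only [Polynomial.homogenize_add, Polynomial.homogenize_one] at e3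
    rw [e1, show N + (n+1) = N + 1 + n by ring, e2] at e3
    have : c ∣ X 1 ^ (N + 1 + n) := by
      rw [← e3]; exact dvd_add (h1.mul_left _) (h4.mul_left _)
    exact key 1 _ (by simp) h10 (hp.dvd_of_dvd_pow this)


lemma psi_sep {d : ℕ} {h : Polynomial ℂ} (hs : h.Separable) (hd : h.natDegree = d + 2) :
    {l : ℂ | ¬ (Polynomial.C l * Polynomial.derivative h +
      (Polynomial.C ((d + 2 : ℕ) : ℂ) * h - Polynomial.X * Polynomial.derivative h)).Separable}.Finite := by
  set B := Polynomial.derivative h with hB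
  set A := Polynomial.C ((d + 2 : ℕ) : ℂ) * h - Polynomial.X * B with hA
  have hcop : IsCoprime A B := by
    have h1 : IsCoprime (Polynomial.C ((d + 2 : ℕ) : ℂ) * h) B := by
      refine (isCoprime_mul_unit_left_left ?_ h B).2 hs
      rw [Polynomial.isUnit_C, isUnit_iff_ne_zero]
      exact_mod_cast Nat.succ_ne_zero (d + 1)
    rw [hA, sub_eq_add_neg, ← neg_mul]
    exact h1.add_mul_right_left _
  set W := A * Polynomial.derivative B - Polynomial.derivative A * B with hW
  have hBd : B.natDegree = d + 1 := by
    rw [hB, Polynomial.natDegree_derivative, hd]; rfl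
  have hW0 : W ≠ 0 := by
    intro h0
    have h1 : B ∣ A * Polynomial.derivative B := by
      rw [sub_eq_zero.1 h0]; exact dvd_mul_left _ _
    have h2 := hcop.symm.dvd_of_dvd_mul_left h1
    have h3 : Polynomial.derivative B = 0 := by
      by_contra hne
      have := Polynomial.natDegree_le_of_dvd h2 hne
      have h5 := Polynomial.natDegree_derivative B
      omega
    have h4 : (Polynomial.derivative B).natDegree = 0 := by rw [h3]; simp
    have := Polynomial.derivative_eq_zero.1 h3
    omega
  refine ((W.roots.toFinset.finite_toSet).image (fun t => - A.eval t / B.eval t)).subset ?_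
  intro l hl
  have hl' : ¬ IsCoprime _ _ := hl
  rw [Polynomial.isCoprime_iff_aeval_ne_zero_of_isAlgClosed ℂ ℂ] at hl'
  push Not at hl'
  obtain ⟨t, ht1, ht2⟩ := hl'
  simp only [Polynomial.derivative_mul, Polynomial.derivative_C, zero_mul,
    zero_add, map_add, map_mul, Polynomial.aeval_C, Polynomial.coe_aeval_eq_eval] at ht1 ht2
  simp only [Algebra.algebraMap_self, RingHom.id_apply] at ht1 ht2
  have hBt : B.eval t ≠ 0 := by
    intro hb
    rw [hb] at ht1
    obtain ⟨u, v, huv⟩ := hcop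
    have := congrArg (Polynomial.eval t) huv
    simp only [Polynomial.eval_add, Polynomial.eval_mul, hb, Polynomial.eval_one] at this
    rw [show A.eval t = 0 by linear_combination ht1] at this
    simp at this
  refine ⟨t, ?_, ?_⟩
  · simp only [Finset.mem_coe, Multiset.mem_toFinset]
    rw [Polynomial.mem_roots hW0, Polynomial.IsRoot, hW, Polynomial.eval_sub, Polynomial.eval_mul,
      Polynomial.eval_mul]
    linear_combination (Polynomial.derivative B).eval t * ht1 - B.eval t * ht2
  · show - A.eval t / B.eval t = l
    rw [div_eq_iff hBt]; linear_combination -ht1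

/-- shear -/
noncomputable def shr {R : Type*} [CommRing R] (l : R) :
    MvPolynomial (Fin 2) R →ₐ[R] MvPolynomial (Fin 2) R := aeval ![X 0 + C l * X 1, X 1]

lemma shr_pderiv {R : Type*} [CommRing R] (l : R) (F : MvPolynomial (Fin 2) R) :
    pderiv 1 (shr l F) = shr l (C l * pderiv 0 F + pderiv 1 F) := by
  unfold shr
  induction F using MvPolynomial.induction_on with
  | C a => simp
  | add p q hp hq => simp only [map_add, hp, hq, mul_add]; ring
  | mul_X p i hp =>
    rw [map_mul, Derivation.leibniz, hp]
    fin_cases i <;> simp [pderiv_X] <;> ring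

lemma shr_hom {R : Type*} [CommRing R] (l : R) {n : ℕ} {F : MvPolynomial (Fin 2) R}
    (hF : F.IsHomogeneous n) : (shr l F).IsHomogeneous n := by
  unfold shr
  rw [aeval_def, eval₂_eq']
  refine IsHomogeneous.sum _ _ _ fun s hs => ?_
  have hd := hom_deg hF (mem_support_iff.1 hs)
  rw [Finsupp.degree_eq_sum, Fin.sum_univ_two] at hd
  rw [Fin.prod_univ_two, ← zero_add n, ← hd]
  refine (isHomogeneous_C _ _).mul (IsHomogeneous.mul ?_ ?_)
  · have : (X 0 + C l * X 1 : MvPolynomial (Fin 2) R).IsHomogeneous 1 :=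
      (isHomogeneous_X _ _).add (by simpa using (isHomogeneous_C _ l).mul (isHomogeneous_X R (1 : Fin 2)))
    simpa using this.pow (s 0)
  · simpa using (isHomogeneous_X R (1 : Fin 2)).pow (s 1)

lemma shr_DL (l : ℂ) {n : ℕ} {g : MvPolynomial (Fin 2) ℂ} (hg : g ∈ DL n) : shr l g ∈ DL n := by
  rw [g.as_sum, map_sum]
  refine sum_mem fun s hs => ?_
  have h1 := mem_DL.1 hg s hs
  exact DL_of_hom (shr_hom l (isHomogeneous_monomial _ rfl)) h1

lemma cx_shr (l : ℝ) (f : MvPolynomial (Fin 2) ℝ) : cx (shr l f) = shr (l : ℂ) (cx f) := by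
  unfold shr cx
  induction f using MvPolynomial.induction_on with
  | C a => simp
  | add p q hp hq => simp only [map_add, hp, hq]
  | mul_X p i hp =>
    rw [map_mul, map_mul, hp, map_mul, map_mul]
    fin_cases i <;> simp

lemma dlt_shr (l : ℂ) (H : MvPolynomial (Fin 2) ℂ) :
    dlt (shr l H) = (dlt H).comp (Polynomial.X + Polynomial.C l) := by
  unfold dlt shr
  induction H using MvPolynomial.induction_on with
  | C a => simp
  | add p q hp hq => simp only [map_add, hp, hq, Polynomial.add_comp]
  | mul_X p i hp =>
    rw [map_mul, map_mul, hp, map_mul, Polynomial.mul_comp]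
    fin_cases i <;> simp

lemma eval_shr {R : Type*} [CommRing R] (l : R) (F : MvPolynomial (Fin 2) R) (a b : R) :
    eval ![a, b] (shr l F) = eval ![a + l * b, b] F := by
  unfold shr
  induction F using MvPolynomial.induction_on with
  | C a => simp
  | add p q hp hq => simp only [map_add, hp, hq]
  | mul_X p i hp =>
    rw [map_mul, map_mul, hp, map_mul]
    fin_cases i <;> simp

lemma sep_comp (l : ℂ) {h : Polynomial ℂ} (hs : h.Separable) :
    (h.comp (Polynomial.X + Polynomial.C l)).Separable := by
  obtain ⟨a, b, hab⟩ := hs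
  refine ⟨a.comp (Polynomial.X + Polynomial.C l), b.comp (Polynomial.X + Polynomial.C l), ?_⟩
  have := congrArg (fun p => Polynomial.comp p (Polynomial.X + Polynomial.C l)) hab
  simpa [Polynomial.derivative_comp] using this


lemma affine_bound2 {m : ℕ} {f F : MvPolynomial (Fin 2) ℝ} (hF : F.IsHomogeneous (2*m+2))
    (hf : cx f - cx F ∈ DL (2*m+2)) (hsep : (dlt (cx F)).Separable)
    (hFne : ∀ p ≠ 0, eval p F ≠ 0) (Zs : Finset (ℝ × ℝ))
    (hZs : ∀ q, q ∈ Zs ↔ ev2 f q.1 q.2 = 0) : 2 * Zs.card ≤ 3*m^2 + 3*m + 2 := by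
  classical
  have hcF := cx_hom hF
  have ev10 : ∀ (G : MvPolynomial (Fin 2) ℝ) (a b : ℝ), eval ![(a : ℂ), (b : ℂ)] (cx G) = ((eval ![a, b] G : ℝ) : ℂ) := by
    intro G a b
    rw [← eval_cx_real]
    congr 2
    ext i; fin_cases i <;> rfl
  have ne10 : ![(1 : ℝ), 0] ≠ 0 := fun h => by simpa using congrFun h 0
  have h10 : eval ![1, 0] (cx F) ≠ 0 := by
    have := ev10 F 1 0
    simp only [Complex.ofReal_one, Complex.ofReal_zero] at this
    rw [this]; exact_mod_cast hFne _ ne10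
  have hdeg : (dlt (cx F)).natDegree = 2 * m + 2 := by
    refine le_antisymm (dlt_natDegree hcF) ?_
    by_contra hlt
    push Not at hlt
    have e1 := Polynomial.homogenize_mul (dlt (cx F)) 1 (m := 2*m+1) (n := 1) (by omega) (by simp)
    rw [mul_one, show 2*m+1+1 = 2*m+2 by ring,
      Polynomial.homogenize_eq_of_isHomogeneous (p := dlt (cx F)) hcF rfl, Polynomial.homogenize_one] at e1
    apply h10
    rw [e1]; simp
  have hfin1 := psi_sep hsep hdeg
  have hfin1' := hfin1.preimage (Complex.ofReal_injective.injOn)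
  have hfin2 : ((Zs ×ˢ Zs).image (fun pq => (pq.1.1 - pq.2.1) / (pq.1.2 - pq.2.2)) : Set ℝ).Finite :=
    Finset.finite_toSet _
  have hfin3 : ({- eval ![1, 0] (pderiv 1 F) / eval ![1, 0] (pderiv 0 F)} : Set ℝ).Finite :=
    Set.finite_singleton _
  obtain ⟨l, hl⟩ := (((hfin1'.union hfin2).union hfin3).infinite_compl).nonempty
  simp only [Set.mem_compl_iff, Set.mem_union, not_or] at hl
  obtain ⟨⟨hl1, hl2⟩, hl3⟩ := hl
  have hl1 : (Polynomial.C (l : ℂ) * Polynomial.derivative (dlt (cx F)) +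
      (Polynomial.C ((2 * m + 2 : ℕ) : ℂ) * dlt (cx F)
        - Polynomial.X * Polynomial.derivative (dlt (cx F)))).Separable := by
    by_contra h; exact hl1 h
  have euler : ∀ (G : MvPolynomial (Fin 2) ℝ) (n : ℕ), G.IsHomogeneous n → ∀ a b : ℝ,
      a * eval ![a, b] (pderiv 0 G) + b * eval ![a, b] (pderiv 1 G) = n * eval ![a, b] G := by
    intro G n hG a b
    have := congrArg (eval ![a, b]) hG.sum_X_mul_pderiv
    rw [Fin.sum_univ_two] at this
    simpa using this
  have hFs := shr_hom l hF
  have h01 : ∀ l : ℝ, eval ![0, 1] (shr l F) ≠ 0 := by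
    intro l
    rw [eval_shr]
    exact hFne _ (fun h => by simpa using congrFun h 1)
  have h10s : eval ![1, 0] (shr l F) ≠ 0 := by
    rw [eval_shr]
    exact hFne _ (fun h => by simpa using congrFun h 0)
  have cxne : ∀ (G : MvPolynomial (Fin 2) ℝ), (eval ![1, 0] G ≠ 0 → eval ![1, 0] (cx G) ≠ 0) ∧
      (eval ![0, 1] G ≠ 0 → eval ![0, 1] (cx G) ≠ 0) := by
    intro G
    have e1 := ev10 G 1 0
    have e2 := ev10 G 0 1
    simp only [Complex.ofReal_one, Complex.ofReal_zero] at e1 e2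
    rw [e1, e2]
    exact ⟨fun h => by exact_mod_cast h, fun h => by exact_mod_cast h⟩
  have hd0 : ((2 * m + 2 : ℕ) : ℝ) ≠ 0 := by exact_mod_cast Nat.succ_ne_zero (2 * m + 1)
  set T : Finset (ℝ × ℝ) := Zs.image (fun q => (q.1 - l * q.2, q.2)) with hT
  have hcard : T.card = Zs.card := by
    refine Finset.card_image_of_injective _ ?_
    rintro ⟨a, b⟩ ⟨c, d⟩ h
    simp only [Prod.mk.injEq] at h ⊢
    obtain ⟨h1, h2⟩ := h
    subst h2
    exact ⟨by linarith, rfl⟩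
  rw [← hcard]
  refine affine_bound' (f := shr l f) (F := shr l F) hFs ?_ ?_ ?_ ?_ T ?_ ?_
  · rw [cx_shr, cx_shr, ← map_sub]; exact shr_DL _ hf
  · rw [← cx_pderiv]
    refine sep_relprime (n := 2 * m + 1) (cx_hom hFs) ?_ ((cxne _).1 h10s) ((cxne _).2 (h01 l))
    rw [cx_shr, dlt_shr]; exact sep_comp _ hsep
  · rw [← cx_pderiv (pderiv 1 (shr l F))]
    refine sep_relprime (n := 2 * m) (cx_hom hFs.pderiv) ?_ ((cxne _).1 ?_) ((cxne _).2 ?_)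
    · rw [shr_pderiv, cx_shr, dlt_shr]
      refine sep_comp _ ?_
      convert hl1 using 1
      have e := congrArg dlt (euler2 hcF)
      have e3 : dlt (X 0) = Polynomial.X := by simp [dlt]
      have e4 : dlt (X 1) = 1 := by simp [dlt]
      have e5 : ∀ c, dlt (C c) = Polynomial.C c := by intro c; simp [dlt]
      rw [map_add, map_mul, map_mul, map_mul, e3, e4, e5, dlt_pderiv] at e
      have e6 : cx (C l * pderiv 0 F + pderiv 1 F) = C (l : ℂ) * pderiv 0 (cx F) + pderiv 1 (cx F) := by
        rw [cx_pderiv, cx_pderiv]; simp [cx]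
      rw [e6, map_add, map_mul, e5, dlt_pderiv]
      linear_combination e
    · rw [shr_pderiv, eval_shr]
      intro h0
      apply hl3
      have hx : eval ![1, 0] (pderiv 0 F) ≠ 0 := by
        have := euler F _ hF 1 0
        rw [one_mul, zero_mul, add_zero] at this
        rw [this]
        exact mul_ne_zero hd0 (hFne _ ne10)
      rw [Set.mem_singleton_iff, eq_div_iff hx]
      simp only [mul_zero, add_zero, map_add, map_mul, eval_C] at h0
      linarith
    · have := euler _ _ hFs 0 1
      rw [one_mul, zero_mul, zero_add] at this
      rw [this]
      exact mul_ne_zero hd0 (h01 l)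
  · intro p hp
    have e : ![p 0, p 1] = p := by ext i; fin_cases i <;> rfl
    rw [← e, eval_shr]
    refine hFne _ fun h => hp ?_
    have a1 := congrFun h 0
    have a2 := congrFun h 1
    simp at a1 a2
    rw [a2] at a1
    rw [← e]
    ext i; fin_cases i
    · simpa using a1
    · simpa using a2
  · rintro ⟨x, y⟩
    simp only [hT, Finset.mem_image, Prod.mk.injEq, ev2, eval_shr]
    constructor
    · rintro ⟨q, hq, h1, h2⟩
      rw [hZs, ev2] at hq
      rw [← h1, ← h2, sub_add_cancel]; exact hq
    · intro h
      refine ⟨(x + l * y, y), (hZs _).2 h, by simp, rfl⟩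
  · intro p hp q hq hpq
    simp only [hT, Finset.mem_image] at hp hq
    obtain ⟨a, ha, rfl⟩ := hp
    obtain ⟨b, hb, rfl⟩ := hq
    simp only at hpq
    by_cases h2 : a.2 = b.2
    · have h1 : a.1 = b.1 := by rw [h2] at hpq; linarith
      rw [h1, h2]
    · exfalso
      apply hl2
      simp only [Finset.coe_image, Set.mem_image, Finset.mem_coe, Finset.mem_product]
      refine ⟨(a, b), ⟨ha, hb⟩, ?_⟩
      rw [div_eq_iff (sub_ne_zero.2 h2)]
      linarith


lemma sqf_C {R : Type*} [CommRing R] [IsDomain R] {P : R} (hP0 : P ≠ 0) (hP : Squarefree P) :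
    Squarefree (Polynomial.C P) := by
  intro g hg
  have hd : g.natDegree = 0 := by
    have h1 : g ∣ Polynomial.C P := (dvd_mul_right g g).trans hg
    have := Polynomial.natDegree_le_of_dvd h1 (by simpa using hP0)
    simpa using this
  rw [Polynomial.eq_C_of_natDegree_eq_zero hd] at hg ⊢
  rw [← Polynomial.C_mul, Polynomial.C_dvd_iff_dvd_coeff] at hg
  have := hg 0
  rw [Polynomial.coeff_C_zero] at this
  exact (hP _ this).map Polynomial.C

/-- a monic squarefree polynomial over an integrally closed domain of characteristic zero satisfies a
Bezout identity with its derivative -/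
lemma bezder {R : Type*} [CommRing R] [IsDomain R] [CharZero R] [IsIntegrallyClosed R]
    {p : Polynomial R} (hm : p.Monic) (hs : Squarefree p) :
    ∃ (r : R) (a b : Polynomial R), r ≠ 0 ∧
      a * p + b * Polynomial.derivative p = Polynomial.C r := by
  let K := FractionRing R
  have hinj : Function.Injective (algebraMap R K) := IsFractionRing.injective R K
  have : CharZero K := charZero_of_injective_algebraMap hinj
  have hsK : Squarefree (p.map (algebraMap R K)) := by
    intro g hg
    have h1 : g ∣ p.map (algebraMap R K) := (dvd_mul_right g g).trans hg
    have hp0 : p.map (algebraMap R K) ≠ 0 := (hm.map _).ne_zero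
    have hg0 : g ≠ 0 := fun h => hp0 (by rw [h, zero_dvd_iff] at h1; exact h1)
    obtain ⟨g', hg'⟩ := IsIntegrallyClosed.eq_map_mul_C_of_dvd K hm h1
    have hl : g.leadingCoeff ≠ 0 := Polynomial.leadingCoeff_ne_zero.2 hg0
    have hgm : (g'.map (algebraMap R K)).Monic := by
      have := congrArg Polynomial.leadingCoeff hg'
      rw [Polynomial.leadingCoeff_mul, Polynomial.leadingCoeff_C] at this
      exact mul_right_cancel₀ hl (by rw [this, one_mul])
    have hgm' : g'.Monic := Polynomial.monic_of_injective hinj hgm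
    have h2 : (g' * g').map (algebraMap R K) ∣ p.map (algebraMap R K) := by
      refine Dvd.dvd.trans ?_ hg
      rw [Polynomial.map_mul]
      refine mul_dvd_mul ?_ ?_ <;>
      · conv_rhs => rw [← hg']
        exact dvd_mul_right _ _
    have h3 := hs _ ((Polynomial.map_dvd_map _ hinj (hgm'.mul hgm')).1 h2)
    rw [← hg']
    refine IsUnit.mul ?_ ?_
    · exact h3.map (Polynomial.mapRingHom (algebraMap R K))
    · exact (isUnit_iff_ne_zero.2 hl).map Polynomial.C
  obtain ⟨a, b, hab⟩ := PerfectField.separable_iff_squarefree.2 hsK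
  obtain ⟨s, hs0, hs1⟩ := IsLocalization.integerNormalization_spec (nonZeroDivisors R) a
  obtain ⟨t, ht0, ht1⟩ := IsLocalization.integerNormalization_spec (nonZeroDivisors R) b
  set A := IsLocalization.integerNormalization (nonZeroDivisors R) a
  set B := IsLocalization.integerNormalization (nonZeroDivisors R) b
  refine ⟨s * t, Polynomial.C t * A, Polynomial.C s * B,
    mul_ne_zero (nonZeroDivisors.ne_zero hs0) (nonZeroDivisors.ne_zero ht0), ?_⟩
  apply Polynomial.map_injective _ hinj
  have e : ∀ (c : R) (g : Polynomial K), c • g = Polynomial.C (algebraMap R K c) * g := by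
    intro c g
    rw [← Polynomial.smul_eq_C_mul, algebraMap_smul]
  rw [e] at hs1 ht1
  rw [Polynomial.derivative_map] at hab
  simp only [Polynomial.map_add, Polynomial.map_mul, Polynomial.map_C, hs1, ht1, map_mul]
  linear_combination (Polynomial.C (algebraMap R K s) * Polynomial.C (algebraMap R K t)) * hab

/-- the substitution `w ↦ w + t q` -/
noncomputable def alf (q : Fin 3 → ℂ) :
    MvPolynomial (Fin 3) ℂ →ₐ[ℂ] Polynomial (MvPolynomial (Fin 3) ℂ) :=
  aeval (fun i => Polynomial.C (X i) + Polynomial.C (C (q i)) * Polynomial.X)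

noncomputable def tht (q : Fin 3 → ℂ) :
    Polynomial (MvPolynomial (Fin 3) ℂ) →+* Polynomial (MvPolynomial (Fin 3) ℂ) :=
  Polynomial.eval₂RingHom (alf q).toRingHom Polynomial.X

lemma alf_C (q : Fin 3 → ℂ) (a : ℂ) : alf q (C a) = Polynomial.C (C a) := by
  simp [alf, Polynomial.algebraMap_apply]

lemma tht_tht (q : Fin 3 → ℂ) (g : Polynomial (MvPolynomial (Fin 3) ℂ)) :
    tht (-q) (tht q g) = g := by
  have : (tht (-q)).comp (tht q) = RingHom.id _ := by
    apply Polynomial.ringHom_ext'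
    · apply MvPolynomial.ringHom_ext
      · intro r
        simp [tht]
      · intro i
        simp only [tht, alf, RingHom.comp_apply, RingHom.id_apply, Polynomial.coe_eval₂RingHom,
          Polynomial.eval₂_C, AlgHom.toRingHom_eq_coe, RingHom.coe_coe, aeval_X,
          Polynomial.eval₂_add, Polynomial.eval₂_mul, Polynomial.eval₂_X, Pi.neg_apply, map_neg]
        simp
        ring
    · simp [tht]
  exact congrArg (fun f => f g) this

lemma alf_sqf {q : Fin 3 → ℂ} {P : MvPolynomial (Fin 3) ℂ} (hP0 : P ≠ 0) (hP : Squarefree P) :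
    Squarefree (alf q P) := by
  have h1 : alf q P = tht q (Polynomial.C P) := by simp [tht]
  rw [h1]
  intro g hg
  have h2 := map_dvd (tht (-q)) hg
  rw [tht_tht, map_mul] at h2
  have h3 := (sqf_C hP0 hP _ h2).map (tht q)
  have h4 := tht_tht (-q) g
  rw [neg_neg] at h4
  rwa [h4] at h3

lemma alf_top {q : Fin 3 → ℂ} {P : MvPolynomial (Fin 3) ℂ} {d : ℕ} (hP : P.IsHomogeneous d) :
    (alf q P).natDegree ≤ d ∧ (alf q P).coeff d = C (eval q P) := by
  have h1 : ∀ i, (Polynomial.C (X i) + Polynomial.C (C (q i)) * Polynomial.X :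
      Polynomial (MvPolynomial (Fin 3) ℂ)).natDegree ≤ 1 := by
    intro i
    compute_degree
  have h2 : ∀ i, (Polynomial.C (X i) + Polynomial.C (C (q i)) * Polynomial.X :
      Polynomial (MvPolynomial (Fin 3) ℂ)).coeff 1 = C (q i) := by
    intro i
    simp [Polynomial.coeff_C]
  have key : ∀ s ∈ P.support, (alf q (monomial s (coeff s P))).natDegree ≤ d ∧
      (alf q (monomial s (coeff s P))).coeff d = C (eval q (monomial s (coeff s P))) := by
    intro s hs
    have hd := hom_deg hP (mem_support_iff.1 hs)
    rw [Finsupp.degree_eq_sum, Fin.sum_univ_three] at hd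
    have e : alf q (monomial s (coeff s P)) = Polynomial.C (C (coeff s P)) *
      ((Polynomial.C (X 0) + Polynomial.C (C (q 0)) * Polynomial.X) ^ s 0 *
       (Polynomial.C (X 1) + Polynomial.C (C (q 1)) * Polynomial.X) ^ s 1 *
       (Polynomial.C (X 2) + Polynomial.C (C (q 2)) * Polynomial.X) ^ s 2) := by
      rw [alf, aeval_monomial, Finsupp.prod_fintype _ _ (by simp), Fin.prod_univ_three]
      rfl
    have e' : eval q (monomial s (coeff s P)) = coeff s P * (q 0 ^ s 0 * q 1 ^ s 1 * q 2 ^ s 2) := by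
      rw [eval_monomial, Finsupp.prod_fintype _ _ (by simp), Fin.prod_univ_three]
    rw [e, e', ← hd]
    have a := fun i => Polynomial.natDegree_pow_le_of_le (s i) (h1 i)
    have b := fun i => Polynomial.coeff_pow_of_natDegree_le (m := s i) (h1 i)
    simp only [mul_one, h2] at a b
    have c1 := Polynomial.natDegree_mul_le_of_le (a 0) (a 1)
    have c2 := Polynomial.natDegree_mul_le_of_le c1 (a 2)
    have d1 := Polynomial.coeff_mul_add_eq_of_natDegree_le (a 0) (a 1)
    have d2 := Polynomial.coeff_mul_add_eq_of_natDegree_le c1 (a 2)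
    refine ⟨(Polynomial.natDegree_C_mul_le _ _).trans c2, ?_⟩
    rw [Polynomial.coeff_C_mul, d2, d1, b, b, b]
    simp
  constructor
  · rw [P.as_sum, map_sum]
    exact Polynomial.natDegree_sum_le_of_forall_le _ _ fun s hs => (key s hs).1
  · conv_lhs => rw [P.as_sum]
    conv_rhs => rw [P.as_sum]
    rw [map_sum, Polynomial.finsetSum_coeff, map_sum, map_sum]
    exact Finset.sum_congr rfl fun s hs => (key s hs).2

lemma alf_map (q w : Fin 3 → ℂ) (P : MvPolynomial (Fin 3) ℂ) :
    (alf q P).map (eval w) =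
      aeval (fun i => Polynomial.C (w i) + Polynomial.C (q i) * Polynomial.X) P := by
  induction P using MvPolynomial.induction_on with
  | C a => simp
  | add p q hp hq => simp only [map_add, Polynomial.map_add, hp, hq]
  | mul_X p i hp =>
    rw [map_mul, Polynomial.map_mul, hp, map_mul]
    simp [alf]

lemma line_disc {d : ℕ} {P : MvPolynomial (Fin 3) ℂ} (hP : P.IsHomogeneous d) (hs : Squarefree P)
    {q : Fin 3 → ℂ} (hq : eval q P ≠ 0) :
    ∃ r : MvPolynomial (Fin 3) ℂ, r ≠ 0 ∧ ∀ w, eval w r ≠ 0 →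
      (aeval (fun i => Polynomial.C (w i) + Polynomial.C (q i) * Polynomial.X) P :
        Polynomial ℂ).Separable := by
  have hP0 : P ≠ 0 := by rintro rfl; simp at hq
  obtain ⟨h1, h2⟩ := alf_top (q := q) hP
  have hu : IsUnit (Polynomial.C (C (eval q P)⁻¹ : MvPolynomial (Fin 3) ℂ)) :=
    ((isUnit_iff_ne_zero.2 (inv_ne_zero hq)).map C).map Polynomial.C
  set p := Polynomial.C (C (eval q P)⁻¹) * alf q P with hp
  have hm : p.Monic := by
    refine Polynomial.monic_of_natDegree_le_of_coeff_eq_one d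
      ((Polynomial.natDegree_C_mul_le _ _).trans h1) ?_
    rw [hp, Polynomial.coeff_C_mul, h2, ← C_mul, inv_mul_cancel₀ hq, C_1]
  have hps : Squarefree p := by
    intro g hg
    exact alf_sqf hP0 hs g ((hu.dvd_mul_left).1 hg)
  obtain ⟨r, a, b, hr, hab⟩ := bezder hm hps
  refine ⟨r, hr, fun w hw => ?_⟩
  have := congrArg (Polynomial.map (eval w)) hab
  rw [hp] at this
  simp only [Polynomial.derivative_mul, Polynomial.derivative_C, zero_mul, zero_add,
    Polynomial.map_add, Polynomial.map_mul, Polynomial.map_C, ← Polynomial.derivative_map,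
    alf_map, eval_C] at this
  refine ⟨Polynomial.C (eval w r)⁻¹ * (a.map (eval w) * Polynomial.C (eval q P)⁻¹),
    Polynomial.C (eval w r)⁻¹ * (b.map (eval w) * Polynomial.C (eval q P)⁻¹), ?_⟩
  have e : Polynomial.C (eval w r)⁻¹ * Polynomial.C (eval w r) = 1 := by
    rw [← Polynomial.C_mul, inv_mul_cancel₀ hw, Polynomial.C_1]
  rw [← e, ← this]
  ring


def det3 {R : Type*} [CommRing R] (a b c : Fin 3 → R) : R :=
  a 0 * (b 1 * c 2 - b 2 * c 1) - a 1 * (b 0 * c 2 - b 2 * c 0) + a 2 * (b 0 * c 1 - b 1 * c 0)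

lemma cramer3 {R : Type*} [CommRing R] (q w e v : Fin 3 → R) :
    det3 q w e • v = det3 v w e • q + det3 q v e • w + det3 q w v • e := by
  ext i
  fin_cases i <;> simp [det3] <;> ring

/-- the linear form `w ↦ det3 q w t` -/
noncomputable def lin3 (q t : Fin 3 → ℝ) : MvPolynomial (Fin 3) ℝ :=
  det3 (fun i => C (q i)) X (fun i => C (t i))

lemma eval_lin3 (q t w : Fin 3 → ℝ) : eval w (lin3 q t) = det3 q w t := by
  simp [lin3, det3]

lemma lin3_ne {q t : Fin 3 → ℝ} (hq : q ≠ 0) (ht : ∀ c : ℝ, t ≠ c • q) : lin3 q t ≠ 0 := by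
  intro h
  have h' : ∀ w, det3 q w t = 0 := fun w => by rw [← eval_lin3, h, map_zero]
  have h0 := h' ![1, 0, 0]
  have h1 := h' ![0, 1, 0]
  have h2 := h' ![0, 0, 1]
  simp [det3] at h0 h1 h2
  obtain ⟨i, hi⟩ := Function.ne_iff.1 hq
  have hi' : q i ≠ 0 := hi
  apply ht (t i / q i)
  ext j
  simp only [Pi.smul_apply, smul_eq_mul]
  rw [div_mul_eq_mul_div, eq_div_iff hi']
  fin_cases i <;> fin_cases j <;> simp <;> linarith

lemma exists_indep (q : Fin 3 → ℝ) : ∃ t : Fin 3 → ℝ, ∀ c : ℝ, t ≠ c • q := by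
  by_contra hcon
  push Not at hcon
  obtain ⟨a, ha⟩ := hcon ![1, 0, 0]
  obtain ⟨b, hb⟩ := hcon ![0, 1, 0]
  have a0 := congrFun ha 0
  have a1 := congrFun ha 1
  have b1 := congrFun hb 1
  have b0 := congrFun hb 0
  simp at a0 a1 b0 b1
  rcases a1 with h | h
  · rw [h] at a0; simp at a0
  · rw [h] at b1; simp at b1

lemma choose_w {r : MvPolynomial (Fin 3) ℂ} (hr : r ≠ 0) {q : Fin 3 → ℝ} (hq : q ≠ 0)
    (T : Finset (Fin 3 → ℝ)) (hT : ∀ t ∈ T, ∀ c : ℝ, t ≠ c • q) :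
    ∃ w : Fin 3 → ℝ, eval (fun i => (w i : ℂ)) r ≠ 0 ∧ ∀ t ∈ T, det3 q w t ≠ 0 := by
  by_contra hcon
  push Not at hcon
  have hG : r * ∏ t ∈ T, cx (lin3 q t) ≠ 0 := by
    refine mul_ne_zero hr (Finset.prod_ne_zero_iff.2 fun t ht h => ?_)
    refine lin3_ne hq (hT t ht) (cx_injective ?_)
    rw [h]; simp [cx]
  apply hG
  refine funext_set (fun _ => Set.range ((↑) : ℝ → ℂ))
    (fun _ => Set.infinite_range_of_injective Complex.ofReal_injective) ?_
  intro x hx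
  rw [map_zero]
  have hx' : ∀ i, ∃ y : ℝ, (y : ℂ) = x i := fun i => hx i (Set.mem_univ i)
  choose w hw using hx'
  have hxw : x = fun i => (w i : ℂ) := funext fun i => (hw i).symm
  rw [map_mul, map_prod, mul_eq_zero, Finset.prod_eq_zero_iff]
  by_cases h0 : eval x r = 0
  · exact Or.inl h0
  · right
    rw [hxw] at h0
    obtain ⟨t, ht, h⟩ := hcon w h0
    refine ⟨t, ht, ?_⟩
    rw [hxw]
    have := eval_cx_real (lin3 q t) w
    rw [eval_lin3, h] at this
    simpa using this

lemma cx_aeval {σ τ : Type*} (b : σ → MvPolynomial τ ℝ) (P : MvPolynomial σ ℝ) :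
    cx (aeval b P) = aeval (fun i => cx (b i)) (cx P) := by
  unfold cx
  induction P using MvPolynomial.induction_on with
  | C a => simp [algebraMap_eq]
  | add p q hp hq => simp only [map_add, hp, hq]
  | mul_X p i hp =>
    rw [map_mul, map_mul, hp, map_mul, map_mul]
    simp

/-- `F` is the top form of `u` in degree `n` -/
def TopF (u F : MvPolynomial (Fin 2) ℂ) (n : ℕ) : Prop := F.IsHomogeneous n ∧ u - F ∈ DL n

lemma TopF.mul {u F v G : MvPolynomial (Fin 2) ℂ} {n k : ℕ} (h1 : TopF u F n) (h2 : TopF v G k) :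
    TopF (u * v) (F * G) (n + k) := by
  refine ⟨h1.1.mul h2.1, ?_⟩
  have hv : v ∈ DL (k + 1) := by
    have := add_mem (DL_mono (Nat.le_succ k) h2.2) (DL_of_hom h2.1 (Nat.lt_succ_self k))
    rwa [sub_add_cancel] at this
  exact DL_top_mul (DL_of_hom h1.1 (Nat.lt_succ_self n)) hv h1.2 h2.2 (by omega) (by omega)

lemma TopF.C (c : ℂ) : TopF (C c) (C c) 0 := ⟨isHomogeneous_C _ _, by rw [sub_self]; exact zero_mem _⟩

lemma TopF.pow {u F : MvPolynomial (Fin 2) ℂ} (h1 : TopF u F 1) (n : ℕ) :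
    TopF (u ^ n) (F ^ n) n := by
  induction n with
  | zero => simpa using TopF.C 1
  | succ n ih => rw [pow_succ, pow_succ]; exact ih.mul h1

lemma TopF.aeval {P : MvPolynomial (Fin 3) ℂ} {d : ℕ} (hP : P.IsHomogeneous d)
    {b a : Fin 3 → MvPolynomial (Fin 2) ℂ} (h : ∀ i, TopF (b i) (a i) 1) :
    MvPolynomial.aeval b P - MvPolynomial.aeval a P ∈ DL d := by
  rw [P.as_sum, map_sum, map_sum, ← Finset.sum_sub_distrib]
  refine sum_mem fun s hs => ?_
  have hd := hom_deg hP (mem_support_iff.1 hs)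
  rw [Finsupp.degree_eq_sum, Fin.sum_univ_three] at hd
  rw [aeval_monomial, aeval_monomial, Finsupp.prod_fintype _ _ (by simp),
    Finsupp.prod_fintype _ _ (by simp), Fin.prod_univ_three, Fin.prod_univ_three]
  have := (TopF.C (coeff s P)).mul ((((h 0).pow (s 0)).mul ((h 1).pow (s 1))).mul ((h 2).pow (s 2)))
  rw [zero_add, hd] at this
  exact this.2

lemma main_bound (m : ℕ) (P : MvPolynomial (Fin 3) ℝ) (hP : P ≠ 0)
    (hhom : P.IsHomogeneous (2 * m + 2)) (hsf : Squarefree (cx P)) (hfin : (RZ P).Finite) :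
    2 * (RZ P).ncard ≤ 3 * m ^ 2 + 3 * m + 2 := by
  classical
  obtain ⟨q, hqP⟩ : ∃ q, eval q P ≠ 0 := by
    by_contra hcon
    push Not at hcon
    exact hP (MvPolynomial.funext fun x => by rw [hcon x, map_zero])
  have hq0 : q ≠ 0 := by
    rintro rfl
    apply hqP
    have := hom_smul hhom 0 0
    rw [zero_smul, zero_pow (by omega), zero_mul] at this
    exact this
  obtain ⟨e, he⟩ := exists_indep q
  have hmemRZ : ∀ z, z ∈ RZ P ↔ eval z.rep P = 0 := fun z => Iff.rfl
  obtain ⟨r, hr, hrsep⟩ := line_disc (cx_hom hhom) hsf (q := fun i => (q i : ℂ)) (by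
    rw [eval_cx_real]; exact_mod_cast hqP)
  obtain ⟨w, hw, hwT⟩ := choose_w hr hq0 (insert e (hfin.toFinset.image Projectivization.rep)) (by
    intro t ht c hc
    rw [Finset.mem_insert, Finset.mem_image] at ht
    rcases ht with rfl | ⟨z, hz, rfl⟩
    · exact he c hc
    · rw [Set.Finite.mem_toFinset, hmemRZ, hc, hom_smul hhom] at hz
      rcases mul_eq_zero.1 hz with h | h
      · have h0 := pow_eq_zero_iff (by omega) |>.1 h
        rw [h0, zero_smul] at hc
        exact z.rep_nonzero hc
      · exact hqP h)
  have hD : det3 q w e ≠ 0 := hwT e (Finset.mem_insert_self _ _)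
  have hZ : ∀ z ∈ RZ P, det3 q w z.rep ≠ 0 := fun z hz =>
    hwT _ (Finset.mem_insert_of_mem (Finset.mem_image_of_mem _ (hfin.mem_toFinset.2 hz)))
  have hsep := hrsep _ hw
  set a : Fin 3 → MvPolynomial (Fin 2) ℝ := fun j => C (q j) * X 0 + C (w j) * X 1 with ha
  set b : Fin 3 → MvPolynomial (Fin 2) ℝ := fun j => C (q j) * X 0 + C (w j) * X 1 + C (e j) with hb
  have hahom : ∀ j, (a j).IsHomogeneous 1 := fun j => by
    refine IsHomogeneous.add ?_ ?_
    · simpa using (isHomogeneous_C (Fin 2) (q j)).mul (isHomogeneous_X ℝ (0 : Fin 2))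
    · simpa using (isHomogeneous_C (Fin 2) (w j)).mul (isHomogeneous_X ℝ (1 : Fin 2))
  have hF : (aeval a P).IsHomogeneous (2 * m + 2) := by
    have := hhom.aeval a hahom
    rwa [one_mul] at this
  have heva : ∀ p : Fin 2 → ℝ, eval p (aeval a P) = eval (p 0 • q + p 1 • w) P := by
    intro p
    rw [aeval_def, algebraMap_eq, eval₂_eq_eval_map, ← eval₂_eq_eval_map, MvPolynomial.eval_eval₂]
    rw [eval₂_eq_eval_map]
    have : (eval p).comp (C : ℝ →+* MvPolynomial (Fin 2) ℝ) = RingHom.id ℝ := by ext; simp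
    rw [this, map_id]
    congr 2
    ext j
    simp [ha]; ring
  have hevb : ∀ p : Fin 2 → ℝ, eval p (aeval b P) = eval (p 0 • q + p 1 • w + e) P := by
    intro p
    rw [aeval_def, algebraMap_eq, MvPolynomial.eval_eval₂]
    rw [eval₂_eq_eval_map]
    have : (eval p).comp (C : ℝ →+* MvPolynomial (Fin 2) ℝ) = RingHom.id ℝ := by ext; simp
    rw [this, map_id]
    congr 2
    ext j
    simp [hb]; ring
  have hdetw : ∀ x y z : ℝ, det3 q w (x • q + y • w + z • e) = z * det3 q w e := by
    intro x y z; simp [det3]; ring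
  have hdetx : ∀ x y z : ℝ, det3 (x • q + y • w + z • e) w e = x * det3 q w e := by
    intro x y z; simp [det3]; ring
  have hdety : ∀ x y z : ℝ, det3 q (x • q + y • w + z • e) e = y * det3 q w e := by
    intro x y z; simp [det3]; ring
  have hdec : ∀ z ∈ RZ P, z.rep = (det3 q w z.rep / det3 q w e) •
      ((det3 z.rep w e / det3 q w z.rep) • q + (det3 q z.rep e / det3 q w z.rep) • w + e) := by
    intro z hz
    have h1 := hZ z hz
    have h2 := cramer3 q w e z.rep
    ext i
    have h3 := congrFun h2 i
    simp only [Pi.smul_apply, Pi.add_apply, smul_eq_mul] at h3 ⊢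
    field_simp
    linear_combination h3
  -- the chart
  set Ψ : Projectivization ℝ (Fin 3 → ℝ) → ℝ × ℝ := fun z =>
    (det3 z.rep w e / det3 q w z.rep, det3 q z.rep e / det3 q w z.rep) with hΨ
  have hΨinj : Set.InjOn Ψ (RZ P) := by
    intro z hz z' hz' h
    have d1 := hdec z hz
    have d2 := hdec z' hz'
    have h1 : det3 z.rep w e / det3 q w z.rep = det3 z'.rep w e / det3 q w z'.rep := congrArg Prod.fst h
    have h2 : det3 q z.rep e / det3 q w z.rep = det3 q z'.rep e / det3 q w z'.rep := congrArg Prod.snd h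
    have n1 := hZ z hz
    have n2 := hZ z' hz'
    rw [← z.mk_rep, ← z'.mk_rep, Projectivization.mk_eq_mk_iff']
    refine ⟨det3 q w z.rep / det3 q w z'.rep, ?_⟩
    have e1 : z.rep = (det3 q w z.rep / det3 q w z'.rep) • z'.rep := by
      have : (det3 q w z.rep / det3 q w z'.rep) • z'.rep = (det3 q w z.rep / det3 q w z'.rep) •
        ((det3 q w z'.rep / det3 q w e) •
      ((det3 z'.rep w e / det3 q w z'.rep) • q + (det3 q z'.rep e / det3 q w z'.rep) • w + e)) := by
        rw [← d2]
      rw [this, ← h1, ← h2, smul_smul, div_mul_div_comm, mul_comm (det3 q w z'.rep) (det3 q w e),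
        mul_div_mul_right _ _ n2]
      exact d1
    exact e1.symm
  have hmem : ∀ p : ℝ × ℝ, p ∈ Ψ '' (RZ P) ↔ ev2 (aeval b P) p.1 p.2 = 0 := by
    rintro ⟨x, y⟩
    rw [ev2, hevb]
    simp only [Matrix.cons_val_zero, Matrix.cons_val_one]
    constructor
    · rintro ⟨z, hz, h⟩
      have d1 := hdec z hz
      have h1 : det3 z.rep w e / det3 q w z.rep = x := congrArg Prod.fst h
      have h2 : det3 q z.rep e / det3 q w z.rep = y := congrArg Prod.snd h
      have hz' := (hmemRZ z).1 hz
      rw [h1, h2] at d1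
      rw [d1, hom_smul hhom] at hz'
      exact (mul_eq_zero.1 hz').resolve_left (pow_ne_zero _ (div_ne_zero (hZ z hz) hD))
    · intro h
      set v := x • q + y • w + e with hv
      have hv1 : v = x • q + y • w + (1:ℝ) • e := by rw [one_smul]
      have hv0 : v ≠ 0 := by
        intro h0
        have := hdetw x y 1
        rw [← hv1, h0] at this
        simp [det3] at this
        apply hD; rw [det3]; linarith
      obtain ⟨c, hc⟩ := Projectivization.exists_smul_eq_mk_rep ℝ v hv0
      have hc' : (c : ℝ) • v = (Projectivization.mk ℝ v hv0).rep := hc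
      have hc0 : (c : ℝ) ≠ 0 := c.ne_zero
      refine ⟨Projectivization.mk ℝ v hv0, ?_, ?_⟩
      · rw [hmemRZ, ← hc', hom_smul hhom, h, mul_zero]
      · have hcv : (c : ℝ) • v = ((c : ℝ) * x) • q + ((c : ℝ) * y) • w + (c : ℝ) • e := by
          rw [hv, smul_add, smul_add, smul_smul, smul_smul]
        simp only [hΨ]
        rw [← hc', hcv, hdetw, hdetx, hdety]
        ext
        · simp only; field_simp
        · simp only; field_simp
  have hfinΨ := hfin.image Ψ
  have hcard : hfinΨ.toFinset.card = (RZ P).ncard := by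
    rw [← Set.ncard_eq_toFinset_card _ hfinΨ, hΨinj.ncard_image]
  rw [← hcard]
  refine affine_bound2 (f := aeval b P) (F := aeval a P) hF ?_ ?_ ?_ hfinΨ.toFinset ?_
  · rw [cx_aeval, cx_aeval]
    refine TopF.aeval (cx_hom hhom) fun i => ⟨cx_hom (hahom i), ?_⟩
    have : cx (b i) - cx (a i) = C ((e i : ℝ) : ℂ) := by simp [hb, ha, cx]
    rw [this]
    exact DL_of_hom (isHomogeneous_C _ _) Nat.zero_lt_one
  · convert hsep using 1
    rw [cx_aeval, dlt, ← AlgHom.comp_apply, comp_aeval]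
    congr 2
    ext1 j
    simp [ha, cx, add_comm]
  · intro p hp h0
    rw [heva] at h0
    set v := p 0 • q + p 1 • w with hv
    have hv1 : v = p 0 • q + p 1 • w + (0:ℝ) • e := by rw [zero_smul, add_zero]
    have hdv : det3 q w v = 0 := by rw [hv1, hdetw, zero_mul]
    have hv0 : v ≠ 0 := by
      intro hv0
      have x1 := hdetx (p 0) (p 1) 0
      have y1 := hdety (p 0) (p 1) 0
      rw [← hv1, hv0] at x1 y1
      have z1 : det3 (0 : Fin 3 → ℝ) w e = 0 := by simp [det3]
      have z2 : det3 q (0 : Fin 3 → ℝ) e = 0 := by simp [det3]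
      rw [z1] at x1
      rw [z2] at y1
      apply hp
      ext i
      fin_cases i
      · exact (mul_eq_zero.1 x1.symm).resolve_right hD
      · exact (mul_eq_zero.1 y1.symm).resolve_right hD
    obtain ⟨c, hc⟩ := Projectivization.exists_smul_eq_mk_rep ℝ v hv0
    have hc' : (c : ℝ) • v = (Projectivization.mk ℝ v hv0).rep := hc
    refine hZ (Projectivization.mk ℝ v hv0) ?_ ?_
    · rw [hmemRZ, ← hc', hom_smul hhom, h0, mul_zero]
    · rw [← hc']
      have : det3 q w ((c:ℝ) • v) = c * det3 q w v := by simp [det3]; ring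
      rw [this, hdv, mul_zero]
  · intro p
    rw [Set.Finite.mem_toFinset]
    exact hmem p

theorem stmt_0 (k : ℕ) (hk : 1 ≤ k) (P : MvPolynomial (Fin 3) ℝ) (hP : P ≠ 0)
    (hhom : P.IsHomogeneous (2 * k))
    (hsf : Squarefree (MvPolynomial.map (algebraMap ℝ ℂ) P))
    (hfin : (RZ P).Finite) :
    ((RZ P).ncard : ℚ) ≤ 3 / 2 * k * (k - 1) + 1 := by
  obtain ⟨m, rfl⟩ : ∃ m, k = m + 1 := ⟨k - 1, by omega⟩
  have h := main_bound m P hP (by rwa [show 2 * m + 2 = 2 * (m + 1) by ring]) hsf hfin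
  have h' : (2 : ℚ) * ((RZ P).ncard : ℚ) ≤ 3 * (m : ℚ) ^ 2 + 3 * m + 2 := by exact_mod_cast h
  push_cast
  nlinarith
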